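/- arXiv:1903.10656 — 2 statements merged into one kernel-verified Lean document; each statement's English description precedes it below -/
import Mathlib

section
/- Suppose Assumption (V) and Assumption (φ) hold. Then for all sufficiently large M > 0, the Hausdorff distance d_H(σ((H_h + M)⁻¹), σ((H + M)⁻¹)) between the spectra of the bounded operators (H_h + M)⁻¹ on ℓ²(hℤ^d) and (H + M)⁻¹ on L²(ℝ^d) tends to 0 as h → 0. -/
open MeasureTheory Complex Real
open scoped FourierTransform InnerProductSpace ENNReal ComplexConjugate

noncomputable section

abbrev Euc (d : ℕ) : Type := EuclideanSpace ℝ (Fin d)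
abbrev Zd (d : ℕ) : Type := Fin d → ℤ

instance (d : ℕ) : MeasurableSingletonClass (Zd d) := by
  constructor
  intro f
  have : ({f} : Set (Zd d)) = Set.univ.pi fun j => {f j} := by
    ext g; simp [Set.eq_univ_iff_forall, funext_iff, Set.mem_pi, eq_comm]
  rw [this]
  exact MeasurableSet.univ_pi fun j => measurableSet_singleton _

/-- The measure on `ℤ^d` giving mass `h^d` to each point, so that `L²` of this measure is
`ℓ²(hℤ^d)` with norm `‖v‖_h² = h^d ∑_z |v(hz)|²`. -/
def latMeas (d : ℕ) (h : ℝ) : Measure (Zd d) := (ENNReal.ofReal (h ^ d)) • Measure.count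

/-- `L²(ℝ^d)`. -/
abbrev L2 (d : ℕ) := Lp ℂ 2 (volume : Measure (Euc d))

/-- `ℓ²(hℤ^d)`. -/
abbrev l2h (d : ℕ) (h : ℝ) := Lp ℂ 2 (latMeas d h)

/-- The lattice point `hz ∈ ℝ^d` associated to `z ∈ ℤ^d`. -/
def latPt (d : ℕ) (h : ℝ) (z : Zd d) : Euc d :=
  (EuclideanSpace.equiv (Fin d) ℝ).symm fun j => h * (z j : ℝ)

/-- The vector in `ℝ^d` associated to `n ∈ ℤ^d`. -/
def latVec (d : ℕ) (n : Zd d) : Euc d :=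
  (EuclideanSpace.equiv (Fin d) ℝ).symm fun j => (n j : ℝ)

/-- `P_h : L²(ℝ^d) → ℓ²(hℤ^d)`, `P_h u (z) = h^{−d} ∫ conj(φ(h⁻¹(x−z))) u(x) dx`. -/
def IsProjOp (d : ℕ) (h : ℝ) (φ : SchwartzMap (Euc d) ℂ)
    (Ph : L2 d →L[ℂ] l2h d h) : Prop :=
  ∀ u : L2 d, ∀ z : Zd d,
    (Ph u : Zd d → ℂ) z =
      (h ^ d : ℂ)⁻¹ * ∫ x, conj (φ (h⁻¹ • (x - latPt d h z))) * (u : Euc d → ℂ) x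

/-- The Laplacian `Δu(x) = ∑_j ∂²u/∂x_j²(x)` of a function on `ℝ^d`. -/
def lapl (d : ℕ) (u : Euc d → ℂ) (x : Euc d) : ℂ :=
  ∑ j : Fin d, fderiv ℝ (fun y => fderiv ℝ u y (EuclideanSpace.single j (1 : ℝ))) x
      (EuclideanSpace.single j (1 : ℝ))

/-- `H` is the continuum Schrödinger operator `−Δ + V`:  a self-adjoint operator on
`L²(ℝ^d)` whose action on every smooth compactly supported function is `−Δu + Vu`.
(Under Assumption (V), `−Δ + V` is essentially self-adjoint on `C_c^∞(ℝ^d)`, so these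
conditions uniquely determine `H` as its self-adjoint closure.) -/
def IsSchrodingerOp (d : ℕ) (V : Euc d → ℝ) (H : L2 d →ₗ.[ℂ] L2 d) : Prop :=
  IsSelfAdjoint H ∧
  ∀ (u : Euc d → ℂ) (_ : ContDiff ℝ (⊤ : ℕ∞) u) (_ : HasCompactSupport u)
    (hu2 : MemLp u 2 (volume : Measure (Euc d)))
    (hHu2 : MemLp (fun x => -(lapl d u x) + (V x : ℂ) * u x) 2 (volume : Measure (Euc d))),
    ∃ hdom : hu2.toLp u ∈ H.domain,
      H ⟨hu2.toLp u, hdom⟩ = hHu2.toLp (fun x => -(lapl d u x) + (V x : ℂ) * u x)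

/-- The pointwise action of the discrete Schrödinger operator `H_h = H_{0,h} + V`:
`(H_h v)(hz) = h⁻² ∑_j (2v(hz) − v(hz+he_j) − v(hz−he_j)) + V(hz) v(hz)`. -/
def discAct (d : ℕ) (h : ℝ) (V : Euc d → ℝ) (v : Zd d → ℂ) (z : Zd d) : ℂ :=
  (h ^ 2 : ℂ)⁻¹ * ∑ j : Fin d, (2 * v z - v (z + Pi.single j 1) - v (z - Pi.single j 1))
    + (V (latPt d h z) : ℂ) * v z

/-- `H_h` is the (self-adjoint) discrete Schrödinger operator `H_{0,h} + V` on `ℓ²(hℤ^d)`,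
with its natural (maximal) domain. -/
def IsDiscreteHam (d : ℕ) (h : ℝ) (V : Euc d → ℝ)
    (Hh : l2h d h →ₗ.[ℂ] l2h d h) : Prop :=
  (∀ v : l2h d h,
    MemLp (discAct d h V (v : Zd d → ℂ)) 2 (latMeas d h) → v ∈ Hh.domain) ∧
  (∀ v : Hh.domain, ∀ z : Zd d,
    (Hh v : Zd d → ℂ) z = discAct d h V ((v : l2h d h) : Zd d → ℂ) z)

/-- `R` is the resolvent `(H − μ)⁻¹` of the (possibly unbounded) operator `H`:  a bounded
operator which is a two-sided inverse of `H − μ`. -/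
def IsResolventAt {E : Type*} [NormedAddCommGroup E] [NormedSpace ℂ E]
    (H : E →ₗ.[ℂ] E) (μ : ℂ) (R : E →L[ℂ] E) : Prop :=
  (∀ w : E, ∃ hd : R w ∈ H.domain, H ⟨R w, hd⟩ - μ • R w = w) ∧
  (∀ u : H.domain, R (H u - μ • (u : E)) = u)

/-- The `L²` norm of a function on `ℝ^d`, as a real number. -/
def l2norm {d : ℕ} (f : Euc d → ℂ) : ℝ := (eLpNorm f 2 (volume : Measure (Euc d))).toReal

/-- The `j`-th standard basis vector of `ℝ^d`. -/
def stdVec (d : ℕ) (j : Fin d) : Euc d := EuclideanSpace.single j (1 : ℝ)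

/-- The negative second difference `2u(x) − u(x+s) − u(x−s)`. -/
def secDiff {d : ℕ} (s : Euc d) (u : Euc d → ℂ) (x : Euc d) : ℂ :=
  2 * u x - u (x + s) - u (x - s)

/-- The finite difference Laplacian on functions on `ℝ^d`. -/
def diffLap {d : ℕ} (h : ℝ) (u : Euc d → ℂ) (x : Euc d) : ℂ :=
  ∑ j : Fin d, ((h ^ 2)⁻¹ : ℝ) * secDiff (h • stdVec d j) u x

section L2Tools

variable {d : ℕ} {f g u w : Euc d → ℂ}

lemma l2norm_nonneg (f : Euc d → ℂ) : 0 ≤ l2norm f := ENNReal.toReal_nonneg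

lemma MeasureTheory.MemLp.conj (hf : MemLp f 2 volume) : MemLp (fun x => conj (f x)) 2 volume :=
  hf.star

lemma integrable_conj_mul (hf : MemLp f 2 volume) (hg : MemLp g 2 volume) :
    Integrable fun x => conj (f x) * g x :=
  hf.conj.integrable_mul hg

lemma integrable_norm_mul (hf : MemLp f 2 volume) (hg : MemLp g 2 volume) :
    Integrable fun x => ‖f x‖ * ‖g x‖ :=
  hf.norm.integrable_mul hg.norm

lemma norm_toLp_eq_l2norm (hf : MemLp f 2 volume) : ‖hf.toLp f‖ = l2norm f := Lp.norm_toLp f hf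

lemma inner_toLp_toLp (hf : MemLp f 2 volume) (hg : MemLp g 2 volume) :
    ⟪hf.toLp f, hg.toLp g⟫_ℂ = ∫ x, conj (f x) * g x := by
  rw [L2.inner_def]
  refine integral_congr_ae ?_
  filter_upwards [hf.coeFn_toLp, hg.coeFn_toLp] with x h1 h2
  rw [h1, h2, RCLike.inner_apply, mul_comm]

lemma norm_integral_conj_mul_le (hf : MemLp f 2 volume) (hg : MemLp g 2 volume) :
    ‖∫ x, conj (f x) * g x‖ ≤ l2norm f * l2norm g := by
  rw [← inner_toLp_toLp hf hg, ← norm_toLp_eq_l2norm hf, ← norm_toLp_eq_l2norm hg]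
  exact norm_inner_le_norm _ _

lemma l2norm_norm (f : Euc d → ℂ) : l2norm (fun x => (‖f x‖ : ℂ)) = l2norm f := by
  unfold l2norm
  congr 1
  refine eLpNorm_congr_norm_ae (.of_forall fun x => ?_)
  simp

lemma integral_conj_mul_self (f : Euc d → ℂ) :
    ∫ x, conj (f x) * f x = ((∫ x, ‖f x‖ ^ 2 : ℝ) : ℂ) := by
  rw [← integral_complex_ofReal]
  congr 1
  ext x
  rw [← Complex.normSq_eq_conj_mul_self, Complex.normSq_eq_norm_sq]

lemma l2norm_sq (hf : MemLp f 2 volume) : l2norm f ^ 2 = ∫ x, ‖f x‖ ^ 2 := by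
  have h := inner_self_eq_norm_sq_to_K (𝕜 := ℂ) (hf.toLp f)
  rw [inner_toLp_toLp hf hf, integral_conj_mul_self, norm_toLp_eq_l2norm] at h
  exact_mod_cast (Complex.ofReal_injective (by simpa using h)).symm

lemma integrable_norm_sq (hf : MemLp f 2 volume) : Integrable fun x => ‖f x‖ ^ 2 :=
  (memLp_two_iff_integrable_sq_norm hf.1).1 hf

lemma integral_norm_mul_le (hf : MemLp f 2 volume) (hg : MemLp g 2 volume) :
    ∫ x, ‖f x‖ * ‖g x‖ ≤ l2norm f * l2norm g := by
  have hf' : MemLp (fun x => (‖f x‖ : ℂ)) 2 volume := hf.norm.ofReal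
  have hg' : MemLp (fun x => (‖g x‖ : ℂ)) 2 volume := hg.norm.ofReal
  have h := norm_integral_conj_mul_le hf' hg'
  rw [l2norm_norm, l2norm_norm] at h
  refine le_trans ?_ h
  have : ∫ x, conj (‖f x‖ : ℂ) * (‖g x‖ : ℂ) = ((∫ x, ‖f x‖ * ‖g x‖ : ℝ) : ℂ) := by
    rw [← integral_complex_ofReal]
    congr 1
    ext x
    simp
  rw [this, Complex.norm_real]
  exact le_abs_self _

lemma l2norm_add_le (hf : MemLp f 2 volume) (hg : MemLp g 2 volume) :
    l2norm (fun x => f x + g x) ≤ l2norm f + l2norm g := by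
  rw [← norm_toLp_eq_l2norm hf, ← norm_toLp_eq_l2norm hg]
  refine le_trans (norm_toLp_eq_l2norm (hf.add hg)).ge ?_
  exact norm_add_le (hf.toLp f) (hg.toLp g)

lemma l2norm_sub_le (hf : MemLp f 2 volume) (hg : MemLp g 2 volume) :
    l2norm (fun x => f x - g x) ≤ l2norm f + l2norm g := by
  rw [← norm_toLp_eq_l2norm hf, ← norm_toLp_eq_l2norm hg]
  refine le_trans (norm_toLp_eq_l2norm (hf.sub hg)).ge ?_
  exact norm_sub_le (hf.toLp f) (hg.toLp g)

lemma l2norm_mono (hg : MemLp g 2 volume) (h : ∀ x, ‖f x‖ ≤ ‖g x‖) : l2norm f ≤ l2norm g :=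
  ENNReal.toReal_mono hg.2.ne (eLpNorm_mono h)

lemma l2norm_const_mul (c : ℂ) (f : Euc d → ℂ) : l2norm (fun x => c * f x) = ‖c‖ * l2norm f := by
  unfold l2norm
  have := eLpNorm_const_smul c f 2 (volume : Measure (Euc d))
  simp only [Pi.smul_def, smul_eq_mul] at this
  rw [this, ENNReal.toReal_mul]
  simp

lemma memLp_shift (hf : MemLp f 2 volume) (s : Euc d) : MemLp (fun x => f (x + s)) 2 volume :=
  hf.comp_measurePreserving (measurePreserving_add_right volume s)

lemma memLp_shift_sub (hf : MemLp f 2 volume) (s : Euc d) : MemLp (fun x => f (x - s)) 2 volume := by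
  simpa [sub_eq_add_neg] using memLp_shift hf (-s)

lemma l2norm_shift (hf : MemLp f 2 volume) (s : Euc d) : l2norm (fun x => f (x + s)) = l2norm f := by
  unfold l2norm
  exact congrArg _ (eLpNorm_comp_measurePreserving hf.1 (measurePreserving_add_right volume s))

lemma memLp_secDiff (hf : MemLp f 2 volume) (s : Euc d) : MemLp (secDiff s f) 2 volume :=
  ((hf.const_mul 2).sub (memLp_shift hf s)).sub (memLp_shift_sub hf s)

lemma memLp_diffLap (hf : MemLp f 2 volume) (h : ℝ) : MemLp (diffLap h f) 2 volume :=
  memLp_finsetSum _ fun j _ => (memLp_secDiff hf (h • stdVec d j)).const_mul _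

lemma integral_conj_mul_secDiff (hw : MemLp w 2 volume) (hu : MemLp u 2 volume) (s : Euc d) :
    ∫ x, conj (w x) * secDiff s u x =
      ∫ x, conj (w (x + s) - w x) * (u (x + s) - u x) := by
  have hws := memLp_shift hw s
  have hus := memLp_shift hu s
  have hus' := memLp_shift_sub hu s
  have e1 : ∫ x, conj (w x) * u (x - s) = ∫ x, conj (w (x + s)) * u x := by
    rw [← integral_add_right_eq_self (fun x => conj (w x) * u (x - s)) s]
    simp
  have e2 : ∫ x, conj (w (x + s)) * u (x + s) = ∫ x, conj (w x) * u x :=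
    integral_add_right_eq_self (fun x => conj (w x) * u x) s
  have i1 := integrable_conj_mul hw hu
  have i2 := integrable_conj_mul hw hus
  have i3 := integrable_conj_mul hw hus'
  have i4 := integrable_conj_mul hws hu
  have i5 := integrable_conj_mul hws hus
  have l : ∫ x, conj (w x) * secDiff s u x =
      2 * (∫ x, conj (w x) * u x) - (∫ x, conj (w x) * u (x + s))
        - ∫ x, conj (w x) * u (x - s) := by
    have i12 : Integrable fun x => 2 * (conj (w x) * u x) - conj (w x) * u (x + s) :=
      (i1.const_mul 2).sub i2
    rw [← integral_const_mul, ← integral_sub (i1.const_mul 2) i2, ← integral_sub i12 i3]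
    congr 1
    ext x
    simp only [secDiff]
    ring
  have r : ∫ x, conj (w (x + s) - w x) * (u (x + s) - u x) =
      (∫ x, conj (w (x + s)) * u (x + s)) - (∫ x, conj (w (x + s)) * u x)
        - (∫ x, conj (w x) * u (x + s)) + ∫ x, conj (w x) * u x := by
    have i54 : Integrable fun x => conj (w (x + s)) * u (x + s) - conj (w (x + s)) * u x :=
      i5.sub i4
    have i542 : Integrable fun x => conj (w (x + s)) * u (x + s) - conj (w (x + s)) * u x
        - conj (w x) * u (x + s) := i54.sub i2
    rw [← integral_sub i5 i4, ← integral_sub i54 i2, ← integral_add i542 i1]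
    congr 1
    ext x
    simp only [map_sub]
    ring
  rw [l, r, e1, e2]
  ring

lemma integral_conj_mul_diffLap (hw : MemLp w 2 volume) (hu : MemLp u 2 volume) (h : ℝ) :
    ∫ x, conj (w x) * diffLap h u x =
      ∑ j : Fin d, ((h ^ 2)⁻¹ : ℝ) * ∫ x, conj (w x) * secDiff (h • stdVec d j) u x := by
  simp only [diffLap, Finset.mul_sum]
  rw [integral_finsetSum]
  · refine Finset.sum_congr rfl fun j _ => ?_
    rw [← integral_const_mul]
    congr 1
    ext x
    ring
  · intro j _
    refine ((integrable_conj_mul hw (memLp_secDiff hu (h • stdVec d j))).const_mul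
      (((h ^ 2)⁻¹ : ℝ) : ℂ)).congr (.of_forall fun x => ?_)
    simp only
    ring

end L2Tools

section Energy

lemma re_weighted_ge {A B l : ℝ} (hA : 0 ≤ A) (hB : 0 ≤ B) (h1 : |B - A| ≤ l * A)
    (h2 : |B - A| ≤ l * B) (a b : ℂ) :
    -(l ^ 2 / 8) * (A * ‖a‖ ^ 2 + B * ‖b‖ ^ 2) ≤ (conj ((B : ℂ) * b - A * a) * (b - a)).re := by
  have key : (conj ((B : ℂ) * b - A * a) * (b - a)).re
      = B * ‖b‖ ^ 2 + A * ‖a‖ ^ 2 - (A + B) * (conj a * b).re := by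
    simp only [Complex.sq_norm, Complex.normSq_apply, map_sub, map_mul, Complex.conj_ofReal,
      Complex.mul_re, Complex.sub_re, Complex.sub_im, Complex.mul_im, Complex.conj_re,
      Complex.conj_im, Complex.ofReal_re, Complex.ofReal_im]
    ring
  have hre : (conj a * b).re ≤ ‖a‖ * ‖b‖ := by
    refine (Complex.re_le_norm _).trans ?_
    simp
  obtain ⟨α, hα, rfl⟩ : ∃ α : ℝ, 0 ≤ α ∧ α ^ 2 = A := ⟨√A, sqrt_nonneg A, sq_sqrt hA⟩
  obtain ⟨β, hβ, rfl⟩ : ∃ β : ℝ, 0 ≤ β ∧ β ^ 2 = B := ⟨√B, sqrt_nonneg B, sq_sqrt hB⟩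
  have h3 : (β ^ 2 - α ^ 2) ^ 2 ≤ l ^ 2 * (α * β) ^ 2 := by
    rw [← sq_abs, sq]
    calc _ ≤ (l * α ^ 2) * (l * β ^ 2) := mul_le_mul h1 h2 (abs_nonneg _) ((abs_nonneg _).trans h1)
      _ = _ := by ring
  have h4 : α ^ 2 + β ^ 2 ≤ 2 * (1 + l ^ 2 / 8) * (α * β) := by
    refine abs_le_of_sq_le_sq' ?_ (by positivity) |>.2
    nlinarith [sq_nonneg (l ^ 2 * (α * β))]
  have h5 : (α ^ 2 + β ^ 2) * (conj a * b).re ≤ (α ^ 2 + β ^ 2) * (‖a‖ * ‖b‖) := by gcongr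
  have h6 : (α ^ 2 + β ^ 2) * (‖a‖ * ‖b‖) ≤ 2 * (1 + l ^ 2 / 8) * (α * β) * (‖a‖ * ‖b‖) := by
    gcongr
  rw [key]
  nlinarith [mul_nonneg (by positivity : 0 ≤ 1 + l ^ 2 / 8) (sq_nonneg (α * ‖a‖ - β * ‖b‖))]

lemma re_sq_weighted_ge (A B : ℝ) (a b : ℂ) :
    -((B - A) ^ 2 * (‖a‖ * ‖b‖)) ≤
      (conj (((B ^ 2 : ℝ) : ℂ) * b - ((A ^ 2 : ℝ) : ℂ) * a) * (b - a)).re := by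
  have key : (conj (((B ^ 2 : ℝ) : ℂ) * b - ((A ^ 2 : ℝ) : ℂ) * a) * (b - a)).re
      = ‖(B : ℂ) * b - A * a‖ ^ 2 - (B - A) ^ 2 * (conj a * b).re := by
    simp only [Complex.sq_norm, Complex.normSq_apply, map_sub, map_mul, Complex.conj_ofReal,
      Complex.mul_re, Complex.sub_re, Complex.sub_im, Complex.mul_im, Complex.conj_re,
      Complex.conj_im, Complex.ofReal_re, Complex.ofReal_im]
    ring
  have hre : (conj a * b).re ≤ ‖a‖ * ‖b‖ := by
    refine (Complex.re_le_norm _).trans ?_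
    simp
  rw [key]
  nlinarith [sq_nonneg ‖(B : ℂ) * b - A * a‖, mul_le_mul_of_nonneg_left hre (sq_nonneg (B - A))]

variable {d : ℕ} {u w : Euc d → ℂ}

lemma re_integral_diffLap (hw : MemLp w 2 volume) (hu : MemLp u 2 volume) (h : ℝ) :
    (∫ x, conj (w x) * diffLap h u x).re = ∑ j : Fin d, (h ^ 2)⁻¹ *
      ∫ x, (conj (w (x + h • stdVec d j) - w x) * (u (x + h • stdVec d j) - u x)).re := by
  rw [integral_conj_mul_diffLap hw hu, Complex.re_sum]
  refine Finset.sum_congr rfl fun j _ => ?_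
  rw [Complex.re_ofReal_mul, integral_conj_mul_secDiff hw hu]
  congr 1
  exact (integral_re (𝕜 := ℂ) (integrable_conj_mul ((memLp_shift hw _).sub hw)
    ((memLp_shift hu _).sub hu))).symm

lemma integrable_re_diff (hw : MemLp w 2 volume) (hu : MemLp u 2 volume) (s : Euc d) :
    Integrable fun x => (conj (w (x + s) - w x) * (u (x + s) - u x)).re :=
  (integrable_conj_mul ((memLp_shift hw s).sub hw) ((memLp_shift hu s).sub hu)).re

lemma re_integral_weighted_ge {G : Euc d → ℝ} {L h : ℝ} (hh : 0 < h) (hG : ∀ x, 0 ≤ G x)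
    (hGs : ∀ x j, |G (x + h • stdVec d j) - G x| ≤ L * h * G x ∧
      |G (x + h • stdVec d j) - G x| ≤ L * h * G (x + h • stdVec d j))
    (hu : MemLp u 2 volume) (hGu : MemLp (fun x => (G x : ℂ) * u x) 2 volume) :
    -(d * L ^ 2 / 4) * ∫ x, G x * ‖u x‖ ^ 2 ≤
      (∫ x, conj ((G x : ℂ) * u x) * diffLap h u x).re := by
  have hint : Integrable fun x => G x * ‖u x‖ ^ 2 := by
    refine (integrable_norm_mul hGu hu).congr (.of_forall fun x => ?_)
    simp only [norm_mul, Complex.norm_real, Real.norm_eq_abs, abs_of_nonneg (hG x)]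
    ring
  rw [re_integral_diffLap hGu hu]
  have hj : ∀ j : Fin d, -(L ^ 2 / 4) * ∫ x, G x * ‖u x‖ ^ 2 ≤ (h ^ 2)⁻¹ *
      ∫ x, (conj (((G (x + h • stdVec d j) : ℝ) : ℂ) * u (x + h • stdVec d j) - (G x : ℂ) * u x)
        * (u (x + h • stdVec d j) - u x)).re := by
    intro j
    set s := h • stdVec d j with hs
    have hints : Integrable fun x => G (x + s) * ‖u (x + s)‖ ^ 2 := hint.comp_add_right s
    have heq : ∫ x, G (x + s) * ‖u (x + s)‖ ^ 2 = ∫ x, G x * ‖u x‖ ^ 2 :=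
      integral_add_right_eq_self (fun x => G x * ‖u x‖ ^ 2) s
    have := integral_mono ((hint.add hints).const_mul (-((L * h) ^ 2 / 8)))
      (integrable_re_diff hGu hu s)
      (fun x => re_weighted_ge (hG x) (hG _) (hGs x j).1 (hGs x j).2 (u x) (u (x + s)))
    rw [integral_const_mul] at this
    simp only [Pi.add_apply] at this
    rw [integral_add hint hints, heq] at this
    rw [inv_mul_eq_div, le_div_iff₀ (by positivity)]
    refine le_trans (le_of_eq ?_) this
    ring
  calc _ = ∑ j : Fin d, -(L ^ 2 / 4) * ∫ x, G x * ‖u x‖ ^ 2 := by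
        rw [Finset.sum_const, Finset.card_univ, Fintype.card_fin, nsmul_eq_mul]; ring
    _ ≤ _ := Finset.sum_le_sum fun j _ => hj j

lemma re_integral_cutoff_ge {χ : Euc d → ℝ} {L h : ℝ} (hh : 0 < h)
    (hχ : ∀ x j, |χ (x + h • stdVec d j) - χ x| ≤ L * h)
    (hu : MemLp u 2 volume) (hχu : MemLp (fun x => ((χ x ^ 2 : ℝ) : ℂ) * u x) 2 volume) :
    -(d * L ^ 2) * l2norm u ^ 2 ≤
      (∫ x, conj (((χ x ^ 2 : ℝ) : ℂ) * u x) * diffLap h u x).re := by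
  rw [re_integral_diffLap hχu hu]
  have hj : ∀ j : Fin d, -L ^ 2 * l2norm u ^ 2 ≤ (h ^ 2)⁻¹ *
      ∫ x, (conj (((χ (x + h • stdVec d j) ^ 2 : ℝ) : ℂ) * u (x + h • stdVec d j)
        - ((χ x ^ 2 : ℝ) : ℂ) * u x) * (u (x + h • stdVec d j) - u x)).re := by
    intro j
    set s := h • stdVec d j with hs
    have hints := integrable_norm_mul hu (memLp_shift hu s)
    have := integral_mono (hints.const_mul (-(L * h) ^ 2))
      (integrable_re_diff hχu hu s)
      (fun x => le_trans (by
        have : (χ (x + s) - χ x) ^ 2 ≤ (L * h) ^ 2 := by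
          rw [← sq_abs]; exact pow_le_pow_left₀ (abs_nonneg _) (hχ x j) 2
        have h0 : 0 ≤ ‖u x‖ * ‖u (x + s)‖ := by positivity
        simp only
        nlinarith) (re_sq_weighted_ge (χ x) (χ (x + s)) (u x) (u (x + s))))
    rw [integral_const_mul] at this
    have h2 := integral_norm_mul_le hu (memLp_shift hu s)
    rw [l2norm_shift hu] at h2
    rw [inv_mul_eq_div, le_div_iff₀ (by positivity)]
    refine le_trans ?_ this
    nlinarith [mul_le_mul_of_nonneg_left h2 (sq_nonneg (L * h))]
  calc _ = ∑ j : Fin d, -L ^ 2 * l2norm u ^ 2 := by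
        rw [Finset.sum_const, Finset.card_univ, Fintype.card_fin, nsmul_eq_mul]; ring
    _ ≤ _ := Finset.sum_le_sum fun j _ => hj j

lemma re_integral_self_diffLap (hu : MemLp u 2 volume) (h : ℝ) :
    (∫ x, conj (u x) * diffLap h u x).re =
      ∑ j : Fin d, (h ^ 2)⁻¹ * l2norm (fun x => u (x + h • stdVec d j) - u x) ^ 2 := by
  rw [re_integral_diffLap hu hu]
  refine Finset.sum_congr rfl fun j _ => ?_
  rw [l2norm_sq (f := fun x => u (x + h • stdVec d j) - u x) ((memLp_shift hu _).sub hu)]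
  congr 2
  ext x
  rw [← Complex.normSq_eq_conj_mul_self, Complex.ofReal_re, Complex.normSq_eq_norm_sq]

lemma re_integral_secDiff_secDiff_nonneg (hu : MemLp u 2 volume) (s t : Euc d) :
    0 ≤ (∫ x, conj (secDiff s u x) * secDiff t u x).re := by
  have hv : MemLp (fun x => u (x + t) - u x) 2 volume := (memLp_shift hu t).sub hu
  rw [integral_conj_mul_secDiff (memLp_secDiff hu s) hu]
  have e1 : ∀ x, secDiff s u (x + t) - secDiff s u x = secDiff s (fun x => u (x + t) - u x) x := by
    intro x
    simp only [secDiff]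
    rw [show x + t + s = x + s + t by abel, show x + t - s = x - s + t by abel]
    ring
  simp only [e1]
  have e2 : ∫ x, conj (secDiff s (fun x => u (x + t) - u x) x) * (u (x + t) - u x) =
      conj (∫ x, conj (u (x + t) - u x) * secDiff s (fun x => u (x + t) - u x) x) := by
    rw [← integral_conj]
    congr 1
    ext x
    simp only [map_mul, Complex.conj_conj]
    ring
  rw [e2, integral_conj_mul_secDiff hv hv, integral_conj_mul_self, Complex.conj_ofReal,
    Complex.ofReal_re]
  positivity

lemma l2norm_secDiff_le (hu : MemLp u 2 volume) (h : ℝ) (j : Fin d) :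
    l2norm (fun x => (((h ^ 2)⁻¹ : ℝ) : ℂ) * secDiff (h • stdVec d j) u x)
      ≤ l2norm (diffLap h u) := by
  have hm : ∀ j, MemLp (fun x => (((h ^ 2)⁻¹ : ℝ) : ℂ) * secDiff (h • stdVec d j) u x) 2 volume :=
    fun j => (memLp_secDiff hu _).const_mul _
  set f : Fin d → Lp ℂ 2 (volume : Measure (Euc d)) := fun j => (hm j).toLp _ with hf
  have hsum : (memLp_diffLap hu h).toLp _ = ∑ j, f j := by
    apply Lp.ext
    refine (MemLp.coeFn_toLp _).trans ?_
    refine Filter.EventuallyEq.trans ?_ (Lp.coeFn_finsetSum Finset.univ f).symm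
    have : ∀ᵐ x ∂(volume : Measure (Euc d)), ∀ j, f j x =
        (((h ^ 2)⁻¹ : ℝ) : ℂ) * secDiff (h • stdVec d j) u x :=
      ae_all_iff.2 fun j => (hm j).coeFn_toLp
    filter_upwards [this] with x hx
    simp [diffLap, hx]
  have hpos : ∀ i k, 0 ≤ (⟪f i, f k⟫_ℂ).re := by
    intro i k
    rw [hf, inner_toLp_toLp (hm i) (hm k)]
    have : ∫ x, conj ((((h ^ 2)⁻¹ : ℝ) : ℂ) * secDiff (h • stdVec d i) u x) *
        ((((h ^ 2)⁻¹ : ℝ) : ℂ) * secDiff (h • stdVec d k) u x) =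
        (((h ^ 2)⁻¹ * (h ^ 2)⁻¹ : ℝ) : ℂ) *
          ∫ x, conj (secDiff (h • stdVec d i) u x) * secDiff (h • stdVec d k) u x := by
      rw [← integral_const_mul]
      congr 1
      ext x
      rw [map_mul, Complex.conj_ofReal]
      push_cast
      ring
    rw [this, Complex.re_ofReal_mul]
    have := re_integral_secDiff_secDiff_nonneg hu (h • stdVec d i) (h • stdVec d k)
    positivity
  rw [← norm_toLp_eq_l2norm (hm j), ← norm_toLp_eq_l2norm (memLp_diffLap hu h), hsum]
  have h1 : ‖f j‖ ^ 2 ≤ ‖f j‖ * ‖∑ k, f k‖ := by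
    calc ‖f j‖ ^ 2 = (⟪f j, f j⟫_ℂ).re := (inner_self_eq_norm_sq (𝕜 := ℂ) (f j)).symm
      _ ≤ ∑ k, (⟪f j, f k⟫_ℂ).re :=
        Finset.single_le_sum (f := fun k => (⟪f j, f k⟫_ℂ).re) (fun k _ => hpos j k)
          (Finset.mem_univ j)
      _ = (⟪f j, ∑ k, f k⟫_ℂ).re := by rw [inner_sum, Complex.re_sum]
      _ ≤ _ := re_inner_le_norm (𝕜 := ℂ) _ _
  change ‖f j‖ ≤ _
  rcases (norm_nonneg (f j)).eq_or_lt with h0 | h0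
  · rw [← h0]; positivity
  · nlinarith

end Energy

section EnergyEstimates

variable {d : ℕ} {u : Euc d → ℂ} {W G : Euc d → ℝ} {a h : ℝ}

/-- The finite difference Schrödinger operator `D_h + W + a` on functions on `ℝ^d`. -/
def diffSchr {d : ℕ} (h : ℝ) (W : Euc d → ℝ) (a : ℝ) (u : Euc d → ℂ) (x : Euc d) : ℂ :=
  diffLap h u x + ((W x : ℂ) * u x + (a : ℂ) * u x)

lemma memLp_diffSchr (hu : MemLp u 2 volume) (hWu : MemLp (fun x => (W x : ℂ) * u x) 2 volume) :
    MemLp (diffSchr h W a u) 2 volume :=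
  (memLp_diffLap hu h).add (hWu.add (hu.const_mul (a : ℂ)))

lemma integral_conj_mul_diffSchr {w : Euc d → ℂ} (hw : MemLp w 2 volume) (hu : MemLp u 2 volume)
    (hWu : MemLp (fun x => (W x : ℂ) * u x) 2 volume) :
    ∫ x, conj (w x) * diffSchr h W a u x = (∫ x, conj (w x) * diffLap h u x) +
      ∫ x, conj (w x) * ((W x : ℂ) * u x + (a : ℂ) * u x) := by
  rw [← integral_add (integrable_conj_mul hw (memLp_diffLap hu h))
    (integrable_conj_mul (g := fun x => (W x : ℂ) * u x + (a : ℂ) * u x) hw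
      (hWu.add (hu.const_mul (a : ℂ))))]
  congr 1
  ext x
  simp only [diffSchr]
  ring

lemma energy_identity_le (hW : ∀ x, 0 ≤ W x) (hu : MemLp u 2 volume)
    (hWu : MemLp (fun x => (W x : ℂ) * u x) 2 volume) :
    (∑ j : Fin d, (h ^ 2)⁻¹ * l2norm (fun x => u (x + h • stdVec d j) - u x) ^ 2)
      + a * l2norm u ^ 2 ≤ l2norm u * l2norm (diffSchr h W a u) := by
  have h1 := norm_integral_conj_mul_le hu (memLp_diffSchr (a := a) (h := h) hu hWu)
  refine le_trans ?_ ((Complex.re_le_norm _).trans h1)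
  rw [integral_conj_mul_diffSchr hu hu hWu, Complex.add_re, re_integral_self_diffLap hu]
  gcongr
  have hint : Integrable fun x => W x * ‖u x‖ ^ 2 := by
    refine (integrable_norm_mul hWu hu).congr (.of_forall fun x => ?_)
    simp only [norm_mul, Complex.norm_real, Real.norm_eq_abs, abs_of_nonneg (hW x)]
    ring
  have e : ∫ x, conj (u x) * ((W x : ℂ) * u x + (a : ℂ) * u x) =
      ((∫ x, (W x * ‖u x‖ ^ 2 + a * ‖u x‖ ^ 2) : ℝ) : ℂ) := by
    rw [← integral_complex_ofReal]
    congr 1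
    ext x
    rw [← Complex.normSq_eq_norm_sq]
    push_cast
    rw [Complex.normSq_eq_conj_mul_self]
    ring
  rw [e, Complex.ofReal_re, integral_add hint ((integrable_norm_sq hu).const_mul a),
    integral_const_mul, ← l2norm_sq hu]
  have : 0 ≤ ∫ x, W x * ‖u x‖ ^ 2 := integral_nonneg fun x => mul_nonneg (hW x) (sq_nonneg _)
  linarith

lemma mul_l2norm_le_diffSchr (hW : ∀ x, 0 ≤ W x) (hu : MemLp u 2 volume)
    (hWu : MemLp (fun x => (W x : ℂ) * u x) 2 volume) :
    a * l2norm u ≤ l2norm (diffSchr h W a u) := by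
  have h1 := energy_identity_le (a := a) (h := h) hW hu hWu
  have h2 : 0 ≤ ∑ j : Fin d, (h ^ 2)⁻¹ * l2norm (fun x => u (x + h • stdVec d j) - u x) ^ 2 :=
    Finset.sum_nonneg fun j _ => by positivity
  rcases (l2norm_nonneg u).eq_or_lt with h0 | h0
  · rw [← h0, mul_zero]; exact l2norm_nonneg _
  · nlinarith

lemma l2norm_shift_sub_le_diffSchr (hh : 0 < h) (ha : 1 ≤ a) (hW : ∀ x, 0 ≤ W x)
    (hu : MemLp u 2 volume) (hWu : MemLp (fun x => (W x : ℂ) * u x) 2 volume) (j : Fin d) :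
    l2norm (fun x => u (x + h • stdVec d j) - u x) ≤ h * l2norm (diffSchr h W a u) := by
  have h1 := energy_identity_le (a := a) (h := h) hW hu hWu
  have h2 := mul_l2norm_le_diffSchr (a := a) (h := h) hW hu hWu
  have h3 := Finset.single_le_sum (f := fun j : Fin d => (h ^ 2)⁻¹ *
    l2norm (fun x => u (x + h • stdVec d j) - u x) ^ 2) (fun k _ => by positivity)
    (Finset.mem_univ j)
  have h4 := l2norm_nonneg u
  have h5 := l2norm_nonneg (diffSchr h W a u)
  have h6 : l2norm u ≤ l2norm (diffSchr h W a u) := by nlinarith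
  have h7 : (h ^ 2)⁻¹ * l2norm (fun x => u (x + h • stdVec d j) - u x) ^ 2 ≤
      l2norm (diffSchr h W a u) ^ 2 := by nlinarith [mul_nonneg (by linarith : 0 ≤ a) (sq_nonneg (l2norm u))]
  rw [inv_mul_eq_div, div_le_iff₀ (by positivity)] at h7
  refine abs_le_of_sq_le_sq' (h7.trans (le_of_eq ?_)) (by positivity) |>.2
  ring

lemma l2norm_potential_le_diffSchr {c L : ℝ} (hh : 0 < h) (hc : 0 ≤ c) (hW : ∀ x, 0 ≤ W x)
    (hWG : ∀ x, W x ≤ G x) (hGW : ∀ x, G x ≤ c * W x)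
    (hGs : ∀ x j, |G (x + h • stdVec d j) - G x| ≤ L * h * G x ∧
      |G (x + h • stdVec d j) - G x| ≤ L * h * G (x + h • stdVec d j))
    (ha : d * L ^ 2 / 4 ≤ a) (hGm : AEStronglyMeasurable G volume)
    (hu : MemLp u 2 volume) (hWu : MemLp (fun x => (W x : ℂ) * u x) 2 volume) :
    l2norm (fun x => (W x : ℂ) * u x) ≤ c * l2norm (diffSchr h W a u) := by
  have hG : ∀ x, 0 ≤ G x := fun x => (hW x).trans (hWG x)
  have hle : ∀ x, ‖(G x : ℂ) * u x‖ ≤ ‖(c : ℂ) * ((W x : ℂ) * u x)‖ := by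
    intro x
    simp only [norm_mul, Complex.norm_real, Real.norm_eq_abs, abs_of_nonneg (hG x),
      abs_of_nonneg (hW x), abs_of_nonneg hc]
    nlinarith [hGW x, norm_nonneg (u x), mul_le_mul_of_nonneg_right (hGW x) (norm_nonneg (u x))]
  have hGu : MemLp (fun x => (G x : ℂ) * u x) 2 volume :=
    (hWu.const_mul (c : ℂ)).mono
      ((Complex.continuous_ofReal.comp_aestronglyMeasurable hGm).mul hu.1) (.of_forall hle)
  have hGle : l2norm (fun x => (G x : ℂ) * u x) ≤ c * l2norm (fun x => (W x : ℂ) * u x) := by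
    refine (l2norm_mono (hWu.const_mul (c : ℂ)) hle).trans (le_of_eq ?_)
    rw [l2norm_const_mul, Complex.norm_real, Real.norm_eq_abs, abs_of_nonneg hc]
  have h1 := norm_integral_conj_mul_le hGu (memLp_diffSchr (a := a) (h := h) hu hWu)
  have h2 := (Complex.re_le_norm _).trans h1
  rw [integral_conj_mul_diffSchr hGu hu hWu, Complex.add_re] at h2
  have h3 := re_integral_weighted_ge hh hG hGs hu hGu
  have hint : Integrable fun x => G x * ‖u x‖ ^ 2 := by
    refine (integrable_norm_mul hGu hu).congr (.of_forall fun x => ?_)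
    simp only [norm_mul, Complex.norm_real, Real.norm_eq_abs, abs_of_nonneg (hG x)]
    ring
  have hint2 : Integrable fun x => G x * W x * ‖u x‖ ^ 2 := by
    refine (integrable_norm_mul hGu hWu).congr (.of_forall fun x => ?_)
    simp only [norm_mul, Complex.norm_real, Real.norm_eq_abs, abs_of_nonneg (hG x),
      abs_of_nonneg (hW x)]
    ring
  have e : ∫ x, conj ((G x : ℂ) * u x) * ((W x : ℂ) * u x + (a : ℂ) * u x) =
      ((∫ x, (G x * W x * ‖u x‖ ^ 2 + a * (G x * ‖u x‖ ^ 2)) : ℝ) : ℂ) := by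
    rw [← integral_complex_ofReal]
    congr 1
    ext x
    rw [← Complex.normSq_eq_norm_sq, map_mul, Complex.conj_ofReal]
    push_cast
    rw [Complex.normSq_eq_conj_mul_self]
    ring
  rw [e, Complex.ofReal_re, integral_add hint2 (hint.const_mul a), integral_const_mul] at h2
  have h4 : l2norm (fun x => (W x : ℂ) * u x) ^ 2 ≤ ∫ x, G x * W x * ‖u x‖ ^ 2 := by
    rw [l2norm_sq hWu]
    refine integral_mono (integrable_norm_sq hWu) hint2 fun x => ?_
    simp only [norm_mul, Complex.norm_real, Real.norm_eq_abs, abs_of_nonneg (hW x)]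
    nlinarith [mul_le_mul_of_nonneg_right (hWG x) (mul_nonneg (hW x) (sq_nonneg ‖u x‖))]
  have h5 : 0 ≤ ∫ x, G x * ‖u x‖ ^ 2 :=
    integral_nonneg fun x => mul_nonneg (hG x) (sq_nonneg _)
  have h6 := l2norm_nonneg (diffSchr h W a u)
  have h7 := l2norm_nonneg (fun x => (W x : ℂ) * u x)
  have h8 : l2norm (fun x => (W x : ℂ) * u x) ^ 2 ≤
      c * l2norm (fun x => (W x : ℂ) * u x) * l2norm (diffSchr h W a u) := by
    nlinarith [mul_le_mul_of_nonneg_right ha h5, mul_le_mul_of_nonneg_right hGle h6]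
  rcases h7.eq_or_lt with h0 | h0
  · rw [← h0]; positivity
  · nlinarith

lemma l2norm_secDiff_le_diffSchr {c : ℝ} (ha : 1 ≤ a) (hW : ∀ x, 0 ≤ W x)
    (hu : MemLp u 2 volume) (hWu : MemLp (fun x => (W x : ℂ) * u x) 2 volume)
    (hc : l2norm (fun x => (W x : ℂ) * u x) ≤ c * l2norm (diffSchr h W a u)) (j : Fin d) :
    l2norm (fun x => (((h ^ 2)⁻¹ : ℝ) : ℂ) * secDiff (h • stdVec d j) u x) ≤
      (2 + c) * l2norm (diffSchr h W a u) := by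
  refine (l2norm_secDiff_le hu h j).trans ?_
  have hF := memLp_diffSchr (a := a) (h := h) hu hWu
  have e : diffLap h u = fun x => diffSchr h W a u x - ((W x : ℂ) * u x + (a : ℂ) * u x) := by
    ext x
    simp only [diffSchr]
    ring
  have hau := hu.const_mul (a : ℂ)
  have h1 := l2norm_sub_le (g := fun x => (W x : ℂ) * u x + (a : ℂ) * u x) hF (hWu.add hau)
  have h2 := l2norm_add_le hWu hau
  rw [l2norm_const_mul, Complex.norm_real, Real.norm_eq_abs, abs_of_nonneg (by linarith)] at h2
  have h3 := mul_l2norm_le_diffSchr (a := a) (h := h) hW hu hWu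
  rw [e]
  linarith

end EnergyEstimates

section Weight

variable {d : ℕ} {W : Euc d → ℝ} {c : ℝ}

/-- A locally Lipschitz weight comparable to a slowly varying function `W`. -/
def regWeight {d : ℕ} (W : Euc d → ℝ) (x : Euc d) : ℝ :=
  ⨆ y, W y * max 0 (1 - dist x y)

/-- `W` is positive and comparable to itself, with constant `c`, on unit balls. -/
def IsSlowlyVarying {d : ℕ} (c : ℝ) (W : Euc d → ℝ) : Prop :=
  1 ≤ c ∧ (∀ x, 0 < W x) ∧ ∀ x y, dist x y ≤ 1 → W y ≤ c * W x

lemma regWeight_term_le (hW : IsSlowlyVarying c W) (x y : Euc d) :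
    W y * max 0 (1 - dist x y) ≤ c * W x := by
  obtain ⟨hc, hpos, hcomp⟩ := hW
  rcases le_total (dist x y) 1 with h | h
  · have h1 := hcomp x y h
    have : max 0 (1 - dist x y) ≤ 1 := max_le zero_le_one (by linarith [dist_nonneg (x := x) (y := y)])
    have h3 : 0 ≤ max 0 (1 - dist x y) := le_max_left _ _
    nlinarith [hpos y]
  · rw [max_eq_left (by linarith), mul_zero]
    exact mul_nonneg (by linarith) (hpos x).le

lemma regWeight_bdd (hW : IsSlowlyVarying c W) (x : Euc d) :
    BddAbove (Set.range fun y => W y * max 0 (1 - dist x y)) :=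
  ⟨c * W x, by rintro _ ⟨y, rfl⟩; exact regWeight_term_le hW x y⟩

lemma le_regWeight (hW : IsSlowlyVarying c W) (x : Euc d) : W x ≤ regWeight W x := by
  refine le_trans (le_of_eq ?_) (le_ciSup (regWeight_bdd hW x) x)
  simp

lemma regWeight_le (hW : IsSlowlyVarying c W) (x : Euc d) : regWeight W x ≤ c * W x :=
  ciSup_le fun y => regWeight_term_le hW x y

lemma regWeight_le_add (hW : IsSlowlyVarying c W) (x x' : Euc d) :
    regWeight W x' ≤ regWeight W x + c * W x' * dist x x' := by
  refine ciSup_le fun y => ?_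
  have h0 := le_ciSup (regWeight_bdd hW x) y
  obtain ⟨hc, hpos, hcomp⟩ := hW
  change _ ≤ regWeight W x at h0
  have hp := mul_nonneg (mul_nonneg (by linarith : 0 ≤ c) (hpos x').le) (dist_nonneg (x := x) (y := x'))
  have hq : 0 ≤ W y * max 0 (1 - dist x y) := mul_nonneg (hpos y).le (le_max_left _ _)
  rcases le_total (dist x' y) 1 with h | h
  · have h1 := hcomp x' y h
    have h2 : max 0 (1 - dist x' y) ≤ max 0 (1 - dist x y) + dist x x' := by
      have := dist_triangle x x' y
      refine max_le (by positivity) ?_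
      linarith [le_max_right 0 (1 - dist x y)]
    nlinarith [hpos y, mul_le_mul_of_nonneg_left h2 (hpos y).le,
      mul_le_mul_of_nonneg_right h1 (dist_nonneg (x := x) (y := x'))]
  · rw [max_eq_left (by linarith), mul_zero]
    linarith

lemma abs_regWeight_sub_le (hW : IsSlowlyVarying c W) {x x' : Euc d} (h : dist x x' ≤ 1) :
    |regWeight W x' - regWeight W x| ≤ c ^ 2 * dist x x' * regWeight W x := by
  have h1 := regWeight_le_add hW x x'
  have h2 := regWeight_le_add hW x' x
  have h3 := le_regWeight hW x
  obtain ⟨hc, hpos, hcomp⟩ := hW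
  have h4 := hcomp x x' h
  rw [dist_comm x' x] at h2
  have h5 := dist_nonneg (x := x) (y := x')
  have h6 : c * W x' * dist x x' ≤ c ^ 2 * dist x x' * regWeight W x := by
    calc c * W x' * dist x x' ≤ c * (c * regWeight W x) * dist x x' := by
          have : c * W x ≤ c * regWeight W x := by gcongr
          gcongr
          linarith
      _ = _ := by ring
  have h7 : c * W x * dist x x' ≤ c ^ 2 * dist x x' * regWeight W x := by
    calc c * W x * dist x x' ≤ c * (c * regWeight W x) * dist x x' := by
          have : 1 * W x ≤ c * regWeight W x := by gcongr; exact (hpos x).le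
          gcongr
          linarith
      _ = _ := by ring
  rw [abs_le]
  constructor <;> linarith

lemma continuous_regWeight (hW : IsSlowlyVarying c W) : Continuous (regWeight W) := by
  rw [continuous_iff_continuousAt]
  intro x
  rw [ContinuousAt, tendsto_iff_dist_tendsto_zero]
  have h0 : Filter.Tendsto (fun y => c ^ 2 * dist x y * regWeight W x) (nhds x) (nhds 0) := by
    have : Continuous fun y => c ^ 2 * dist x y * regWeight W x := by fun_prop
    simpa using this.tendsto x
  refine squeeze_zero' (.of_forall fun _ => dist_nonneg) ?_ h0
  filter_upwards [Metric.closedBall_mem_nhds x one_pos] with y hy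
  rw [Real.dist_eq]
  exact abs_regWeight_sub_le hW (by rwa [dist_comm])

lemma dist_add_smul_stdVec (x : Euc d) (h : ℝ) (j : Fin d) : dist x (x + h • stdVec d j) = |h| := by
  simp [stdVec, norm_smul]

lemma regWeight_shift (hW : IsSlowlyVarying c W) {h : ℝ} (hh : 0 < h) (hh1 : h ≤ 1) (x : Euc d)
    (j : Fin d) :
    |regWeight W (x + h • stdVec d j) - regWeight W x| ≤ c ^ 2 * h * regWeight W x ∧
      |regWeight W (x + h • stdVec d j) - regWeight W x| ≤
        c ^ 2 * h * regWeight W (x + h • stdVec d j) := by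
  have hd : dist x (x + h • stdVec d j) = h := by rw [dist_add_smul_stdVec, abs_of_pos hh]
  have h1 := abs_regWeight_sub_le hW (hd.trans_le hh1)
  have h2 := abs_regWeight_sub_le hW ((dist_comm _ _).trans_le (hd.trans_le hh1))
  rw [hd] at h1
  rw [dist_comm, hd, abs_sub_comm] at h2
  exact ⟨h1, h2⟩

end Weight

section Cells

variable {d : ℕ} {h : ℝ}

/-- The index of the cell of the lattice `hℤ^d` containing `x`. -/
def cellIdx (d : ℕ) (h : ℝ) (x : Euc d) : Zd d := fun j => ⌊x j / h⌋

/-- The corner of the cell of the lattice `hℤ^d` containing `x`. -/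
def cellPt (d : ℕ) (h : ℝ) (x : Euc d) : Euc d := latPt d h (cellIdx d h x)

lemma latPt_apply (z : Zd d) (j : Fin d) : latPt d h z j = h * (z j : ℝ) := rfl

lemma measurable_cellIdx : Measurable (cellIdx d h) := by
  refine measurable_pi_lambda _ fun j => ?_
  have : Continuous fun x : Euc d => x j / h := by fun_prop
  exact Int.measurable_floor.comp this.measurable

lemma cellIdx_eq_iff (hh : 0 < h) (x : Euc d) (z : Zd d) :
    cellIdx d h x = z ↔ ∀ j, x j ∈ Set.Ico (h * (z j : ℝ)) (h * (z j : ℝ) + h) := by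
  rw [funext_iff]
  refine forall_congr' fun j => ?_
  simp only [cellIdx, Int.floor_eq_iff, Set.mem_Ico]
  rw [le_div_iff₀ hh, div_lt_iff₀ hh]
  constructor <;> rintro ⟨h1, h2⟩ <;> constructor <;> linarith

lemma measurePreserving_cellIdx (hh : 0 < h) :
    MeasurePreserving (cellIdx d h) volume (latMeas d h) := by
  refine ⟨measurable_cellIdx, ?_⟩
  refine Measure.ext_of_singleton fun z => ?_
  rw [Measure.map_apply measurable_cellIdx (measurableSet_singleton z)]
  have hpre : cellIdx d h ⁻¹' {z} = WithLp.ofLp ⁻¹'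
      (Set.univ.pi fun j => Set.Ico (h * (z j : ℝ)) (h * (z j : ℝ) + h)) := by
    ext x
    simp only [Set.mem_preimage, Set.mem_singleton_iff, cellIdx_eq_iff hh, Set.mem_pi,
      Set.mem_univ, true_implies]
  rw [hpre, (PiLp.volume_preserving_ofLp (Fin d)).measure_preimage
    (MeasurableSet.univ_pi fun j => measurableSet_Ico).nullMeasurableSet, Real.volume_pi_Ico]
  simp [latMeas, ENNReal.ofReal_pow hh.le]

lemma ae_latMeas_iff (hh : 0 < h) {p : Zd d → Prop} : (∀ᵐ z ∂latMeas d h, p z) ↔ ∀ z, p z := by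
  have : latMeas d h = ENNReal.ofReal (h ^ d) • Measure.count := rfl
  rw [this, Measure.ae_ennreal_smul_measure_iff (by positivity)]
  simp

lemma cellIdx_add (hh : 0 < h) (x : Euc d) (j : Fin d) :
    cellIdx d h (x + h • stdVec d j) = cellIdx d h x + Pi.single j 1 := by
  rw [cellIdx_eq_iff hh]
  intro i
  have h1 := (cellIdx_eq_iff hh x _).1 rfl i
  by_cases hij : i = j
  · subst hij
    simp only [stdVec, PiLp.add_apply, PiLp.smul_apply, PiLp.single_apply, if_true,
      smul_eq_mul, Pi.add_apply, Pi.single_eq_same, Int.cast_add, Int.cast_one, Set.mem_Ico] at h1 ⊢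
    constructor <;> linarith
  · simpa [stdVec, hij] using h1

lemma cellIdx_sub (hh : 0 < h) (x : Euc d) (j : Fin d) :
    cellIdx d h (x - h • stdVec d j) = cellIdx d h x - Pi.single j 1 := by
  have := cellIdx_add hh (x - h • stdVec d j) j
  rw [sub_add_cancel] at this
  rw [this, add_sub_cancel_right]

lemma cellIdx_add_small (hh : 0 < h) {t : ℝ} (ht0 : 0 ≤ t) (ht : t ≤ h) (x : Euc d) (j : Fin d) :
    cellIdx d h (x + t • stdVec d j) = cellIdx d h x ∨
      cellIdx d h (x + t • stdVec d j) = cellIdx d h x + Pi.single j 1 := by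
  have h1 := (cellIdx_eq_iff hh x _).1 rfl
  by_cases hc : x j + t < h * (cellIdx d h x j : ℝ) + h
  · left
    rw [cellIdx_eq_iff hh]
    intro i
    have h1 := h1 i
    by_cases hij : i = j
    · subst hij
      simp only [stdVec, PiLp.add_apply, PiLp.smul_apply, PiLp.single_apply, if_true,
        smul_eq_mul, mul_one, Set.mem_Ico] at h1 ⊢
      constructor <;> linarith
    · simpa [stdVec, hij] using h1
  · right
    rw [cellIdx_eq_iff hh]
    intro i
    have h1 := h1 i
    by_cases hij : i = j
    · subst hij
      simp only [stdVec, PiLp.add_apply, PiLp.smul_apply, PiLp.single_apply, if_true,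
        smul_eq_mul, mul_one, Pi.add_apply, Pi.single_eq_same, Int.cast_add, Int.cast_one,
        Set.mem_Ico] at h1 ⊢
      constructor <;> linarith
    · simpa [stdVec, hij] using h1

lemma latPt_add (z : Zd d) (j : Fin d) :
    latPt d h (z + Pi.single j 1) = latPt d h z + h • stdVec d j := by
  ext i
  by_cases hij : i = j
  · subst hij
    simp [latPt_apply, stdVec]
    ring
  · simp [latPt_apply, stdVec, hij]

lemma cellPt_add (hh : 0 < h) (x : Euc d) (j : Fin d) :
    cellPt d h (x + h • stdVec d j) = cellPt d h x + h • stdVec d j := by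
  rw [cellPt, cellIdx_add hh, latPt_add, cellPt]

lemma dist_cellPt_le (hh : 0 < h) (x : Euc d) : dist x (cellPt d h x) ≤ √d * h := by
  have h1 := (cellIdx_eq_iff hh x _).1 rfl
  rw [EuclideanSpace.dist_eq]
  calc √(∑ i, dist (x i) (cellPt d h x i) ^ 2) ≤ √(∑ i : Fin d, h ^ 2) := by
        refine Real.sqrt_le_sqrt (Finset.sum_le_sum fun i _ => ?_)
        refine pow_le_pow_left₀ dist_nonneg ?_ 2
        have := h1 i
        rw [Set.mem_Ico] at this
        rw [cellPt, latPt_apply, Real.dist_eq, abs_le]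
        constructor <;> linarith
    _ = √d * h := by
        rw [Finset.sum_const, Finset.card_univ, Fintype.card_fin, nsmul_eq_mul,
          Real.sqrt_mul (by positivity), Real.sqrt_sq hh.le]

lemma measurable_cellPt : Measurable (cellPt d h) :=
  (measurable_of_countable (latPt d h)).comp measurable_cellIdx

/-- The isometric embedding of `ℓ²(hℤ^d)` into `L²(ℝ^d)` as functions constant on cells. -/
def cellEmb (d : ℕ) {h : ℝ} (hh : 0 < h) : l2h d h →ₗᵢ[ℂ] L2 d :=
  Lp.compMeasurePreservingₗᵢ ℂ (cellIdx d h) (measurePreserving_cellIdx hh)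

/-- The cellwise constant function attached to a function on the lattice. -/
def cellFun {d : ℕ} (h : ℝ) (v : Zd d → ℂ) (x : Euc d) : ℂ := v (cellIdx d h x)

lemma cellEmb_coeFn (hh : 0 < h) (v : l2h d h) :
    (cellEmb d hh v : Euc d → ℂ) =ᵐ[volume] cellFun h v :=
  Lp.coeFn_compMeasurePreserving v (measurePreserving_cellIdx hh)

lemma memLp_cellFun (hh : 0 < h) {v : Zd d → ℂ} (hv : MemLp v 2 (latMeas d h)) :
    MemLp (cellFun h v) 2 volume :=
  hv.comp_measurePreserving (measurePreserving_cellIdx hh)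

lemma memLp_of_cellFun (hh : 0 < h) {v : Zd d → ℂ} (hv : MemLp (cellFun h v) 2 volume) :
    MemLp v 2 (latMeas d h) := by
  have hv' : AEStronglyMeasurable v (latMeas d h) := (measurable_of_countable v).aestronglyMeasurable
  have hmp := measurePreserving_cellIdx (d := d) hh
  rw [← hmp.map_eq] at hv' ⊢
  exact (memLp_map_measure_iff hv' hmp.aemeasurable).2 hv

lemma cellEmb_eq_toLp (hh : 0 < h) (v : l2h d h) :
    cellEmb d hh v = (memLp_cellFun hh (Lp.memLp v)).toLp _ :=
  Lp.ext ((cellEmb_coeFn hh v).trans (MemLp.coeFn_toLp _).symm)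

lemma norm_eq_l2norm_cellFun (hh : 0 < h) (v : l2h d h) : ‖v‖ = l2norm (cellFun h v) := by
  rw [← (cellEmb d hh).norm_map v, cellEmb_eq_toLp, norm_toLp_eq_l2norm]

lemma cellFun_discAct (hh : 0 < h) (V : Euc d → ℝ) (v : Zd d → ℂ) (x : Euc d) :
    cellFun h (discAct d h V v) x =
      diffLap h (cellFun h v) x + (V (cellPt d h x) : ℂ) * cellFun h v x := by
  simp only [cellFun, discAct, diffLap, secDiff, cellIdx_add hh, cellIdx_sub hh, cellPt,
    Finset.mul_sum]
  push_cast
  rfl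

end Cells

section Taylor

variable {d : ℕ} {h : ℝ} {u w : Euc d → ℂ}

lemma norm_second_diff_sub_le {φ φ' φ'' : ℝ → ℂ} (h1 : ∀ t, HasDerivAt φ (φ' t) t)
    (h2 : ∀ t, HasDerivAt φ' (φ'' t) t) (hh : 0 ≤ h) {η : ℝ}
    (hη : ∀ t, 0 ≤ t → t ≤ h → ‖φ'' t + φ'' (-t) - 2 * φ'' 0‖ ≤ η) :
    ‖φ h + φ (-h) - 2 * φ 0 - (h ^ 2 : ℝ) * φ'' 0‖ ≤ h ^ 2 * η := by
  have hη0 : 0 ≤ η := (norm_nonneg _).trans (hη 0 le_rfl hh)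
  have hneg : ∀ {f f' : ℝ → ℂ}, (∀ t, HasDerivAt f (f' t) t) →
      ∀ t, HasDerivAt (fun t => f (-t)) (-f' (-t)) t := by
    intro f f' hf t
    exact ((hf (-t)).scomp t (hasDerivAt_neg t)).congr_deriv (by simp)
  have hg1 : ∀ t, HasDerivAt (fun t : ℝ => φ t + φ (-t) - 2 * φ 0 - ((t ^ 2 : ℝ) : ℂ) * φ'' 0)
      (φ' t - φ' (-t) - ((2 * t : ℝ) : ℂ) * φ'' 0) t := by
    intro t
    have h3 : HasDerivAt (fun t : ℝ => ((t ^ 2 : ℝ) : ℂ)) ((2 * t : ℝ) : ℂ) t := by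
      have := (hasDerivAt_pow 2 t).ofReal_comp
      simpa using this
    exact ((((h1 t).add (hneg h1 t)).sub_const (2 * φ 0)).sub (h3.mul_const (φ'' 0))).congr_deriv
      (by ring)
  have hg2 : ∀ t, HasDerivAt (fun t : ℝ => φ' t - φ' (-t) - ((2 * t : ℝ) : ℂ) * φ'' 0)
      (φ'' t + φ'' (-t) - 2 * φ'' 0) t := by
    intro t
    have h3 : HasDerivAt (fun t : ℝ => ((2 * t : ℝ) : ℂ)) 2 t := by
      have := ((hasDerivAt_id t).const_mul 2).ofReal_comp
      simpa using this
    exact (((h2 t).sub (hneg h2 t)).sub (h3.mul_const (φ'' 0))).congr_deriv (by ring)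
  have hb1 : ∀ t ∈ Set.Icc (0 : ℝ) h, ‖φ' t - φ' (-t) - ((2 * t : ℝ) : ℂ) * φ'' 0‖ ≤ η * h := by
    intro t ht
    have := (convex_Icc (0 : ℝ) h).norm_image_sub_le_of_norm_hasDerivWithin_le
      (fun s _ => (hg2 s).hasDerivWithinAt) (fun s hs => hη s hs.1 hs.2)
      (Set.left_mem_Icc.2 hh) ht
    simp only [neg_zero, sub_self, mul_zero, ofReal_zero, zero_mul, sub_zero, Real.norm_eq_abs,
      abs_of_nonneg ht.1] at this
    exact this.trans (mul_le_mul_of_nonneg_left ht.2 hη0)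
  have := (convex_Icc (0 : ℝ) h).norm_image_sub_le_of_norm_hasDerivWithin_le
      (fun s _ => (hg1 s).hasDerivWithinAt) hb1 (Set.left_mem_Icc.2 hh) (Set.right_mem_Icc.2 hh)
  simp only [neg_zero, sub_zero, Real.norm_eq_abs, abs_of_nonneg hh] at this
  have h0 : φ 0 + φ 0 - 2 * φ 0 - (((0 : ℝ) ^ 2 : ℝ) : ℂ) * φ'' 0 = 0 := by simp; ring
  rw [h0, sub_zero] at this
  calc _ ≤ _ := this
    _ = _ := by ring

/-- The partial derivative `∂u/∂x_j`. -/
def pd {d : ℕ} (j : Fin d) (u : Euc d → ℂ) (x : Euc d) : ℂ := fderiv ℝ u x (stdVec d j)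

lemma lapl_eq_sum_pd (u : Euc d → ℂ) (x : Euc d) : lapl d u x = ∑ j, pd j (pd j u) x := rfl

lemma contDiff_pd (hu : ContDiff ℝ (⊤ : ℕ∞) u) (j : Fin d) : ContDiff ℝ (⊤ : ℕ∞) (pd j u) :=
  (hu.fderiv_right (m := (⊤ : ℕ∞)) (by simp)).clm_apply contDiff_const

lemma hasCompactSupport_pd (hu : HasCompactSupport u) (j : Fin d) :
    HasCompactSupport (pd j u) :=
  hu.fderiv_apply ℝ _

lemma hasDerivAt_line (hu : ContDiff ℝ (⊤ : ℕ∞) u) (j : Fin d) (x : Euc d) (t : ℝ) :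
    HasDerivAt (fun t : ℝ => u (x + t • stdVec d j)) (pd j u (x + t • stdVec d j)) t := by
  have h1 : HasDerivAt (fun t : ℝ => x + t • stdVec d j) (stdVec d j) t := by
    simpa using ((hasDerivAt_id t).smul_const (stdVec d j)).const_add x
  have h2 := (hu.differentiable (by simp) (x + t • stdVec d j)).hasFDerivAt
  exact h2.comp_hasDerivAt t h1

lemma hasDerivAt_integral_line (hu : ContDiff ℝ (⊤ : ℕ∞) u) (hc : HasCompactSupport u)
    (hw : MemLp w 2 volume) (j : Fin d) (t : ℝ) :
    HasDerivAt (fun t : ℝ => ∫ x, conj (w x) * u (x + t • stdVec d j))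
      (∫ x, conj (w x) * pd j u (x + t • stdVec d j)) t := by
  have hwm : AEStronglyMeasurable (fun x => conj (w x)) volume := hw.conj.1
  have hmem : ∀ {f : Euc d → ℂ}, Continuous f → HasCompactSupport f → ∀ t : ℝ,
      MemLp (fun x => f (x + t • stdVec d j)) 2 volume := fun hf hfc t =>
    memLp_shift (hf.memLp_of_hasCompactSupport hfc) _
  have hpdc := (contDiff_pd hu j).continuous
  have hpdk := hasCompactSupport_pd hc j
  obtain ⟨C, hC⟩ := hpdk.exists_bound_of_continuous hpdc
  obtain ⟨R, hR⟩ := hpdk.isCompact.isBounded.subset_closedBall (0 : Euc d)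
  set B : Set (Euc d) := Metric.closedBall 0 (R + |t| + 1)
  have hball : ∀ x, ∀ s ∈ Metric.ball t 1, pd j u (x + s • stdVec d j) ≠ 0 → x ∈ B := by
    intro x s hs hne
    have h1 := hR (subset_tsupport _ hne)
    rw [mem_closedBall_zero_iff] at h1 ⊢
    have h2 : ‖s • stdVec d j‖ = |s| := by simp [norm_smul, stdVec]
    have h3 : |s| ≤ |t| + 1 := by
      rw [Metric.mem_ball, Real.dist_eq] at hs
      have := abs_sub_abs_le_abs_sub s t
      linarith
    have h4 := norm_sub_le (x + s • stdVec d j) (s • stdVec d j)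
    rw [add_sub_cancel_right] at h4
    linarith
  have hBint : MemLp (B.indicator fun _ => (C : ℝ)) 2 (volume : Measure (Euc d)) :=
    memLp_indicator_const 2 measurableSet_closedBall C
      (Or.inr (isCompact_closedBall _ _).measure_lt_top.ne)
  refine (hasDerivAt_integral_of_dominated_loc_of_deriv_le
    (F := fun t x => conj (w x) * u (x + t • stdVec d j))
    (F' := fun t x => conj (w x) * pd j u (x + t • stdVec d j))
    (bound := fun x => ‖w x‖ * B.indicator (fun _ => C) x)
    (Metric.ball_mem_nhds t one_pos) (Filter.Eventually.of_forall fun s => ?_) ?_ ?_ ?_ ?_ ?_).2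
  · exact (integrable_conj_mul hw (hmem hu.continuous hc s)).1
  · exact integrable_conj_mul hw (hmem hu.continuous hc t)
  · exact (integrable_conj_mul hw (hmem hpdc hpdk t)).1
  · refine Filter.Eventually.of_forall fun x s hs => ?_
    by_cases hne : pd j u (x + s • stdVec d j) = 0
    · simp only [hne, mul_zero, norm_zero]
      refine mul_nonneg (norm_nonneg _) (Set.indicator_nonneg (fun _ _ => ?_) _)
      exact (norm_nonneg _).trans (hC x)
    · rw [norm_mul, RCLike.norm_conj, Set.indicator_of_mem (hball x s hs hne)]
      exact mul_le_mul_of_nonneg_left (hC _) (norm_nonneg _)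
  · exact hw.norm.integrable_mul hBint
  · exact Filter.Eventually.of_forall fun x s _ => (hasDerivAt_line hu j x s).const_mul _

/-- A smooth compactly supported function has second differences uniformly close to its second
derivatives. -/
lemma exists_secDiff_approx (hu : ContDiff ℝ (⊤ : ℕ∞) u) (hc : HasCompactSupport u) (j : Fin d)
    {ε : ℝ} (hε : 0 < ε) : ∃ δ > 0, ∀ h : ℝ, 0 < h → h < δ → ∀ x,
      ‖(((h ^ 2)⁻¹ : ℝ) : ℂ) * secDiff (h • stdVec d j) u x + pd j (pd j u) x‖ ≤ ε := by
  have hp2 := contDiff_pd (contDiff_pd hu j) j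
  have huc := Continuous.uniformContinuous_of_tendsto_cocompact (x := (0 : ℂ)) hp2.continuous
    ((hasCompactSupport_pd (hasCompactSupport_pd hc j) j).is_zero_at_infty)
  obtain ⟨δ, hδ, hδ'⟩ := Metric.uniformContinuous_iff.1 huc (ε / 2) (by positivity)
  refine ⟨δ, hδ, fun h hh hhδ x => ?_⟩
  have hd : ∀ t : ℝ, |t| ≤ h →
      ‖pd j (pd j u) (x + t • stdVec d j) - pd j (pd j u) x‖ ≤ ε / 2 := by
    intro t ht
    rw [← dist_eq_norm]
    refine (hδ' ?_).le
    rw [dist_comm, dist_add_smul_stdVec]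
    exact ht.trans_lt hhδ
  have := norm_second_diff_sub_le (hasDerivAt_line hu j x)
    (hasDerivAt_line (contDiff_pd hu j) j x) hh.le (η := ε) ?_
  · have heq : (((h ^ 2)⁻¹ : ℝ) : ℂ) * secDiff (h • stdVec d j) u x + pd j (pd j u) x =
        -((((h ^ 2)⁻¹ : ℝ) : ℂ) * (u (x + h • stdVec d j) + u (x + (-h) • stdVec d j) -
          2 * u (x + (0 : ℝ) • stdVec d j) -
          (h ^ 2 : ℝ) * pd j (pd j u) (x + (0 : ℝ) • stdVec d j))) := by
      have hne : ((h : ℝ) : ℂ) ≠ 0 := ofReal_ne_zero.2 hh.ne'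
      simp only [secDiff, zero_smul, add_zero, neg_smul, ← sub_eq_add_neg]
      push_cast
      field_simp
      ring
    rw [heq, norm_neg, norm_mul, norm_real, Real.norm_of_nonneg (by positivity)]
    calc _ ≤ (h ^ 2)⁻¹ * (h ^ 2 * ε) := mul_le_mul_of_nonneg_left this (by positivity)
      _ = ε := by field_simp
  · intro t ht0 ht
    have h1 := hd t (by rwa [abs_of_nonneg ht0])
    have h2 := hd (-t) (by rwa [abs_neg, abs_of_nonneg ht0])
    rw [zero_smul, add_zero]
    calc _ = ‖(pd j (pd j u) (x + t • stdVec d j) - pd j (pd j u) x) +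
          (pd j (pd j u) (x + (-t) • stdVec d j) - pd j (pd j u) x)‖ := by congr 1; ring
      _ ≤ _ := norm_add_le _ _
      _ ≤ ε := by linarith

lemma exists_diffLap_approx (hu : ContDiff ℝ (⊤ : ℕ∞) u) (hc : HasCompactSupport u)
    {ε : ℝ} (hε : 0 < ε) : ∃ δ > 0, ∀ h : ℝ, 0 < h → h < δ → ∀ x,
      ‖diffLap h u x + lapl d u x‖ ≤ ε := by
  have hε' : 0 < ε / (d + 1) := by positivity
  choose δ hδ hδ' using fun j => exists_secDiff_approx hu hc j hε'
  have hev : ∀ᶠ h in nhdsWithin (0 : ℝ) (Set.Ioi 0), ∀ j, h < δ j :=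
    Filter.eventually_all.2 fun j => nhdsWithin_le_nhds (gt_mem_nhds (hδ j))
  obtain ⟨δ₀, hδ₀, hsub⟩ := mem_nhdsGT_iff_exists_Ioo_subset.1 hev
  refine ⟨δ₀, hδ₀, fun h hh hhδ x => ?_⟩
  have hlt : ∀ j, h < δ j := hsub ⟨hh, hhδ⟩
  rw [diffLap, lapl_eq_sum_pd, ← Finset.sum_add_distrib]
  calc _ ≤ ∑ _j : Fin d, ε / (d + 1) := norm_sum_le_of_le _ fun j _ => hδ' j h hh (hlt j) x
    _ = d * (ε / (d + 1)) := by simp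
    _ ≤ ε := by
      rw [mul_div_assoc', div_le_iff₀ (by positivity)]
      nlinarith

lemma l2norm_cellFun_shift_sub_le (hh : 0 < h) {v : Zd d → ℂ}
    (hv : MemLp (cellFun h v) 2 volume) (j : Fin d) {t : ℝ} (ht0 : 0 ≤ t) (ht : t ≤ h) :
    l2norm (fun x => cellFun h v (x + t • stdVec d j) - cellFun h v x) ≤
      l2norm (fun x => cellFun h v (x + h • stdVec d j) - cellFun h v x) := by
  refine l2norm_mono ((memLp_shift hv _).sub hv) fun x => ?_
  simp only [cellFun]
  rcases cellIdx_add_small hh ht0 ht x j with h1 | h1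
  · rw [h1]; simp
  · rw [h1, cellIdx_add hh]

/-- Kinetic consistency: on cellwise constant functions, second differences and second derivatives
agree up to the size of the first differences. -/
lemma norm_integral_cellFun_secDiff_le (hh : 0 < h) (hu : ContDiff ℝ (⊤ : ℕ∞) u)
    (hc : HasCompactSupport u) {v : Zd d → ℂ} (hv : MemLp (cellFun h v) 2 volume) (j : Fin d) :
    ‖∫ x, conj (cellFun h v x) *
        ((((h ^ 2)⁻¹ : ℝ) : ℂ) * secDiff (h • stdVec d j) u x + pd j (pd j u) x)‖ ≤
      2 * (l2norm (fun x => cellFun h v (x + h • stdVec d j) - cellFun h v x) *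
        l2norm (pd j (pd j u))) := by
  set w := cellFun h v
  set N := l2norm (fun x => w (x + h • stdVec d j) - w x)
  have hu1 := contDiff_pd hu j
  have hc1 := hasCompactSupport_pd hc j
  have hu2 := contDiff_pd hu1 j
  have hc2 := hasCompactSupport_pd hc1 j
  set p := pd j (pd j u)
  have hmu : MemLp u 2 volume := hu.continuous.memLp_of_hasCompactSupport hc
  have hmp : MemLp p 2 volume := hu2.continuous.memLp_of_hasCompactSupport hc2
  have hi : ∀ {f : Euc d → ℂ}, MemLp f 2 volume → ∀ s : Euc d,
    Integrable fun x => conj (w x) * f (x + s) := fun hf s => integrable_conj_mul hv (memLp_shift hf s)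
  have key : ∀ s : Euc d, ‖(∫ x, conj (w x) * p (x + s)) - ∫ x, conj (w x) * p x‖ ≤
      l2norm (fun x => w (x - s) - w x) * l2norm p := by
    intro s
    have h1 : ∫ x, conj (w x) * p (x + s) = ∫ x, conj (w (x - s)) * p x := by
      rw [← integral_add_right_eq_self (μ := volume) (fun x => conj (w (x - s)) * p x) s]
      simp
    rw [h1, ← integral_sub (integrable_conj_mul (memLp_shift_sub hv s) hmp)
      (integrable_conj_mul hv hmp)]
    have h2 := norm_integral_conj_mul_le (f := fun x => w (x - s) - w x)
      ((memLp_shift_sub hv s).sub hv) hmp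
    simpa [sub_mul] using h2
  have keyN : ∀ t : ℝ, 0 ≤ t → t ≤ h → l2norm (fun x => w (x + t • stdVec d j) - w x) ≤ N :=
    fun t h0 h1 => l2norm_cellFun_shift_sub_le hh hv j h0 h1
  have keyN' : ∀ t : ℝ, 0 ≤ t → t ≤ h → l2norm (fun x => w (x - t • stdVec d j) - w x) ≤ N := by
    intro t h0 h1
    refine le_trans (le_of_eq ?_) (keyN t h0 h1)
    rw [← l2norm_shift (f := fun x => w (x - t • stdVec d j) - w x)
      ((memLp_shift_sub hv (t • stdVec d j)).sub hv) (t • stdVec d j),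
      ← l2norm_norm, ← l2norm_norm (fun x => w (x + t • stdVec d j) - w x)]
    congr 1
    ext x
    simp [norm_sub_rev]
  have main := norm_second_diff_sub_le (hasDerivAt_integral_line hu hc hv j)
    (hasDerivAt_integral_line hu1 hc1 hv j) hh.le (η := 2 * (N * l2norm p)) ?_
  · have heq : ∫ x, conj (w x) *
        ((((h ^ 2)⁻¹ : ℝ) : ℂ) * secDiff (h • stdVec d j) u x + p x) =
        -((((h ^ 2)⁻¹ : ℝ) : ℂ) * ((∫ x, conj (w x) * u (x + h • stdVec d j)) +
          (∫ x, conj (w x) * u (x + (-h) • stdVec d j)) -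
          2 * (∫ x, conj (w x) * u (x + (0 : ℝ) • stdVec d j)) -
          (h ^ 2 : ℝ) * ∫ x, conj (w x) * p (x + (0 : ℝ) • stdVec d j))) := by
      have hab : Integrable fun x => conj (w x) * u (x + h • stdVec d j) +
          conj (w x) * u (x + (-h) • stdVec d j) := (hi hmu _).add (hi hmu _)
      have habc : Integrable fun x => conj (w x) * u (x + h • stdVec d j) +
          conj (w x) * u (x + (-h) • stdVec d j) -
          2 * (conj (w x) * u (x + (0 : ℝ) • stdVec d j)) := hab.sub ((hi hmu _).const_mul 2)
      rw [← integral_add (hi hmu _) (hi hmu _), ← integral_const_mul, ← integral_const_mul,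
        ← integral_sub hab ((hi hmu _).const_mul _),
        ← integral_sub habc ((hi hmp _).const_mul _), ← integral_const_mul, ← integral_neg]
      congr 1
      ext x
      have hne : ((h : ℝ) : ℂ) ≠ 0 := ofReal_ne_zero.2 hh.ne'
      simp only [secDiff, zero_smul, add_zero, neg_smul, ← sub_eq_add_neg]
      push_cast
      field_simp
      ring
    rw [heq, norm_neg, norm_mul, norm_real, Real.norm_of_nonneg (by positivity)]
    calc _ ≤ (h ^ 2)⁻¹ * (h ^ 2 * _) := mul_le_mul_of_nonneg_left main (by positivity)
      _ = _ := by field_simp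
  · intro t ht0 ht
    simp only [zero_smul, add_zero]
    have h1 := (key (t • stdVec d j)).trans
      (mul_le_mul_of_nonneg_right (keyN' t ht0 ht) (l2norm_nonneg _))
    have h2 := key ((-t) • stdVec d j)
    simp only [neg_smul, sub_neg_eq_add] at h2
    have h2 := h2.trans (mul_le_mul_of_nonneg_right (keyN t ht0 ht) (l2norm_nonneg _))
    rw [← neg_smul] at h2
    calc _ = ‖((∫ x, conj (w x) * p (x + t • stdVec d j)) - ∫ x, conj (w x) * p x) +
          ((∫ x, conj (w x) * p (x + (-t) • stdVec d j)) - ∫ x, conj (w x) * p x)‖ := by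
            congr 1; ring
      _ ≤ _ := norm_add_le _ _
      _ ≤ _ := by linarith

end Taylor

section Convergence

open scoped Topology

variable {d : ℕ} {u : Euc d → ℂ}

lemma l2norm_le_of_support {F : Euc d → ℂ} {η R : ℝ} (hη : 0 ≤ η) (hF : ∀ x, ‖F x‖ ≤ η)
    (hs : ∀ x, R < ‖x‖ → F x = 0) :
    l2norm F ≤ η * l2norm ((Metric.closedBall (0 : Euc d) R).indicator fun _ => (1 : ℂ)) := by
  have hm : MemLp ((Metric.closedBall (0 : Euc d) R).indicator fun _ => (1 : ℂ)) 2 volume :=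
    memLp_indicator_const 2 measurableSet_closedBall 1
      (Or.inr (isCompact_closedBall _ _).measure_lt_top.ne)
  have h1 := l2norm_const_mul (η : ℂ) ((Metric.closedBall (0 : Euc d) R).indicator fun _ => (1 : ℂ))
  rw [norm_real, Real.norm_of_nonneg hη] at h1
  rw [← h1]
  refine l2norm_mono (hm.const_mul _) fun x => ?_
  by_cases hx : R < ‖x‖
  · rw [hs x hx, norm_zero]
    exact norm_nonneg _
  · rw [Set.indicator_of_mem (by simpa using hx)]
    simpa [abs_of_nonneg hη] using hF x

lemma tendsto_l2norm_zero {F : ℝ → Euc d → ℂ}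
    (hF : ∀ ε > 0, ∀ᶠ h in 𝓝[>] (0 : ℝ), ∀ x, ‖F h x‖ ≤ ε)
    (hs : ∃ R, ∀ᶠ h in 𝓝[>] (0 : ℝ), ∀ x, R < ‖x‖ → F h x = 0) :
    Filter.Tendsto (fun h => l2norm (F h)) (𝓝[>] 0) (𝓝 0) := by
  obtain ⟨R, hR⟩ := hs
  set K := l2norm ((Metric.closedBall (0 : Euc d) R).indicator fun _ => (1 : ℂ))
  have hK : 0 ≤ K := l2norm_nonneg _
  rw [Metric.tendsto_nhds]
  intro ε hε
  have hε' : 0 < ε / (K + 1) := by positivity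
  filter_upwards [hF _ hε', hR] with h h1 h2
  rw [Real.dist_eq, sub_zero, abs_of_nonneg (l2norm_nonneg _)]
  calc _ ≤ ε / (K + 1) * K := l2norm_le_of_support hε'.le h1 h2
    _ < ε := by
      rw [div_mul_eq_mul_div, div_lt_iff₀ (by positivity)]
      nlinarith

lemma exists_radius (hc : HasCompactSupport u) : ∃ R, ∀ x, R < ‖x‖ → u x = 0 := by
  obtain ⟨R, hR⟩ := hc.isCompact.isBounded.subset_closedBall (0 : Euc d)
  refine ⟨R, fun x hx => ?_⟩
  by_contra hne
  have := hR (subset_tsupport _ hne)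
  rw [mem_closedBall_zero_iff] at this
  linarith

lemma eventually_pos_lt {δ : ℝ} (hδ : 0 < δ) : ∀ᶠ h in 𝓝[>] (0 : ℝ), 0 < h ∧ h < δ :=
  Ioo_mem_nhdsGT hδ

lemma secDiff_eq_zero {R h : ℝ} (hR : ∀ x, R < ‖x‖ → u x = 0) (hh : 0 < h) (hh1 : h < 1)
    (j : Fin d) {x : Euc d} (hx : R + 1 < ‖x‖) : secDiff (h • stdVec d j) u x = 0 := by
  have hn : ‖h • stdVec d j‖ ≤ 1 := by
    simp [norm_smul, stdVec, abs_of_pos hh, hh1.le]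
  have h1 := norm_sub_norm_le x (-(h • stdVec d j))
  have h2 := norm_sub_norm_le x (h • stdVec d j)
  rw [sub_neg_eq_add, norm_neg] at h1
  rw [secDiff, hR x (by linarith), hR (x + _) (by linarith), hR (x - _) (by linarith)]
  simp

lemma tendsto_l2norm_secDiff (hu : ContDiff ℝ (⊤ : ℕ∞) u) (hc : HasCompactSupport u) (j : Fin d) :
    Filter.Tendsto (fun h : ℝ => l2norm fun x =>
      (((h ^ 2)⁻¹ : ℝ) : ℂ) * secDiff (h • stdVec d j) u x + pd j (pd j u) x) (𝓝[>] 0) (𝓝 0) := by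
  refine tendsto_l2norm_zero (fun ε hε => ?_) ?_
  · obtain ⟨δ, hδ, H⟩ := exists_secDiff_approx hu hc j hε
    filter_upwards [eventually_pos_lt hδ] with h hh using H h hh.1 hh.2
  · obtain ⟨R, hR⟩ := exists_radius hc
    obtain ⟨R', hR'⟩ := exists_radius (hasCompactSupport_pd (hasCompactSupport_pd hc j) j)
    refine ⟨max (R + 1) R', ?_⟩
    filter_upwards [eventually_pos_lt one_pos] with h hh x hx
    rw [secDiff_eq_zero hR hh.1 hh.2 j ((le_max_left _ _).trans_lt hx),
      hR' x ((le_max_right _ _).trans_lt hx)]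
    simp

lemma contDiff_lapl (hu : ContDiff ℝ (⊤ : ℕ∞) u) : ContDiff ℝ (⊤ : ℕ∞) (lapl d u) :=
  ContDiff.sum fun j _ => contDiff_pd (contDiff_pd hu j) j

lemma hasCompactSupport_lapl (hc : HasCompactSupport u) : HasCompactSupport (lapl d u) := by
  obtain ⟨R, hR⟩ := hc.isCompact.isBounded.subset_closedBall (0 : Euc d)
  refine HasCompactSupport.intro hc.isCompact fun x hx => ?_
  rw [lapl_eq_sum_pd]
  refine Finset.sum_eq_zero fun j _ => ?_
  have h1 : tsupport (pd j (pd j u)) ⊆ tsupport u :=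
    (tsupport_fderiv_apply_subset ℝ _).trans (tsupport_fderiv_apply_subset ℝ _)
  exact image_eq_zero_of_notMem_tsupport fun h => hx (h1 h)

lemma diffLap_eq_zero {R h : ℝ} (hR : ∀ x, R < ‖x‖ → u x = 0) (hh : 0 < h) (hh1 : h < 1)
    {x : Euc d} (hx : R + 1 < ‖x‖) : diffLap h u x = 0 :=
  Finset.sum_eq_zero fun j _ => by rw [secDiff_eq_zero hR hh hh1 j hx, mul_zero]

lemma tendsto_l2norm_diffLap (hu : ContDiff ℝ (⊤ : ℕ∞) u) (hc : HasCompactSupport u) :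
    Filter.Tendsto (fun h : ℝ => l2norm fun x => diffLap h u x + lapl d u x) (𝓝[>] 0) (𝓝 0) := by
  refine tendsto_l2norm_zero (fun ε hε => ?_) ?_
  · obtain ⟨δ, hδ, H⟩ := exists_diffLap_approx hu hc hε
    filter_upwards [eventually_pos_lt hδ] with h hh using H h hh.1 hh.2
  · obtain ⟨R, hR⟩ := exists_radius hc
    obtain ⟨R', hR'⟩ := exists_radius (hasCompactSupport_lapl hc)
    refine ⟨max (R + 1) R', ?_⟩
    filter_upwards [eventually_pos_lt one_pos] with h hh x hx
    rw [diffLap_eq_zero hR hh.1 hh.2 ((le_max_left _ _).trans_lt hx),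
      hR' x ((le_max_right _ _).trans_lt hx), add_zero]

/-- The differential expression `−Δu + Wu + au`. -/
def schr {d : ℕ} (W : Euc d → ℝ) (a : ℝ) (u : Euc d → ℂ) (x : Euc d) : ℂ :=
  -lapl d u x + ((W x : ℂ) * u x + (a : ℂ) * u x)

variable {W : Euc d → ℝ} {a c : ℝ}

lemma continuous_schr (hu : ContDiff ℝ (⊤ : ℕ∞) u) (hW : Continuous W) :
    Continuous (schr W a u) := by
  have := (contDiff_lapl hu).continuous
  have := hu.continuous
  unfold schr
  fun_prop

lemma hasCompactSupport_schr (hc : HasCompactSupport u) : HasCompactSupport (schr W a u) :=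
  ((hasCompactSupport_lapl hc).neg).add ((hc.mul_left).add (hc.mul_left))

lemma memLp_schr (hu : ContDiff ℝ (⊤ : ℕ∞) u) (hc : HasCompactSupport u) (hW : Continuous W) :
    MemLp (schr W a u) 2 volume :=
  (continuous_schr hu hW).memLp_of_hasCompactSupport (hasCompactSupport_schr hc)

lemma memLp_mul_of_continuous (hu : ContDiff ℝ (⊤ : ℕ∞) u) (hc : HasCompactSupport u)
    (hW : Continuous W) : MemLp (fun x => (W x : ℂ) * u x) 2 volume := by
  have := hu.continuous
  exact Continuous.memLp_of_hasCompactSupport (by fun_prop) hc.mul_left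

lemma memLp_of_contDiff (hu : ContDiff ℝ (⊤ : ℕ∞) u) (hc : HasCompactSupport u) :
    MemLp u 2 volume := hu.continuous.memLp_of_hasCompactSupport hc

lemma tendsto_l2norm_diffSchr_sub (hu : ContDiff ℝ (⊤ : ℕ∞) u) (hc : HasCompactSupport u) :
    Filter.Tendsto (fun h : ℝ => l2norm fun x => diffSchr h W a u x - schr W a u x)
      (𝓝[>] 0) (𝓝 0) := by
  refine (tendsto_l2norm_diffLap hu hc).congr fun h => ?_
  congr 1
  ext x
  rw [diffSchr, schr]
  ring

lemma l2norm_diffSchr_le (hu : ContDiff ℝ (⊤ : ℕ∞) u) (hc : HasCompactSupport u)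
    (hW : Continuous W) (h : ℝ) : l2norm (diffSchr h W a u) ≤
      l2norm (schr W a u) + l2norm fun x => diffSchr h W a u x - schr W a u x := by
  have h1 := memLp_schr (a := a) hu hc hW
  have h2 : MemLp (diffSchr h W a u) 2 volume :=
    memLp_diffSchr (memLp_of_contDiff hu hc) (memLp_mul_of_continuous hu hc hW)
  have h3 := l2norm_add_le (g := fun x => diffSchr h W a u x - schr W a u x) h1 (h2.sub h1)
  simp only [add_sub_cancel] at h3
  exact h3

lemma l2norm_potential_le_diffSchr_of_slowlyVarying (hW : IsSlowlyVarying c W)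
    (ha : d * c ^ 4 / 4 ≤ a) {h : ℝ} (hh : 0 < h) (hh1 : h ≤ 1) (hu : MemLp u 2 volume)
    (hWu : MemLp (fun x => (W x : ℂ) * u x) 2 volume) :
    l2norm (fun x => (W x : ℂ) * u x) ≤ c * l2norm (diffSchr h W a u) := by
  refine l2norm_potential_le_diffSchr (G := regWeight W) (L := c ^ 2) hh
    (zero_le_one.trans hW.1) (fun x => (hW.2.1 x).le) (le_regWeight hW) (regWeight_le hW)
    (fun x j => regWeight_shift hW hh hh1 x j) ?_ (continuous_regWeight hW).aestronglyMeasurable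
    hu hWu
  rwa [← pow_mul]

lemma l2norm_potential_le_schr (hWc : Continuous W) (hW : IsSlowlyVarying c W)
    (ha : d * c ^ 4 / 4 ≤ a) (hu : ContDiff ℝ (⊤ : ℕ∞) u) (hc : HasCompactSupport u) :
    l2norm (fun x => (W x : ℂ) * u x) ≤ c * l2norm (schr W a u) := by
  have ht := ((tendsto_l2norm_diffSchr_sub (W := W) (a := a) hu hc).const_add
    (l2norm (schr W a u))).const_mul c
  rw [add_zero] at ht
  refine ge_of_tendsto ht ?_
  filter_upwards [eventually_pos_lt one_pos] with h hh
  exact (l2norm_potential_le_diffSchr_of_slowlyVarying hW ha hh.1 hh.2.le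
    (memLp_of_contDiff hu hc) (memLp_mul_of_continuous hu hc hWc)).trans
    (mul_le_mul_of_nonneg_left (l2norm_diffSchr_le hu hc hWc h) (zero_le_one.trans hW.1))

lemma l2norm_pd_pd_le_schr (hWc : Continuous W) (hW : IsSlowlyVarying c W)
    (ha : d * c ^ 4 / 4 ≤ a) (ha1 : 1 ≤ a) (hu : ContDiff ℝ (⊤ : ℕ∞) u)
    (hc : HasCompactSupport u) (j : Fin d) :
    l2norm (pd j (pd j u)) ≤ (2 + c) * l2norm (schr W a u) := by
  have hc0 : 0 ≤ c := zero_le_one.trans hW.1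
  have ht := (((tendsto_l2norm_diffSchr_sub (W := W) (a := a) hu hc).const_add
    (l2norm (schr W a u))).const_mul (2 + c)).add (tendsto_l2norm_secDiff hu hc j)
  rw [add_zero, add_zero] at ht
  refine ge_of_tendsto ht ?_
  have hmu := memLp_of_contDiff hu hc
  have hmW := memLp_mul_of_continuous hu hc hWc
  have hmp := memLp_of_contDiff (contDiff_pd (contDiff_pd hu j) j)
    (hasCompactSupport_pd (hasCompactSupport_pd hc j) j)
  filter_upwards [eventually_pos_lt one_pos] with h hh
  have h1 := l2norm_secDiff_le_diffSchr (h := h) ha1 (fun x => (hW.2.1 x).le) hmu hmW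
    (l2norm_potential_le_diffSchr_of_slowlyVarying hW ha hh.1 hh.2.le hmu hmW) j
  have h2 := h1.trans
    (mul_le_mul_of_nonneg_left (l2norm_diffSchr_le hu hc hWc h) (by positivity))
  have hms := (memLp_secDiff hmu (h • stdVec d j)).const_mul (((h ^ 2)⁻¹ : ℝ) : ℂ)
  have h3 := l2norm_sub_le (hms.add hmp) hms
  simp only [Pi.add_apply, add_sub_cancel_left] at h3
  calc _ ≤ _ := h3
    _ ≤ _ := by rw [add_comm]; exact add_le_add h2 le_rfl

lemma tendsto_l2norm_comp_cellPt {F : Euc d → ℂ} (hF : Continuous F) (hc : HasCompactSupport F) :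
    Filter.Tendsto (fun h : ℝ => l2norm fun x => F (cellPt d h x) - F x) (𝓝[>] 0) (𝓝 0) := by
  refine tendsto_l2norm_zero (fun ε hε => ?_) ?_
  · have huc := Continuous.uniformContinuous_of_tendsto_cocompact (x := (0 : ℂ)) hF
      hc.is_zero_at_infty
    obtain ⟨δ, hδ, hδ'⟩ := Metric.uniformContinuous_iff.1 huc ε hε
    have hδ1 : 0 < δ / (√d + 1) := by positivity
    filter_upwards [eventually_pos_lt hδ1] with h hh x
    rw [← dist_eq_norm]
    refine (hδ' ?_).le
    rw [dist_comm]
    refine (dist_cellPt_le hh.1 x).trans_lt ?_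
    have := (lt_div_iff₀ (by positivity)).1 hh.2
    nlinarith [hh.1]
  · obtain ⟨R, hR⟩ := exists_radius hc
    refine ⟨R + √d, ?_⟩
    filter_upwards [eventually_pos_lt one_pos] with h hh x hx
    have h1 := dist_cellPt_le hh.1 x
    have h2 : √d * h ≤ √d := mul_le_of_le_one_right (Real.sqrt_nonneg _) hh.2.le
    have h3 := norm_sub_norm_le x (cellPt d h x)
    rw [dist_eq_norm] at h1
    rw [hR x (by have := Real.sqrt_nonneg (d : ℝ); linarith), hR _ (by linarith), sub_zero]

/-- The restriction of a function to the lattice `hℤ^d`. -/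
def latRestr {d : ℕ} (h : ℝ) (u : Euc d → ℂ) (z : Zd d) : ℂ := u (latPt d h z)

lemma cellFun_latRestr (h : ℝ) (x : Euc d) : cellFun h (latRestr h u) x = u (cellPt d h x) := rfl

lemma cellFun_discAct_latRestr {h : ℝ} (hh : 0 < h) (V : Euc d → ℝ) (x : Euc d) :
    cellFun h (discAct d h V (latRestr h u)) x =
      diffLap h u (cellPt d h x) + (V (cellPt d h x) : ℂ) * u (cellPt d h x) := by
  have h1 : ∀ j, cellPt d h (x - h • stdVec d j) = cellPt d h x - h • stdVec d j := fun j => by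
    have := cellPt_add hh (x - h • stdVec d j) j
    rw [sub_add_cancel] at this
    rw [this, add_sub_cancel_right]
  rw [cellFun_discAct hh]
  simp only [cellFun_latRestr, diffLap, secDiff, cellPt_add hh, h1]

lemma tendsto_l2norm_discAct_latRestr {V : Euc d → ℝ} (hV : Continuous V)
    (hu : ContDiff ℝ (⊤ : ℕ∞) u) (hc : HasCompactSupport u) (b : ℝ) :
    Filter.Tendsto (fun h : ℝ => l2norm fun x => cellFun h (discAct d h V (latRestr h u)) x +
      (b : ℂ) * u (cellPt d h x) - schr V b u x) (𝓝[>] 0) (𝓝 0) := by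
  refine tendsto_l2norm_zero (fun ε hε => ?_) ?_
  · have hε2 : 0 < ε / 2 := by positivity
    obtain ⟨δ, hδ, H⟩ := exists_diffLap_approx hu hc hε2
    have hF := continuous_schr (a := b) hu hV
    have hFc := hasCompactSupport_schr (W := V) (a := b) hc
    have huc := Continuous.uniformContinuous_of_tendsto_cocompact (x := (0 : ℂ)) hF
      hFc.is_zero_at_infty
    obtain ⟨δ', hδ', H'⟩ := Metric.uniformContinuous_iff.1 huc _ hε2
    have hδ1 : 0 < δ' / (√d + 1) := by positivity
    filter_upwards [eventually_pos_lt hδ, eventually_pos_lt hδ1] with h hh hh1 x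
    have e1 := H h hh.1 hh.2 (cellPt d h x)
    have e2 : ‖schr V b u (cellPt d h x) - schr V b u x‖ ≤ ε / 2 := by
      rw [← dist_eq_norm]
      refine (H' ?_).le
      rw [dist_comm]
      refine (dist_cellPt_le hh.1 x).trans_lt ?_
      have := (lt_div_iff₀ (by positivity)).1 hh1.2
      nlinarith [hh.1]
    rw [cellFun_discAct_latRestr hh.1]
    calc _ = ‖(diffLap h u (cellPt d h x) + lapl d u (cellPt d h x)) +
          (schr V b u (cellPt d h x) - schr V b u x)‖ := by
            congr 1
            simp only [schr]
            ring
      _ ≤ _ := norm_add_le _ _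
      _ ≤ ε := by linarith
  · obtain ⟨R, hR⟩ := exists_radius hc
    obtain ⟨R', hR'⟩ := exists_radius (hasCompactSupport_schr (W := V) (a := b) hc)
    refine ⟨max (R + 1 + √d) R', ?_⟩
    filter_upwards [eventually_pos_lt one_pos] with h hh x hx
    have h1 := dist_cellPt_le hh.1 x
    have h2 : √d * h ≤ √d := mul_le_of_le_one_right (Real.sqrt_nonneg _) hh.2.le
    have h3 := norm_sub_norm_le x (cellPt d h x)
    have h4 := (le_max_left _ _).trans_lt hx
    rw [dist_eq_norm] at h1
    rw [cellFun_discAct_latRestr hh.1, diffLap_eq_zero hR hh.1 hh.2 (by linarith),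
      hR (cellPt d h x) (by linarith), hR' x ((le_max_right _ _).trans_lt hx)]
    simp

end Convergence

section Mollify

open scoped Topology Convolution

variable {d : ℕ} {q : Euc d → ℂ} {ρ : Euc d → ℝ} {ε : ℝ}

/-- `ρ` is an even mollifier supported in the ball of radius `ε`. -/
structure IsMollifier {d : ℕ} (ε : ℝ) (ρ : Euc d → ℝ) : Prop where
  contDiff : ContDiff ℝ (⊤ : ℕ∞) ρ
  compact : HasCompactSupport ρ
  nonneg : ∀ x, 0 ≤ ρ x
  integral_eq : ∫ x, ρ x = 1
  even : ∀ x, ρ (-x) = ρ x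
  support : ∀ x, ε ≤ ‖x‖ → ρ x = 0

/-- The mollification of `q` by the kernel `ρ`. -/
def mollify {d : ℕ} (ρ : Euc d → ℝ) (q : Euc d → ℂ) (x : Euc d) : ℂ :=
  ∫ y, q y * (ρ (y - x) : ℂ)

lemma IsMollifier.contDiff_ofReal (hρ : IsMollifier ε ρ) :
    ContDiff ℝ (⊤ : ℕ∞) fun x => (ρ x : ℂ) :=
  ofRealCLM.contDiff.comp hρ.contDiff

lemma IsMollifier.compact_ofReal (hρ : IsMollifier ε ρ) :
    HasCompactSupport fun x => (ρ x : ℂ) :=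
  hρ.compact.comp_left (g := fun t : ℝ => (t : ℂ)) ofReal_zero

lemma integrable_mul_sub {f : Euc d → ℂ} (hq : MemLp q 2 volume) (hf : MemLp f 2 volume)
    (x : Euc d) : Integrable fun y => q y * f (y - x) :=
  hq.integrable_mul (memLp_shift_sub hf x)

lemma norm_integral_mul_sub_le {f : Euc d → ℂ} (hq : MemLp q 2 volume) (hf : MemLp f 2 volume)
    (x : Euc d) : ‖∫ y, q y * f (y - x)‖ ≤ l2norm q * l2norm f := by
  have h1 := norm_integral_conj_mul_le hq.conj (memLp_shift_sub hf x)
  have h2 : l2norm (fun x => conj (q x)) = l2norm q := by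
    rw [← l2norm_norm, ← l2norm_norm q]
    simp
  have h3 : l2norm (fun y => f (y - x)) = l2norm f := by
    simpa only [sub_eq_add_neg] using l2norm_shift hf (-x)
  simpa [h2, h3] using h1

lemma IsMollifier.mollify_eq_convolution (hρ : IsMollifier ε ρ) (q : Euc d → ℂ) :
    mollify ρ q = q ⋆[ContinuousLinearMap.mul ℝ ℂ, volume] fun x => (ρ x : ℂ) := by
  ext x
  simp only [mollify, convolution_def, ContinuousLinearMap.mul_apply']
  congr 1
  ext y
  rw [← hρ.even, neg_sub]

lemma IsMollifier.continuous_mollify (hρ : IsMollifier ε ρ) (hq : MemLp q 2 volume) :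
    Continuous (mollify ρ q) := by
  rw [hρ.mollify_eq_convolution]
  exact hρ.compact_ofReal.continuous_convolution_right _ (hq.locallyIntegrable (by norm_num))
    hρ.contDiff_ofReal.continuous

lemma IsMollifier.norm_mollify_sq_le (hρ : IsMollifier ε ρ) (hq : MemLp q 2 volume) (x : Euc d) :
    ‖mollify ρ q x‖ ^ 2 ≤ ∫ y, ‖q y‖ ^ 2 * ρ (y - x) := by
  have hρi : Integrable fun y => ρ (y - x) :=
    (hρ.contDiff.continuous.integrable_of_hasCompactSupport hρ.compact).comp_sub_right x
  have hρ1 : ∫ y, ρ (y - x) = 1 := by rw [integral_sub_right_eq_self]; exact hρ.integral_eq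
  have hmρ : MemLp ρ 2 volume :=
    hρ.contDiff.continuous.memLp_of_hasCompactSupport hρ.compact
  have hmρs : MemLp (fun y => ρ (y - x)) 2 volume :=
    hmρ.comp_measurePreserving (measurePreserving_sub_right volume x)
  have hi1 : Integrable fun y => ‖q y‖ * ρ (y - x) := hq.norm.integrable_mul hmρs
  obtain ⟨C, hC⟩ := hρ.compact.exists_bound_of_continuous hρ.contDiff.continuous
  have hi2 : Integrable fun y => ‖q y‖ ^ 2 * ρ (y - x) :=
    (integrable_norm_sq hq).mul_bdd hρi.1 (Filter.Eventually.of_forall fun y => hC _)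
  set c := ∫ y, ‖q y‖ * ρ (y - x)
  have hle : ‖mollify ρ q x‖ ≤ c := by
    refine (norm_integral_le_integral_norm _).trans (le_of_eq ?_)
    congr 1
    ext y
    rw [norm_mul, norm_real, Real.norm_of_nonneg (hρ.nonneg _)]
  have hsq : ‖mollify ρ q x‖ ^ 2 ≤ c ^ 2 := pow_le_pow_left₀ (norm_nonneg _) hle 2
  have hpos : 0 ≤ ∫ y, ρ (y - x) * (‖q y‖ - c) ^ 2 :=
    integral_nonneg fun y => mul_nonneg (hρ.nonneg _) (sq_nonneg _)
  have hexp : ∫ y, ρ (y - x) * (‖q y‖ - c) ^ 2 = (∫ y, ‖q y‖ ^ 2 * ρ (y - x)) - c ^ 2 := by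
    have h1 : Integrable fun y => ‖q y‖ ^ 2 * ρ (y - x) - (2 * c) * (‖q y‖ * ρ (y - x)) :=
      hi2.sub (hi1.const_mul _)
    calc _ = ∫ y, (‖q y‖ ^ 2 * ρ (y - x) - (2 * c) * (‖q y‖ * ρ (y - x)) + c ^ 2 * ρ (y - x)) := by
          congr 1; ext y; ring
      _ = (∫ y, ‖q y‖ ^ 2 * ρ (y - x)) - (2 * c) * c + c ^ 2 * 1 := by
          rw [integral_add h1 (hρi.const_mul _), integral_sub hi2 (hi1.const_mul _),
            integral_const_mul, integral_const_mul, hρ1]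
      _ = _ := by ring
  linarith

lemma IsMollifier.integrable_and_integral_sq (hρ : IsMollifier ε ρ) (hq : MemLp q 2 volume) :
    Integrable (fun x => ∫ y, ‖q y‖ ^ 2 * ρ (y - x)) ∧
      ∫ x, ∫ y, ‖q y‖ ^ 2 * ρ (y - x) = l2norm q ^ 2 := by
  have hρi : Integrable ρ := hρ.contDiff.continuous.integrable_of_hasCompactSupport hρ.compact
  have heq : (fun x => ∫ y, ‖q y‖ ^ 2 * ρ (y - x)) =
      (fun y => ‖q y‖ ^ 2) ⋆[ContinuousLinearMap.mul ℝ ℝ, volume] ρ := by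
    ext x
    simp only [convolution_def, ContinuousLinearMap.mul_apply']
    congr 1
    ext y
    rw [← hρ.even, neg_sub]
  rw [heq]
  refine ⟨(integrable_norm_sq hq).integrable_convolution _ hρi, ?_⟩
  rw [integral_convolution _ (integrable_norm_sq hq) hρi, hρ.integral_eq, l2norm_sq hq]
  simp

lemma IsMollifier.memLp_mollify (hρ : IsMollifier ε ρ) (hq : MemLp q 2 volume) :
    MemLp (mollify ρ q) 2 volume := by
  have hm := (hρ.continuous_mollify hq).aestronglyMeasurable (μ := volume)
  rw [memLp_two_iff_integrable_sq_norm hm]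
  refine (hρ.integrable_and_integral_sq hq).1.mono' (hm.norm.pow 2)
    (Filter.Eventually.of_forall fun x => ?_)
  rw [Real.norm_of_nonneg (by positivity)]
  exact hρ.norm_mollify_sq_le hq x

lemma IsMollifier.l2norm_mollify_le (hρ : IsMollifier ε ρ) (hq : MemLp q 2 volume) :
    l2norm (mollify ρ q) ≤ l2norm q := by
  refine (sq_le_sq₀ (l2norm_nonneg _) (l2norm_nonneg _)).1 ?_
  rw [l2norm_sq (hρ.memLp_mollify hq), ← (hρ.integrable_and_integral_sq hq).2]
  exact integral_mono (integrable_norm_sq (hρ.memLp_mollify hq))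
    (hρ.integrable_and_integral_sq hq).1 fun x => hρ.norm_mollify_sq_le hq x

lemma IsMollifier.diffLap_mollify (hρ : IsMollifier ε ρ) (hq : MemLp q 2 volume) (h : ℝ)
    (x : Euc d) : diffLap h (mollify ρ q) x =
      ∫ y, q y * diffLap h (fun z => (ρ z : ℂ)) (y - x) := by
  have hmρ : MemLp (fun z => (ρ z : ℂ)) 2 volume :=
    memLp_of_contDiff hρ.contDiff_ofReal hρ.compact_ofReal
  have hi := integrable_mul_sub hq hmρ
  have hsec : ∀ s, secDiff s (mollify ρ q) x =
      ∫ y, q y * secDiff s (fun z => (ρ z : ℂ)) (y - x) := by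
    intro s
    have h1 : Integrable fun y => 2 * (q y * (ρ (y - x) : ℂ)) - q y * (ρ (y - (x + s)) : ℂ) :=
      ((hi x).const_mul 2).sub (hi (x + s))
    rw [secDiff, mollify, mollify, mollify, ← integral_const_mul,
      ← integral_sub ((hi x).const_mul 2) (hi (x + s)), ← integral_sub h1 (hi (x - s))]
    congr 1
    ext y
    rw [secDiff, show y - (x + s) = y - x - s by abel, show y - (x - s) = y - x + s by abel]
    ring
  simp only [diffLap, hsec, Finset.mul_sum]
  rw [integral_finsetSum]
  · refine Finset.sum_congr rfl fun j _ => ?_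
    rw [← integral_const_mul]
    congr 1
    ext y
    ring
  · intro j _
    exact integrable_mul_sub hq ((memLp_secDiff hmρ _).const_mul _) x

lemma pd_comp_sub (u : Euc d → ℂ) (x : Euc d) (j : Fin d) :
    pd j (fun y => u (y - x)) = fun y => pd j u (y - x) := by
  ext y
  simp only [pd]
  rw [fderiv_comp_sub]

lemma lapl_comp_sub (u : Euc d → ℂ) (x y : Euc d) :
    lapl d (fun y => u (y - x)) y = lapl d u (y - x) := by
  simp only [lapl_eq_sum_pd, pd_comp_sub]

/-- An even mollifier obtained from a smooth bump function. -/
lemma isMollifier_normed (φ : ContDiffBump (0 : Euc d)) :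
    IsMollifier φ.rOut (φ.normed volume) where
  contDiff := φ.contDiff_normed
  compact := φ.hasCompactSupport_normed
  nonneg := φ.nonneg_normed
  integral_eq := φ.integral_normed
  even := φ.normed_neg
  support x hx := by
    by_contra hne
    have : x ∈ Function.support (φ.normed volume) := hne
    rw [φ.support_normed_eq, mem_ball_zero_iff] at this
    linarith

lemma ae_tendsto_mollify (hq : MemLp q 2 volume) {φ : ℕ → ContDiffBump (0 : Euc d)}
    (h1 : Filter.Tendsto (fun n => (φ n).rOut) Filter.atTop (𝓝 0)) {K : ℝ}
    (h2 : ∀ n, (φ n).rOut ≤ K * (φ n).rIn) :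
    ∀ᵐ x, Filter.Tendsto (fun n => mollify ((φ n).normed volume) q x) Filter.atTop (𝓝 (q x)) := by
  have := ContDiffBump.ae_convolution_tendsto_right_of_locallyIntegrable h1
    (Filter.Eventually.of_forall h2) (hq.locallyIntegrable (by norm_num))
  filter_upwards [this] with x hx
  refine hx.congr fun n => ?_
  rw [convolution_lsmul_swap, mollify]
  congr 1
  ext y
  rw [← (φ n).normed_neg, neg_sub, real_smul, mul_comm]

end Mollify

section Density

open scoped Topology

variable {d : ℕ} {q : Euc d → ℂ} {ρ : Euc d → ℝ} {ε : ℝ} {W : Euc d → ℝ} {a : ℝ}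

lemma IsMollifier.norm_commutator_le (hρ : IsMollifier ε ρ) (hq : MemLp q 2 volume)
    (hW : Continuous W) {ω : ℝ} {x : Euc d} (hω : ∀ y, ‖y - x‖ < ε → |W y - W x| ≤ ω) :
    ‖(∫ y, q y * ((W y : ℂ) * (ρ (y - x) : ℂ))) - (W x : ℂ) * mollify ρ q x‖ ≤
      ω * ‖mollify ρ (fun y => (‖q y‖ : ℂ)) x‖ := by
  have hmρ : MemLp (fun z => (ρ z : ℂ)) 2 volume :=
    memLp_of_contDiff hρ.contDiff_ofReal hρ.compact_ofReal
  have hmW : MemLp (fun y => (W y : ℂ) * (ρ (y - x) : ℂ)) 2 volume := by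
    have h1 := hρ.contDiff.continuous
    have h2 : HasCompactSupport fun y => (ρ (y - x) : ℂ) := by
      simpa [Function.comp_def] using
        hρ.compact_ofReal.comp_homeomorph (Homeomorph.subRight x)
    exact Continuous.memLp_of_hasCompactSupport (by fun_prop) h2.mul_left
  have hqn : MemLp (fun y => (‖q y‖ : ℂ)) 2 volume := hq.norm.ofReal
  have hi := integrable_mul_sub hqn hmρ x
  have hiW : Integrable fun y => q y * ((W y : ℂ) * (ρ (y - x) : ℂ)) := hq.integrable_mul hmW
  rw [mollify, ← integral_const_mul, ← integral_sub hiW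
    ((integrable_mul_sub hq hmρ x).const_mul _)]
  have hm : ‖mollify ρ (fun y => (‖q y‖ : ℂ)) x‖ = ∫ y, ‖q y‖ * ρ (y - x) := by
    have h1 : mollify ρ (fun y => (‖q y‖ : ℂ)) x = ((∫ y, ‖q y‖ * ρ (y - x) : ℝ) : ℂ) := by
      rw [mollify, ← integral_complex_ofReal]
      simp
    rw [h1, norm_real, Real.norm_of_nonneg]
    exact integral_nonneg fun y => mul_nonneg (norm_nonneg _) (hρ.nonneg _)
  rw [hm, ← integral_const_mul]
  refine norm_integral_le_of_norm_le ?_ (Filter.Eventually.of_forall fun y => ?_)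
  · have := (hi.norm).const_mul ω
    refine this.congr (Filter.Eventually.of_forall fun y => ?_)
    simp [abs_of_nonneg (hρ.nonneg (y - x))]
  · have h1 : q y * ((W y : ℂ) * (ρ (y - x) : ℂ)) - (W x : ℂ) * (q y * (ρ (y - x) : ℂ)) =
        ((W y - W x : ℝ) : ℂ) * (q y * (ρ (y - x) : ℂ)) := by push_cast; ring
    rw [h1, norm_mul, norm_mul, norm_real, norm_real, Real.norm_of_nonneg (hρ.nonneg _),
      Real.norm_eq_abs]
    rcases lt_or_ge ‖y - x‖ ε with hy | hy
    · exact mul_le_mul_of_nonneg_right (hω y hy) (mul_nonneg (norm_nonneg _) (hρ.nonneg _))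
    · rw [hρ.support _ hy]
      simp

lemma IsMollifier.diffLap_mollify_eq (hρ : IsMollifier ε ρ) (hq : MemLp q 2 volume)
    (hW : Continuous W) (horth : ∀ u : Euc d → ℂ, ContDiff ℝ (⊤ : ℕ∞) u → HasCompactSupport u →
      ∫ y, q y * schr W a u y = 0) (h : ℝ) (x : Euc d) :
    diffLap h (mollify ρ q) x =
      (∫ y, q y * (diffLap h (fun z => (ρ z : ℂ)) (y - x) + lapl d (fun z => (ρ z : ℂ)) (y - x)))
        - (∫ y, q y * ((W y : ℂ) * (ρ (y - x) : ℂ))) - (a : ℂ) * mollify ρ q x := by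
  have hmρ : MemLp (fun z => (ρ z : ℂ)) 2 volume :=
    memLp_of_contDiff hρ.contDiff_ofReal hρ.compact_ofReal
  have hml : MemLp (lapl d fun z => (ρ z : ℂ)) 2 volume :=
    memLp_of_contDiff (contDiff_lapl hρ.contDiff_ofReal) (hasCompactSupport_lapl hρ.compact_ofReal)
  have hcs : HasCompactSupport fun y => (ρ (y - x) : ℂ) := by
    simpa [Function.comp_def] using hρ.compact_ofReal.comp_homeomorph (Homeomorph.subRight x)
  have hcd : ContDiff ℝ (⊤ : ℕ∞) fun y => (ρ (y - x) : ℂ) :=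
    hρ.contDiff_ofReal.comp (contDiff_id.sub contDiff_const)
  have hmW : MemLp (fun y => (W y : ℂ) * (ρ (y - x) : ℂ)) 2 volume :=
    memLp_mul_of_continuous hcd hcs hW
  have h0 := horth _ hcd hcs
  have hiW : Integrable fun y => q y * ((W y : ℂ) * (ρ (y - x) : ℂ)) := hq.integrable_mul hmW
  have hiD := integrable_mul_sub hq (memLp_diffLap hmρ h) x
  have hiL := integrable_mul_sub hq hml x
  have hiρ := (integrable_mul_sub hq hmρ x).const_mul (a : ℂ)
  have hiLn : Integrable fun y => -(q y * lapl d (fun z => (ρ z : ℂ)) (y - x)) := hiL.neg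
  have hiS : Integrable fun y => q y * ((W y : ℂ) * (ρ (y - x) : ℂ)) +
      (a : ℂ) * (q y * (ρ (y - x) : ℂ)) := hiW.add hiρ
  have h1 : ∫ y, q y * schr W a (fun y => (ρ (y - x) : ℂ)) y =
      -(∫ y, q y * lapl d (fun z => (ρ z : ℂ)) (y - x)) +
        ((∫ y, q y * ((W y : ℂ) * (ρ (y - x) : ℂ))) + (a : ℂ) * mollify ρ q x) := by
    rw [mollify, ← integral_const_mul, ← integral_neg, ← integral_add hiW hiρ,
      ← integral_add hiLn hiS]
    congr 1
    ext y
    simp only [schr, lapl_comp_sub (fun z => (ρ z : ℂ))]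
    ring
  rw [h1] at h0
  have h2 : ∫ y, q y * (diffLap h (fun z => (ρ z : ℂ)) (y - x) +
      lapl d (fun z => (ρ z : ℂ)) (y - x)) = (∫ y, q y * diffLap h (fun z => (ρ z : ℂ)) (y - x)) +
        ∫ y, q y * lapl d (fun z => (ρ z : ℂ)) (y - x) := by
    rw [← integral_add hiD hiL]
    simp only [mul_add]
  rw [hρ.diffLap_mollify hq, h2]
  linear_combination h0

lemma IsMollifier.l2norm_cutoff_mollify_sq_le (hρ : IsMollifier ε ρ) (hq : MemLp q 2 volume)
    (hW : Continuous W) (ha : ∀ x, 1 ≤ W x + a)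
    (horth : ∀ u : Euc d → ℂ, ContDiff ℝ (⊤ : ℕ∞) u → HasCompactSupport u →
      ∫ y, q y * schr W a u y = 0)
    {χ : Euc d → ℝ} (hχc : Continuous χ) (hχs : HasCompactSupport χ)
    (hχ1 : ∀ x, |χ x| ≤ 1) {L ω : ℝ} (hω0 : 0 ≤ ω) (hχL : ∀ x y, |χ y - χ x| ≤ L * dist x y)
    (hω : ∀ x y, χ x ≠ 0 → ‖y - x‖ < ε → |W y - W x| ≤ ω) :
    l2norm (fun x => (χ x : ℂ) * mollify ρ q x) ^ 2 ≤ (d * L ^ 2 + ω) * l2norm q ^ 2 := by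
  set P := mollify ρ q
  set m := mollify ρ fun y => (‖q y‖ : ℂ)
  set Q := l2norm q
  set E : ℝ → ℝ := fun h => l2norm fun z =>
    diffLap h (fun z => (ρ z : ℂ)) z + lapl d (fun z => (ρ z : ℂ)) z
  have hmρ : MemLp (fun z => (ρ z : ℂ)) 2 volume :=
    memLp_of_contDiff hρ.contDiff_ofReal hρ.compact_ofReal
  have hml : MemLp (lapl d fun z => (ρ z : ℂ)) 2 volume :=
    memLp_of_contDiff (contDiff_lapl hρ.contDiff_ofReal) (hasCompactSupport_lapl hρ.compact_ofReal)
  have hQ : 0 ≤ Q := l2norm_nonneg _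
  have hqn : MemLp (fun y => (‖q y‖ : ℂ)) 2 volume := hq.norm.ofReal
  have hP : MemLp P 2 volume := hρ.memLp_mollify hq
  have hm : MemLp m 2 volume := hρ.memLp_mollify hqn
  have hPQ : l2norm P ≤ Q := hρ.l2norm_mollify_le hq
  have hmQ : l2norm m ≤ Q := (hρ.l2norm_mollify_le hqn).trans_eq (l2norm_norm q)
  have hPc : Continuous P := hρ.continuous_mollify hq
  have hχP : MemLp (fun x => (χ x : ℂ) * P x) 2 volume :=
    Continuous.memLp_of_hasCompactSupport (by fun_prop)
      (HasCompactSupport.mul_right (hχs.comp_left (g := fun t : ℝ => (t : ℂ)) ofReal_zero))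
  have hχ2 : MemLp (fun x => ((χ x ^ 2 : ℝ) : ℂ)) 2 volume :=
    Continuous.memLp_of_hasCompactSupport (by fun_prop)
      (hχs.comp_left (g := fun t : ℝ => ((t ^ 2 : ℝ) : ℂ)) (by simp))
  have hχ2P : MemLp (fun x => ((χ x ^ 2 : ℝ) : ℂ) * P x) 2 volume :=
    Continuous.memLp_of_hasCompactSupport (by fun_prop)
      (HasCompactSupport.mul_right (hχs.comp_left (g := fun t : ℝ => ((t ^ 2 : ℝ) : ℂ)) (by simp)))
  set K := l2norm fun x => ((χ x ^ 2 : ℝ) : ℂ)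
  have hEb : ∀ h x, ‖∫ y, q y * (diffLap h (fun z => (ρ z : ℂ)) (y - x) +
      lapl d (fun z => (ρ z : ℂ)) (y - x))‖ ≤ Q * E h := fun h x =>
    norm_integral_mul_sub_le hq ((memLp_diffLap hmρ h).add hml) x
  have hpt : ∀ h x, (conj (((χ x ^ 2 : ℝ) : ℂ) * P x) * diffLap h P x).re ≤
      (Q * E h) * (‖((χ x ^ 2 : ℝ) : ℂ)‖ * ‖P x‖) + ω * (‖P x‖ * ‖m x‖)
        - ‖(χ x : ℂ) * P x‖ ^ 2 := by
    intro h x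
    have hE0 : 0 ≤ Q * E h := mul_nonneg hQ (l2norm_nonneg _)
    by_cases hx : χ x = 0
    · simp only [hx]
      have := mul_nonneg hω0 (mul_nonneg (norm_nonneg (P x)) (norm_nonneg (m x)))
      simpa using this
    · rw [hρ.diffLap_mollify_eq hq hW horth]
      set e := ∫ y, q y * (diffLap h (fun z => (ρ z : ℂ)) (y - x) +
        lapl d (fun z => (ρ z : ℂ)) (y - x)) with he
      set g := ∫ y, q y * ((W y : ℂ) * (ρ (y - x) : ℂ)) with hg
      have hg' : ‖g - (W x : ℂ) * P x‖ ≤ ω * ‖m x‖ :=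
        hρ.norm_commutator_le hq hW (hω x · hx)
      have he' : ‖e‖ ≤ Q * E h := hEb h x
      have hdec : conj (((χ x ^ 2 : ℝ) : ℂ) * P x) * (e - g - (a : ℂ) * mollify ρ q x) =
          ((χ x ^ 2 : ℝ) : ℂ) * (conj (P x) * e) -
          ((χ x ^ 2 : ℝ) : ℂ) * (conj (P x) * (g - (W x : ℂ) * P x)) -
          ((χ x ^ 2 * (W x + a) : ℝ) : ℂ) * (conj (P x) * P x) := by
        change conj (((χ x ^ 2 : ℝ) : ℂ) * P x) * (e - g - (a : ℂ) * P x) = _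
        rw [map_mul, conj_ofReal]
        push_cast
        ring
      rw [hdec, conj_mul']
      simp only [sub_re, re_ofReal_mul, ← ofReal_pow, ofReal_re]
      have hχsq : 0 ≤ χ x ^ 2 := sq_nonneg _
      have hχsq1 : χ x ^ 2 ≤ 1 := by
        rw [← sq_abs]; exact pow_le_one₀ (abs_nonneg _) (hχ1 x)
      have i1 : (conj (P x) * e).re ≤ ‖P x‖ * (Q * E h) := by
        refine (re_le_norm _).trans ?_
        rw [norm_mul, RCLike.norm_conj]
        exact mul_le_mul_of_nonneg_left he' (norm_nonneg _)
      have i2 : -(conj (P x) * (g - (W x : ℂ) * P x)).re ≤ ‖P x‖ * (ω * ‖m x‖) := by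
        refine (neg_le_abs _).trans ((abs_re_le_norm _).trans ?_)
        rw [norm_mul, RCLike.norm_conj]
        exact mul_le_mul_of_nonneg_left hg' (norm_nonneg _)
      have i3 : 0 ≤ ‖P x‖ * (ω * ‖m x‖) := by positivity
      have hn : ‖(χ x : ℂ) * P x‖ ^ 2 = χ x ^ 2 * ‖P x‖ ^ 2 := by
        rw [norm_mul, mul_pow, norm_real, Real.norm_eq_abs, sq_abs]
      rw [hn, norm_real, Real.norm_of_nonneg hχsq]
      have j1 := mul_le_mul_of_nonneg_left i1 hχsq
      have j2 := mul_le_mul_of_nonneg_left i2 hχsq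
      have j3 := mul_le_mul_of_nonneg_right hχsq1 i3
      have j4 : χ x ^ 2 * ‖P x‖ ^ 2 ≤ χ x ^ 2 * (W x + a) * ‖P x‖ ^ 2 := by
        have := mul_le_mul_of_nonneg_left (ha x) hχsq
        rw [mul_one] at this
        exact mul_le_mul_of_nonneg_right this (sq_nonneg _)
      nlinarith
  have hh : ∀ h, 0 < h → l2norm (fun x => (χ x : ℂ) * P x) ^ 2 ≤
      (d * L ^ 2 + ω) * Q ^ 2 + Q * E h * (K * Q) := by
    intro h hh
    have h1 := re_integral_cutoff_ge (L := L) hh (fun x j => by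
      have := hχL x (x + h • stdVec d j)
      rwa [dist_add_smul_stdVec, abs_of_pos hh] at this) hP hχ2P
    have hi1 := (integrable_norm_mul hχ2 hP).const_mul (Q * E h)
    have hi2 := (integrable_norm_mul hP hm).const_mul ω
    have hi3 := integrable_norm_sq hχP
    have hi12 : Integrable fun x => (Q * E h) * (‖((χ x ^ 2 : ℝ) : ℂ)‖ * ‖P x‖) +
      ω * (‖P x‖ * ‖m x‖) := hi1.add hi2
    have h2 : (∫ x, conj (((χ x ^ 2 : ℝ) : ℂ) * P x) * diffLap h P x).re ≤
        (Q * E h) * (∫ x, ‖((χ x ^ 2 : ℝ) : ℂ)‖ * ‖P x‖) + ω * (∫ x, ‖P x‖ * ‖m x‖) -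
          ∫ x, ‖(χ x : ℂ) * P x‖ ^ 2 := by
      have hic := integrable_conj_mul hχ2P (memLp_diffLap hP h)
      have h3 : (∫ x, conj (((χ x ^ 2 : ℝ) : ℂ) * P x) * diffLap h P x).re =
          ∫ x, (conj (((χ x ^ 2 : ℝ) : ℂ) * P x) * diffLap h P x).re := (integral_re hic).symm
      rw [h3, ← integral_const_mul, ← integral_const_mul, ← integral_add hi1 hi2,
        ← integral_sub hi12 hi3]
      exact integral_mono hic.re (hi12.sub hi3) (hpt h)
    have h4 := integral_norm_mul_le hχ2 hP
    have h5 := integral_norm_mul_le hP hm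
    have hE0 : 0 ≤ Q * E h := mul_nonneg hQ (l2norm_nonneg _)
    have hK : 0 ≤ K := l2norm_nonneg _
    have h6 := mul_le_mul_of_nonneg_left
      (h4.trans (mul_le_mul_of_nonneg_left hPQ hK)) hE0
    have h7 := mul_le_mul_of_nonneg_left
      (h5.trans (mul_le_mul hPQ hmQ (l2norm_nonneg _) hQ)) hω0
    have h8 : l2norm P ^ 2 ≤ Q ^ 2 := pow_le_pow_left₀ (l2norm_nonneg _) hPQ 2
    have h9 : (0 : ℝ) ≤ d * L ^ 2 := by positivity
    have h10 := mul_le_mul_of_nonneg_left h8 h9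
    rw [← l2norm_sq hχP] at h2
    nlinarith
  have ht := ((tendsto_l2norm_diffLap hρ.contDiff_ofReal hρ.compact_ofReal).const_mul Q).mul_const
    (K * Q) |>.const_add ((d * L ^ 2 + ω) * Q ^ 2)
  rw [mul_zero, zero_mul, add_zero] at ht
  refine ge_of_tendsto ht ?_
  filter_upwards [self_mem_nhdsWithin] with h h0 using hh h h0

/-- The standard cutoff, equal to `1` on the ball of radius `r` and to `0` outside the ball of
radius `2r`. -/
def cutoff {d : ℕ} (r : ℝ) (x : Euc d) : ℝ := max 0 (min 1 (2 - ‖x‖ / r))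

lemma continuous_cutoff (r : ℝ) : Continuous (cutoff r : Euc d → ℝ) := by
  unfold cutoff
  fun_prop

lemma cutoff_eq_zero {r : ℝ} (hr : 0 < r) {x : Euc d} (hx : 2 * r ≤ ‖x‖) : cutoff r x = 0 := by
  have : 2 ≤ ‖x‖ / r := (le_div_iff₀ hr).2 hx
  exact max_eq_left ((min_le_right _ _).trans (by linarith))

lemma abs_cutoff_le (r : ℝ) (x : Euc d) : |cutoff r x| ≤ 1 := by
  rw [cutoff, abs_of_nonneg (le_max_left _ _)]
  exact max_le zero_le_one (min_le_left _ _)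

lemma abs_cutoff_sub_le {r : ℝ} (hr : 0 < r) (x y : Euc d) :
    |cutoff r y - cutoff r x| ≤ r⁻¹ * dist x y := by
  have h1 : |(2 - ‖y‖ / r) - (2 - ‖x‖ / r)| ≤ r⁻¹ * dist x y := by
    have : (2 - ‖y‖ / r) - (2 - ‖x‖ / r) = r⁻¹ * (‖x‖ - ‖y‖) := by field_simp; ring
    rw [this, abs_mul, abs_of_pos (inv_pos.2 hr), dist_eq_norm]
    exact mul_le_mul_of_nonneg_left (abs_norm_sub_norm_le x y) (inv_pos.2 hr).le
  refine le_trans ?_ h1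
  refine (abs_max_sub_max_le_max _ _ _ _).trans ?_
  rw [sub_self, abs_zero, max_eq_right (abs_nonneg _)]
  refine (abs_min_sub_min_le_max _ _ _ _).trans ?_
  rw [sub_self, abs_zero, max_eq_right (abs_nonneg _)]

lemma cutoff_eq_one {r : ℝ} (hr : 0 < r) {x : Euc d} (hx : ‖x‖ ≤ r) : cutoff r x = 1 := by
  have : ‖x‖ / r ≤ 1 := (div_le_one hr).2 hx
  rw [cutoff, min_eq_left (by linarith), max_eq_right zero_le_one]

lemma hasCompactSupport_cutoff {r : ℝ} (hr : 0 < r) :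
    HasCompactSupport (cutoff r : Euc d → ℝ) :=
  HasCompactSupport.intro (isCompact_closedBall 0 (2 * r)) fun x hx => by
    refine cutoff_eq_zero hr ?_
    rw [mem_closedBall_zero_iff] at hx
    linarith

/-- Essential self-adjointness: an `L²` function annihilating the range of `−Δ + W + a` on test
functions vanishes. -/
lemma ae_eq_zero_of_orthogonal (hq : MemLp q 2 volume)
    (hW : Continuous W) (ha : ∀ x, 1 ≤ W x + a)
    (horth : ∀ u : Euc d → ℂ, ContDiff ℝ (⊤ : ℕ∞) u → HasCompactSupport u →
      ∫ y, q y * schr W a u y = 0) : q =ᵐ[volume] 0 := by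
  have hex : ∀ n : ℕ, ∃ ε > 0, ε ≤ 1 / ((n : ℝ) + 1) ∧ ∀ x y : Euc d, cutoff ((n : ℝ) + 1) x ≠ 0 →
      ‖y - x‖ < ε → |W y - W x| ≤ 1 / ((n : ℝ) + 1) := by
    intro n
    have hn : (0 : ℝ) < (n : ℝ) + 1 := by positivity
    have huc := (isCompact_closedBall (0 : Euc d) (2 * ((n : ℝ) + 1) + 1)).uniformContinuousOn_of_continuous
      hW.continuousOn
    obtain ⟨δ, hδ, H⟩ := Metric.uniformContinuousOn_iff.1 huc (1 / ((n : ℝ) + 1)) (by positivity)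
    refine ⟨min δ (1 / ((n : ℝ) + 1)), by positivity, min_le_right _ _, fun x y hx hy => ?_⟩
    have hx2 : ‖x‖ ≤ 2 * ((n : ℝ) + 1) := by
      by_contra! hlt
      exact hx (cutoff_eq_zero hn hlt.le)
    have h1 : ‖y - x‖ < 1 := by
      refine hy.trans_le ((min_le_right _ _).trans ?_)
      rw [div_le_one hn]
      linarith [Nat.cast_nonneg (α := ℝ) n]
    have hy2 := norm_le_norm_add_norm_sub' y x
    refine (H y ?_ x ?_ ?_).le
    · rw [mem_closedBall_zero_iff]; linarith
    · rw [mem_closedBall_zero_iff]; linarith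
    · rw [dist_eq_norm]; exact hy.trans_le (min_le_left _ _)
  choose ε hε hεn hω using hex
  let φ : ℕ → ContDiffBump (0 : Euc d) := fun n =>
    ⟨ε n / 2, ε n, by have := hε n; positivity, by have := hε n; linarith⟩
  have hr : Filter.Tendsto (fun n => (φ n).rOut) Filter.atTop (𝓝 0) :=
    squeeze_zero (fun n => (hε n).le) hεn tendsto_one_div_add_atTop_nhds_zero_nat
  have hae := ae_tendsto_mollify hq hr (K := 2) (fun n => le_of_eq (by simp only [φ]; ring))
  set f : ℕ → Euc d → ℂ := fun n x =>
    (cutoff ((n : ℝ) + 1) x : ℂ) * mollify ((φ n).normed volume) q x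
  have hfm : ∀ n, MemLp (f n) 2 volume := fun n => by
    have hn : (0 : ℝ) < (n : ℝ) + 1 := by positivity
    have h1 := (isMollifier_normed (φ n)).continuous_mollify hq
    have h2 := continuous_cutoff (d := d) ((n : ℝ) + 1)
    exact Continuous.memLp_of_hasCompactSupport (by fun_prop) (HasCompactSupport.mul_right
      ((hasCompactSupport_cutoff hn).comp_left (g := fun t : ℝ => (t : ℂ)) ofReal_zero))
  have hfle : ∀ n, l2norm (f n) ^ 2 ≤ (d + 1) * (1 / ((n : ℝ) + 1)) * l2norm q ^ 2 := fun n => by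
    have hn : (0 : ℝ) < (n : ℝ) + 1 := by positivity
    refine ((isMollifier_normed (φ n)).l2norm_cutoff_mollify_sq_le hq hW ha horth
      (continuous_cutoff _) (hasCompactSupport_cutoff hn) (abs_cutoff_le _)
      (ω := 1 / ((n : ℝ) + 1)) (by positivity) (abs_cutoff_sub_le hn) (hω n)).trans ?_
    refine mul_le_mul_of_nonneg_right ?_ (sq_nonneg _)
    have h1 : ((n : ℝ) + 1)⁻¹ ≤ 1 := inv_le_one_of_one_le₀ (by linarith [Nat.cast_nonneg (α := ℝ) n])
    have h2 : (0 : ℝ) ≤ ((n : ℝ) + 1)⁻¹ := by positivity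
    have h3 : (((n : ℝ) + 1)⁻¹) ^ 2 ≤ ((n : ℝ) + 1)⁻¹ := by nlinarith
    have h4 := mul_le_mul_of_nonneg_left h3 (Nat.cast_nonneg (α := ℝ) d)
    rw [one_div]
    linarith
  have hlim : Filter.Tendsto (fun n => l2norm (f n)) Filter.atTop (𝓝 0) := by
    have h1 : Filter.Tendsto (fun n => l2norm (f n) ^ 2) Filter.atTop (𝓝 0) := by
      refine squeeze_zero (fun n => sq_nonneg _) hfle ?_
      have := (tendsto_one_div_add_atTop_nhds_zero_nat (𝕜 := ℝ)).const_mul ((d : ℝ) + 1)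
        |>.mul_const (l2norm q ^ 2)
      simpa using this
    have h2 := h1.sqrt
    simpa [Real.sqrt_sq (l2norm_nonneg _)] using h2
  have hlimE : Filter.Tendsto (fun n => eLpNorm (f n) 2 volume) Filter.atTop (𝓝 0) := by
    have h1 := ENNReal.tendsto_ofReal hlim
    rw [ENNReal.ofReal_zero] at h1
    exact h1.congr fun n => ENNReal.ofReal_toReal (hfm n).2.ne
  have hfae : ∀ᵐ x, Filter.Tendsto (fun n => f n x) Filter.atTop (𝓝 (q x)) := by
    filter_upwards [hae] with x hx
    refine hx.congr' ?_
    obtain ⟨N, hN⟩ := exists_nat_ge ‖x‖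
    filter_upwards [Filter.eventually_ge_atTop N] with n hn
    have : ‖x‖ ≤ (n : ℝ) + 1 := hN.trans ((Nat.cast_le.2 hn).trans (by linarith))
    simp [f, cutoff_eq_one (by positivity) this]
  have hle := Lp.eLpNorm_lim_le_liminf_eLpNorm (p := 2) (fun n => (hfm n).1) q hfae
  rw [hlimE.liminf_eq] at hle
  exact (eLpNorm_eq_zero_iff hq.1 (by norm_num)).1 (le_antisymm hle bot_le)

lemma pd_add {u v : Euc d → ℂ} (hu : ContDiff ℝ (⊤ : ℕ∞) u) (hv : ContDiff ℝ (⊤ : ℕ∞) v)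
    (j : Fin d) : pd j (u + v) = pd j u + pd j v := by
  ext x
  simp only [pd, Pi.add_apply]
  rw [fderiv_add (hu.differentiable (by simp) x) (hv.differentiable (by simp) x)]
  rfl

lemma pd_const_smul {u : Euc d → ℂ} (hu : ContDiff ℝ (⊤ : ℕ∞) u) (c : ℂ) (j : Fin d) :
    pd j (c • u) = c • pd j u := by
  ext x
  simp only [pd, Pi.smul_apply]
  rw [fderiv_const_smul (hu.differentiable (by simp) x)]
  rfl

lemma schr_add {u v : Euc d → ℂ} (hu : ContDiff ℝ (⊤ : ℕ∞) u) (hv : ContDiff ℝ (⊤ : ℕ∞) v)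
    (W : Euc d → ℝ) (a : ℝ) (x : Euc d) :
    schr W a (u + v) x = schr W a u x + schr W a v x := by
  simp only [schr, lapl_eq_sum_pd, pd_add hu hv, pd_add (contDiff_pd hu _) (contDiff_pd hv _),
    Pi.add_apply, Finset.sum_add_distrib]
  ring

lemma schr_const_smul {u : Euc d → ℂ} (hu : ContDiff ℝ (⊤ : ℕ∞) u) (c : ℂ)
    (W : Euc d → ℝ) (a : ℝ) (x : Euc d) : schr W a (c • u) x = c * schr W a u x := by
  simp only [schr, lapl_eq_sum_pd, pd_const_smul hu, pd_const_smul (contDiff_pd hu _),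
    Pi.smul_apply, smul_eq_mul, ← Finset.mul_sum]
  ring

/-- The range of `−Δ + W + a` on test functions. -/
def schrRange {d : ℕ} (W : Euc d → ℝ) (a : ℝ) : Submodule ℂ (L2 d) where
  carrier := {f | ∃ (u : Euc d → ℂ) (_ : ContDiff ℝ (⊤ : ℕ∞) u) (_ : HasCompactSupport u),
    f =ᵐ[volume] schr W a u}
  add_mem' := by
    rintro f g ⟨u, hu, hc, hf⟩ ⟨v, hv, hc', hg⟩
    refine ⟨u + v, hu.add hv, hc.add hc', ?_⟩
    filter_upwards [hf, hg, Lp.coeFn_add f g] with x h1 h2 h3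
    rw [h3, Pi.add_apply, h1, h2, schr_add hu hv]
  zero_mem' := by
    have hz : ContDiff ℝ (⊤ : ℕ∞) (0 : Euc d → ℂ) := contDiff_const
    refine ⟨0, hz, HasCompactSupport.zero, ?_⟩
    filter_upwards [Lp.coeFn_zero ℂ 2 (volume : Measure (Euc d))] with x h1
    have := schr_const_smul hz 0 W a x
    rw [zero_smul, zero_mul] at this
    rw [h1, this, Pi.zero_apply]
  smul_mem' := by
    rintro c f ⟨u, hu, hc, hf⟩
    refine ⟨c • u, hu.const_smul c, hc.smul_left (f := fun _ => c), ?_⟩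
    filter_upwards [hf, Lp.coeFn_smul c f] with x h1 h2
    rw [h2, Pi.smul_apply, h1, schr_const_smul hu, smul_eq_mul]

lemma dense_schrRange (hW : Continuous W) (ha : ∀ x, 1 ≤ W x + a) :
    Dense (schrRange W a : Set (L2 d)) := by
  rw [Submodule.dense_iff_topologicalClosure_eq_top, Submodule.topologicalClosure_eq_top_iff,
    Submodule.eq_bot_iff]
  intro g hg
  rw [Submodule.mem_orthogonal'] at hg
  have hgm := Lp.memLp g
  have h0 := ae_eq_zero_of_orthogonal hgm.conj hW ha fun u hu hc => by
    have h1 := hg _ ⟨u, hu, hc, (memLp_schr (a := a) hu hc hW).coeFn_toLp⟩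
    rwa [← Lp.toLp_coeFn g hgm, inner_toLp_toLp] at h1
  rw [Lp.eq_zero_iff_ae_eq_zero]
  filter_upwards [h0] with x hx
  simpa using hx

end Density

section Resolvents

variable {d : ℕ} {V : Euc d → ℝ} {Mc : ℝ}

/-- A test function is recovered from its image under `−Δ + V + M` by the resolvent. -/
lemma resolvent_schr (hVc : Continuous V) {H : L2 d →ₗ.[ℂ] L2 d} (hH : IsSchrodingerOp d V H)
    {RM : L2 d →L[ℂ] L2 d} (hR : IsResolventAt H (-(Mc : ℂ)) RM) {u : Euc d → ℂ}
    (hu : ContDiff ℝ (⊤ : ℕ∞) u) (hc : HasCompactSupport u) {f : L2 d}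
    (hf : f =ᵐ[volume] schr V Mc u) : RM f = (memLp_of_contDiff hu hc).toLp u := by
  have hm : MemLp (fun x => -(lapl d u x) + (V x : ℂ) * u x) 2 volume :=
    (memLp_of_contDiff (contDiff_lapl hu) (hasCompactSupport_lapl hc)).neg.add
      (memLp_mul_of_continuous hu hc hVc)
  obtain ⟨hdom, hHu⟩ := hH.2 u hu hc (memLp_of_contDiff hu hc) hm
  have h1 := hR.2 ⟨_, hdom⟩
  rw [hHu] at h1
  refine (congrArg RM ?_).trans h1
  refine Lp.ext ?_
  filter_upwards [hf, hm.coeFn_toLp, (memLp_of_contDiff hu hc).coeFn_toLp,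
    Lp.coeFn_sub (hm.toLp _) ((-(Mc : ℂ)) • (memLp_of_contDiff hu hc).toLp u),
    Lp.coeFn_smul (-(Mc : ℂ)) ((memLp_of_contDiff hu hc).toLp u)] with x h2 h3 h4 h5 h6
  rw [h2, h5, Pi.sub_apply, h3, h6, Pi.smul_apply, h4, schr, smul_eq_mul]
  ring

lemma IsResolventAt.inner_symm {H : L2 d →ₗ.[ℂ] L2 d} (hH : IsSelfAdjoint H)
    {RM : L2 d →L[ℂ] L2 d} (hR : IsResolventAt H (-(Mc : ℂ)) RM) (f g : L2 d) :
    ⟪RM f, g⟫_ℂ = ⟪f, RM g⟫_ℂ := by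
  obtain ⟨hf, hf'⟩ := hR.1 f
  obtain ⟨hg, hg'⟩ := hR.1 g
  have hs : ⟪H ⟨RM f, hf⟩, RM g⟫_ℂ = ⟪RM f, H ⟨RM g, hg⟩⟫_ℂ := by
    have h1 := LinearPMap.adjoint_isFormalAdjoint hH.dense_domain
    rw [(LinearPMap.isSelfAdjoint_def).1 hH] at h1
    exact h1 ⟨RM f, hf⟩ ⟨RM g, hg⟩
  conv_lhs => rw [← hg']
  conv_rhs => rw [← hf']
  rw [inner_sub_left, inner_sub_right, hs, inner_smul_left, inner_smul_right]
  simp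

variable {h : ℝ}

lemma IsDiscreteHam.discAct_resolvent (hh : 0 < h) {Hh : l2h d h →ₗ.[ℂ] l2h d h}
    (hHh : IsDiscreteHam d h V Hh) {RhM : l2h d h →L[ℂ] l2h d h}
    (hR : IsResolventAt Hh (-(Mc : ℂ)) RhM) (g : l2h d h) (z : Zd d) :
    discAct d h V (RhM g : Zd d → ℂ) z + (Mc : ℂ) * (RhM g : Zd d → ℂ) z = (g : Zd d → ℂ) z := by
  obtain ⟨hd, hg⟩ := hR.1 g
  have h1 := (ae_latMeas_iff hh).1 (Lp.coeFn_sub (Hh ⟨RhM g, hd⟩) ((-(Mc : ℂ)) • RhM g)) z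
  have h2 := (ae_latMeas_iff hh).1 (Lp.coeFn_smul (-(Mc : ℂ)) (RhM g)) z
  rw [hg, Pi.sub_apply, h2, hHh.2] at h1
  rw [h1, Pi.smul_apply, smul_eq_mul]
  ring

lemma IsDiscreteHam.resolvent_discAct (hh : 0 < h) {Hh : l2h d h →ₗ.[ℂ] l2h d h}
    (hHh : IsDiscreteHam d h V Hh) {RhM : l2h d h →L[ℂ] l2h d h}
    (hR : IsResolventAt Hh (-(Mc : ℂ)) RhM) {v f : l2h d h}
    (hf : ∀ z, (f : Zd d → ℂ) z =
      discAct d h V (v : Zd d → ℂ) z + (Mc : ℂ) * (v : Zd d → ℂ) z) : RhM f = v := by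
  have hm : MemLp (discAct d h V (v : Zd d → ℂ)) 2 (latMeas d h) := by
    have h1 := (Lp.memLp f).sub ((Lp.memLp v).const_mul (Mc : ℂ))
    convert h1 using 1
    ext z
    rw [Pi.sub_apply, hf]
    ring
  have hd := hHh.1 v hm
  have h1 := hR.2 ⟨v, hd⟩
  refine (congrArg RhM ?_).trans h1
  refine Lp.ext ((ae_latMeas_iff hh).2 fun z => ?_)
  rw [(ae_latMeas_iff hh).1 (Lp.coeFn_sub _ _) z, Pi.sub_apply, hHh.2,
    (ae_latMeas_iff hh).1 (Lp.coeFn_smul _ _) z, hf, Pi.smul_apply, smul_eq_mul]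
  ring

/-- The embedded lattice resolvent equation. -/
lemma IsDiscreteHam.diffSchr_resolvent (hh : 0 < h) {Hh : l2h d h →ₗ.[ℂ] l2h d h}
    (hHh : IsDiscreteHam d h V Hh) {RhM : l2h d h →L[ℂ] l2h d h}
    (hR : IsResolventAt Hh (-(Mc : ℂ)) RhM) (M : ℝ) (g : l2h d h) :
    diffSchr h (fun x => V (cellPt d h x) + M) (Mc - M) (cellFun h (RhM g)) = cellFun h g := by
  ext x
  have h1 := hHh.discAct_resolvent hh hR g (cellIdx d h x)
  have h2 := cellFun_discAct hh V (RhM g) x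
  rw [cellFun] at h2
  rw [h2] at h1
  rw [diffSchr, cellFun, cellFun, ← h1]
  simp only [cellFun]
  push_cast
  ring

lemma IsDiscreteHam.memLp_potential_resolvent (hh : 0 < h) {Hh : l2h d h →ₗ.[ℂ] l2h d h}
    (hHh : IsDiscreteHam d h V Hh) {RhM : l2h d h →L[ℂ] l2h d h}
    (hR : IsResolventAt Hh (-(Mc : ℂ)) RhM) (M : ℝ) (g : l2h d h) :
    MemLp (fun x => ((V (cellPt d h x) + M : ℝ) : ℂ) * cellFun h (RhM g) x) 2 volume := by
  have hw := memLp_cellFun hh (Lp.memLp (RhM g))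
  have h1 := ((memLp_cellFun hh (Lp.memLp g)).sub (memLp_diffLap hw h)).sub
    (hw.const_mul ((Mc - M : ℝ) : ℂ))
  convert h1 using 1
  ext x
  rw [← hHh.diffSchr_resolvent hh hR M g]
  simp only [diffSchr, Pi.sub_apply]
  ring

lemma integral_conj_mul_diffLap_comm {u w : Euc d → ℂ} (hw : MemLp w 2 volume)
    (hu : MemLp u 2 volume) (h : ℝ) :
    ∫ x, conj (w x) * diffLap h u x = conj (∫ x, conj (u x) * diffLap h w x) := by
  rw [integral_conj_mul_diffLap hw hu, integral_conj_mul_diffLap hu hw, map_sum]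
  refine Finset.sum_congr rfl fun j _ => ?_
  rw [map_mul, conj_ofReal, integral_conj_mul_secDiff hw hu, integral_conj_mul_secDiff hu hw,
    ← integral_conj]
  congr 2
  ext x
  simp only [map_mul, conj_conj]
  ring

lemma IsDiscreteHam.inner_symm (hh : 0 < h) {Hh : l2h d h →ₗ.[ℂ] l2h d h}
    (hHh : IsDiscreteHam d h V Hh) {RhM : l2h d h →L[ℂ] l2h d h}
    (hR : IsResolventAt Hh (-(Mc : ℂ)) RhM) (f g : l2h d h) :
    ⟪RhM f, g⟫_ℂ = ⟪f, RhM g⟫_ℂ := by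
  have key : ∀ f g : l2h d h, ⟪RhM f, g⟫_ℂ =
      (∫ x, conj (cellFun h (RhM f) x) * diffLap h (cellFun h (RhM g)) x) +
      ∫ x, conj (cellFun h (RhM f) x) * (((V (cellPt d h x) + 0 : ℝ) : ℂ) * cellFun h (RhM g) x
        + ((Mc - 0 : ℝ) : ℂ) * cellFun h (RhM g) x) := by
    intro f g
    rw [← integral_conj_mul_diffSchr (memLp_cellFun hh (Lp.memLp (RhM f)))
      (memLp_cellFun hh (Lp.memLp (RhM g))) (hHh.memLp_potential_resolvent hh hR 0 g),
      hHh.diffSchr_resolvent hh hR 0 g, ← (cellEmb d hh).inner_map_map,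
      cellEmb_eq_toLp, cellEmb_eq_toLp, inner_toLp_toLp]
  rw [← inner_conj_symm f, key f g, key g f, map_add,
    integral_conj_mul_diffLap_comm (memLp_cellFun hh (Lp.memLp (RhM f)))
      (memLp_cellFun hh (Lp.memLp (RhM g))), ← integral_conj (f := fun x =>
      conj (cellFun h (RhM g) x) * (((V (cellPt d h x) + 0 : ℝ) : ℂ) * cellFun h (RhM f) x
        + ((Mc - 0 : ℝ) : ℂ) * cellFun h (RhM f) x))]
  congr 2
  ext x
  simp only [map_mul, map_add, conj_conj, conj_ofReal]
  ring

end Resolvents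

section Comparison

variable {d : ℕ} {W : Euc d → ℝ} {a c h : ℝ} {u : Euc d → ℂ}

lemma schr_sub_const (V : Euc d → ℝ) (M Mc : ℝ) (u : Euc d → ℂ) :
    schr (fun x => V x + M) (Mc - M) u = schr V Mc u := by
  ext x
  simp only [schr]
  push_cast
  ring

lemma l2norm_potential_le_diffSchr_cellPt (hW : IsSlowlyVarying c W)
    (ha : d * c ^ 4 / 4 ≤ a) (hh : 0 < h) (hh1 : h ≤ 1) {w : Euc d → ℂ} (hw : MemLp w 2 volume)
    (hWw : MemLp (fun x => (W (cellPt d h x) : ℂ) * w x) 2 volume) :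
    l2norm (fun x => (W (cellPt d h x) : ℂ) * w x) ≤
      c * l2norm (diffSchr h (fun x => W (cellPt d h x)) a w) := by
  refine l2norm_potential_le_diffSchr (G := fun x => regWeight W (cellPt d h x)) (L := c ^ 2)
    hh (zero_le_one.trans hW.1) (fun x => (hW.2.1 _).le) (fun x => le_regWeight hW _)
    (fun x => regWeight_le hW _) (fun x j => ?_) (by rw [← pow_mul]; exact ha)
    ((continuous_regWeight hW).measurable.comp measurable_cellPt).aestronglyMeasurable hw hWw
  rw [cellPt_add hh]
  exact regWeight_shift hW hh hh1 _ j

lemma norm_integral_cellFun_diffLap_le (hh : 0 < h) (hu : ContDiff ℝ (⊤ : ℕ∞) u)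
    (hc : HasCompactSupport u) {v : Zd d → ℂ} (hv : MemLp (cellFun h v) 2 volume) {A B : ℝ}
    (hA : ∀ j, l2norm (fun x => cellFun h v (x + h • stdVec d j) - cellFun h v x) ≤ A)
    (hB : ∀ j, l2norm (pd j (pd j u)) ≤ B) :
    ‖∫ x, conj (cellFun h v x) * (diffLap h u x + lapl d u x)‖ ≤ d * (2 * (A * B)) := by
  have hu2 := memLp_of_contDiff hu hc
  have hm : ∀ j, MemLp (fun x => (((h ^ 2)⁻¹ : ℝ) : ℂ) * secDiff (h • stdVec d j) u x +
      pd j (pd j u) x) 2 volume := fun j =>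
    ((memLp_secDiff hu2 _).const_mul _).add (memLp_of_contDiff (contDiff_pd (contDiff_pd hu j) j)
      (hasCompactSupport_pd (hasCompactSupport_pd hc j) j))
  have h1 : ∫ x, conj (cellFun h v x) * (diffLap h u x + lapl d u x) =
      ∑ j, ∫ x, conj (cellFun h v x) * ((((h ^ 2)⁻¹ : ℝ) : ℂ) * secDiff (h • stdVec d j) u x +
        pd j (pd j u) x) := by
    rw [← integral_finsetSum _ fun j _ => integrable_conj_mul hv (hm j)]
    congr 1
    ext x
    rw [← Finset.mul_sum, Finset.sum_add_distrib, lapl_eq_sum_pd, diffLap]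
  rw [h1]
  refine (norm_sum_le _ _).trans ?_
  refine (Finset.sum_le_card_nsmul _ _ (2 * (A * B)) fun j _ => ?_).trans (by simp)
  refine (norm_integral_cellFun_secDiff_le hh hu hc hv j).trans ?_
  have h2 := mul_le_mul (hA j) (hB j) (l2norm_nonneg _) ((l2norm_nonneg _).trans (hA j))
  linarith

lemma norm_integral_resolvent_comparison_le (hWc : Continuous W) (hW : IsSlowlyVarying c W)
    (ha : d * c ^ 4 / 4 ≤ a) (ha1 : 1 ≤ a) (hh : 0 < h) (hh1 : h ≤ 1) {ω : ℝ} (hω0 : 0 ≤ ω)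
    (hω : ∀ x, |(W x)⁻¹ - (W (cellPt d h x))⁻¹| ≤ ω)
    (hu : ContDiff ℝ (⊤ : ℕ∞) u) (hc : HasCompactSupport u) {v : Zd d → ℂ}
    (hv : MemLp (cellFun h v) 2 volume)
    (hWv : MemLp (fun x => (W (cellPt d h x) : ℂ) * cellFun h v x) 2 volume) :
    ‖(∫ x, conj (u x) * diffSchr h (fun x => W (cellPt d h x)) a (cellFun h v) x) -
        ∫ x, conj (schr W a u x) * cellFun h v x‖ ≤
      (2 * d * (2 + c) * h + ω * c ^ 2) * (l2norm (schr W a u) *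
        l2norm (diffSchr h (fun x => W (cellPt d h x)) a (cellFun h v))) := by
  set w := cellFun h v
  set Wh : Euc d → ℝ := fun x => W (cellPt d h x)
  set F := l2norm (schr W a u)
  set G := l2norm (diffSchr h Wh a w)
  have hc0 : 0 ≤ c := zero_le_one.trans hW.1
  have hu2 := memLp_of_contDiff hu hc
  have hl2 := memLp_of_contDiff (contDiff_lapl hu) (hasCompactSupport_lapl hc)
  have hWu := memLp_mul_of_continuous hu hc hWc
  have hWh0 : ∀ x, 0 ≤ Wh x := fun x => (hW.2.1 _).le
  have hkin : ‖∫ x, conj (w x) * (diffLap h u x + lapl d u x)‖ ≤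
      d * (2 * ((h * G) * ((2 + c) * F))) :=
    norm_integral_cellFun_diffLap_le hh hu hc hv
      (fun j => l2norm_shift_sub_le_diffSchr hh ha1 hWh0 hv hWv j)
      (fun j => l2norm_pd_pd_le_schr hWc hW ha ha1 hu hc j)
  have hi1 := integrable_conj_mul (memLp_diffLap hu2 h) hv
  have hi2 := integrable_conj_mul hu2 hWv
  have hi3 := integrable_conj_mul hu2 hv
  have hi4 := integrable_conj_mul hl2 hv
  have hi5 := integrable_conj_mul hWu hv
  have hsplit : (∫ x, conj (u x) * diffSchr h Wh a w x) - ∫ x, conj (schr W a u x) * w x =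
      conj (∫ x, conj (w x) * (diffLap h u x + lapl d u x)) +
        ∫ x, (conj (u x) * ((Wh x : ℂ) * w x) - conj ((W x : ℂ) * u x) * w x) := by
    have e1 : conj (∫ x, conj (w x) * (diffLap h u x + lapl d u x)) =
        (∫ x, conj (u x) * diffLap h w x) + ∫ x, conj (lapl d u x) * w x := by
      rw [integral_conj_mul_diffLap_comm hu2 hv, ← integral_conj, ← integral_conj]
      have j1 : Integrable fun x => conj (conj (w x) * diffLap h u x) :=
        hi1.congr (Filter.Eventually.of_forall fun x => by simp [mul_comm])
      rw [← integral_add j1 hi4]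
      congr 1
      ext x
      simp only [map_mul, map_add, conj_conj]
      ring
    rw [integral_conj_mul_diffSchr hu2 hv hWv, e1, integral_sub hi2 hi5]
    have e2 : ∫ x, conj (u x) * ((Wh x : ℂ) * w x + (a : ℂ) * w x) =
        (∫ x, conj (u x) * ((Wh x : ℂ) * w x)) + (a : ℂ) * ∫ x, conj (u x) * w x := by
      rw [← integral_const_mul, ← integral_add hi2 (hi3.const_mul _)]
      congr 1
      ext x
      ring
    have e3 : ∫ x, conj (schr W a u x) * w x = -(∫ x, conj (lapl d u x) * w x) +
        ((∫ x, conj ((W x : ℂ) * u x) * w x) + (a : ℂ) * ∫ x, conj (u x) * w x) := by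
      have j1 : Integrable fun x => conj ((W x : ℂ) * u x) * w x + (a : ℂ) * (conj (u x) * w x) :=
        hi5.add (hi3.const_mul _)
      have j2 : Integrable fun x => -(conj (lapl d u x) * w x) := hi4.neg
      rw [← integral_const_mul, ← integral_neg, ← integral_add hi5 (hi3.const_mul _),
        ← integral_add j2 j1]
      congr 1
      ext x
      simp only [schr, map_mul, map_add, map_neg, conj_ofReal]
      ring
    rw [e2, e3]
    ring
  have hpot : ‖∫ x, (conj (u x) * ((Wh x : ℂ) * w x) - conj ((W x : ℂ) * u x) * w x)‖ ≤
      ω * ((c * F) * (c * G)) := by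
    have h1 : ‖∫ x, (conj (u x) * ((Wh x : ℂ) * w x) - conj ((W x : ℂ) * u x) * w x)‖ ≤
        ∫ x, ω * (‖(W x : ℂ) * u x‖ * ‖(Wh x : ℂ) * w x‖) := by
      refine norm_integral_le_of_norm_le ((integrable_norm_mul hWu hWv).const_mul ω)
        (Filter.Eventually.of_forall fun x => ?_)
      have hx : 0 < W x := hW.2.1 _
      have hxh : 0 < Wh x := hW.2.1 _
      have e : conj (u x) * ((Wh x : ℂ) * w x) - conj ((W x : ℂ) * u x) * w x =
          ((Wh x - W x : ℝ) : ℂ) * (conj (u x) * w x) := by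
        rw [map_mul, conj_ofReal]
        push_cast
        ring
      have e' : Wh x - W x = ((W x)⁻¹ - (Wh x)⁻¹) * (W x * Wh x) := by field_simp
      rw [e, e', norm_mul, norm_mul, norm_mul, norm_mul, norm_real, norm_real, norm_real,
        RCLike.norm_conj, Real.norm_of_nonneg hx.le, Real.norm_of_nonneg hxh.le, norm_mul,
        Real.norm_of_nonneg (mul_pos hx hxh).le]
      have := mul_le_mul_of_nonneg_right (hω x)
        (by positivity : 0 ≤ (W x * Wh x) * (‖u x‖ * ‖w x‖))
      rw [Real.norm_eq_abs]
      linarith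
    rw [integral_const_mul] at h1
    refine h1.trans (mul_le_mul_of_nonneg_left ((integral_norm_mul_le hWu hWv).trans ?_) hω0)
    exact mul_le_mul (l2norm_potential_le_schr hWc hW ha hu hc)
      (l2norm_potential_le_diffSchr_cellPt hW ha hh hh1 hv hWv) (l2norm_nonneg _)
      (mul_nonneg hc0 (l2norm_nonneg _))
  rw [hsplit]
  refine (norm_add_le _ _).trans ?_
  rw [RCLike.norm_conj]
  linarith

lemma norm_le_of_dense_inner {E : Type*} [NormedAddCommGroup E] [InnerProductSpace ℂ E]
    {s : Set E} (hs : Dense s) {x : E} {C : ℝ} (hC : 0 ≤ C)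
    (hx : ∀ f ∈ s, ‖⟪f, x⟫_ℂ‖ ≤ C * ‖f‖) : ‖x‖ ≤ C := by
  have h1 : ‖⟪x, x⟫_ℂ‖ ≤ C * ‖x‖ := by
    have hcl : IsClosed {f : E | ‖⟪f, x⟫_ℂ‖ ≤ C * ‖f‖} :=
      isClosed_le (by fun_prop) (by fun_prop)
    exact hcl.closure_subset_iff.2 hx (hs x)
  rw [inner_self_eq_norm_sq_to_K, norm_pow, RCLike.norm_ofReal, abs_norm, sq] at h1
  rcases (norm_nonneg x).eq_or_lt with h0 | h0
  · rwa [← h0]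
  · exact le_of_mul_le_mul_right h1 h0

lemma norm_resolvent_comparison_le {V : Euc d → ℝ} {M Mc : ℝ} (hVc : Continuous V)
    (hW : IsSlowlyVarying c fun x => V x + M) (ha : d * c ^ 4 / 4 ≤ Mc - M) (ha1 : 1 ≤ Mc - M)
    (hh : 0 < h) (hh1 : h ≤ 1) {ω : ℝ} (hω0 : 0 ≤ ω)
    (hω : ∀ x, |(V x + M)⁻¹ - (V (cellPt d h x) + M)⁻¹| ≤ ω)
    {H : L2 d →ₗ.[ℂ] L2 d} (hH : IsSchrodingerOp d V H)
    {RM : L2 d →L[ℂ] L2 d} (hR : IsResolventAt H (-(Mc : ℂ)) RM)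
    {Hh : l2h d h →ₗ.[ℂ] l2h d h} (hHh : IsDiscreteHam d h V Hh) {RhM : l2h d h →L[ℂ] l2h d h}
    (hRh : IsResolventAt Hh (-(Mc : ℂ)) RhM) (g : l2h d h) :
    ‖RM (cellEmb d hh g) - cellEmb d hh (RhM g)‖ ≤
      (2 * d * (2 + c) * h + ω * c ^ 2) * ‖g‖ := by
  have hWc : Continuous fun x => V x + M := by fun_prop
  have hc0 : 0 ≤ c := zero_le_one.trans hW.1
  refine norm_le_of_dense_inner (dense_schrRange (a := Mc - M) hWc fun x => ?_) (by positivity) ?_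
  · have := (hW.2.1 x).le
    linarith
  rintro f ⟨u, hu, hc, hf⟩
  have hm := memLp_schr (a := Mc - M) hu hc hWc
  have hfe : f = hm.toLp _ := by
    rw [← Lp.toLp_coeFn f (Lp.memLp f)]
    exact MemLp.toLp_congr _ _ hf
  have hRf : RM f = (memLp_of_contDiff hu hc).toLp u :=
    resolvent_schr hVc hH hR hu hc (by rwa [schr_sub_const] at hf)
  have h1 := norm_integral_resolvent_comparison_le hWc hW ha ha1 hh hh1 hω0 hω hu hc
    (memLp_cellFun hh (Lp.memLp (RhM g))) (hHh.memLp_potential_resolvent hh hRh M g)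
  rw [hHh.diffSchr_resolvent hh hRh, ← norm_eq_l2norm_cellFun hh, ← norm_toLp_eq_l2norm hm, ← hfe,
    ← inner_toLp_toLp (memLp_of_contDiff hu hc) (memLp_cellFun hh (Lp.memLp g)), ← hRf,
    ← inner_toLp_toLp hm (memLp_cellFun hh (Lp.memLp (RhM g))), ← hfe, ← cellEmb_eq_toLp hh,
    ← cellEmb_eq_toLp hh, hR.inner_symm hH.1, ← inner_sub_right] at h1
  linarith

end Comparison

section ApproximateSpectrum

variable {E : Type*} [NormedAddCommGroup E] [InnerProductSpace ℂ E]

lemma norm_algebraMap_sub_apply (T : E →L[ℂ] E) (l : ℂ) (x : E) :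
    ‖(algebraMap ℂ (E →L[ℂ] E) l - T) x‖ = ‖T x - l • x‖ := by
  rw [sub_apply, Algebra.algebraMap_eq_smul_one, norm_sub_rev]
  rfl

variable [CompleteSpace E]

lemma IsStarNormal.algebraMap_sub {T : E →L[ℂ] E} (hT : IsStarNormal T) (l : ℂ) :
    IsStarNormal (algebraMap ℂ (E →L[ℂ] E) l - T) := by
  refine ⟨?_⟩
  have h1 : Commute (algebraMap ℂ (E →L[ℂ] E) (star l)) T := Algebra.commutes _ _
  have h2 : Commute (algebraMap ℂ (E →L[ℂ] E) l) (star T) := Algebra.commutes _ _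
  have h3 : Commute (algebraMap ℂ (E →L[ℂ] E) (star l)) (algebraMap ℂ (E →L[ℂ] E) l) :=
    Algebra.commutes _ _
  rw [star_sub, ← algebraMap_star_comm]
  exact (h3.sub_right h1).sub_left (h2.symm.sub_right hT.star_comm_self)

/-- Every spectral value of a normal operator is an approximate eigenvalue. -/
lemma IsStarNormal.exists_approx_eigenvector {T : E →L[ℂ] E} (hT : IsStarNormal T) {l : ℂ}
    (hl : l ∈ spectrum ℂ T) {δ : ℝ} (hδ : 0 < δ) : ∃ x ≠ 0, ‖T x - l • x‖ ≤ δ * ‖x‖ := by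
  by_contra! hcon
  have hle : ∀ x, δ * ‖x‖ ≤ ‖(algebraMap ℂ (E →L[ℂ] E) l - T) x‖ := by
    intro x
    rcases eq_or_ne x 0 with rfl | hx
    · simp
    · rw [norm_algebraMap_sub_apply]
      exact (hcon x hx).le
  have hN := hT.algebraMap_sub l
  refine hl (spectrum.mem_resolventSet_iff.2 ?_)
  rw [ContinuousLinearMap.isUnit_iff_bijective,
    ContinuousLinearMap.bijective_iff_dense_range_and_antilipschitz]
  refine ⟨?_, ⟨Real.toNNReal δ⁻¹, ContinuousLinearMap.antilipschitz_of_bound _ fun x => ?_⟩⟩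
  · rw [Submodule.topologicalClosure_eq_top_iff, ContinuousLinearMap.IsStarNormal.orthogonal_range hN,
      Submodule.eq_bot_iff]
    intro x hx
    have h1 := hle x
    rw [show (algebraMap ℂ (E →L[ℂ] E) l - T) x = 0 from hx, norm_zero] at h1
    exact norm_le_zero_iff.1 (nonpos_of_mul_nonpos_right h1 hδ)
  · rw [Real.coe_toNNReal _ (inv_nonneg.2 hδ.le), inv_mul_eq_div, le_div_iff₀ hδ, mul_comm]
    exact hle x

/-- An approximate eigenvalue of a normal operator is close to its spectrum. -/
lemma IsStarNormal.exists_mem_spectrum_of_approx_eigenvector {T : E →L[ℂ] E}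
    (hT : IsStarNormal T) {l : ℂ} {δ : ℝ} {x : E} (hx0 : x ≠ 0)
    (hx : ‖T x - l • x‖ ≤ δ * ‖x‖) : ∃ m ∈ spectrum ℂ T, dist m l ≤ δ := by
  by_cases hl : l ∈ spectrum ℂ T
  · refine ⟨l, hl, ?_⟩
    rw [dist_self]
    exact nonneg_of_mul_nonneg_left ((norm_nonneg _).trans hx) (norm_pos_iff.2 hx0)
  have hnt : Nontrivial E := ⟨⟨x, 0, hx0⟩⟩
  obtain ⟨A, hA⟩ : IsUnit (algebraMap ℂ (E →L[ℂ] E) l - T) := spectrum.notMem_iff.1 hl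
  have hN : IsStarNormal (↑A⁻¹ : E →L[ℂ] E) := by
    refine ⟨?_⟩
    have h0 : Commute (star (A : E →L[ℂ] E)) A := hA ▸ (hT.algebraMap_sub l).star_comm_self
    have h1 : Commute ((star A : (E →L[ℂ] E)ˣ) : E →L[ℂ] E) (A : E →L[ℂ] E) := h0
    have h2 := (h1.units_inv_left).units_inv_right
    rw [← star_inv] at h2
    exact h2
  obtain ⟨k, hk, hkr⟩ := spectrum.exists_nnnorm_eq_spectralRadius (↑A⁻¹ : E →L[ℂ] E)
  rw [IsStarNormal.spectralRadius_eq_nnnorm, ENNReal.coe_inj] at hkr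
  have hkn : ‖k‖ = ‖(↑A⁻¹ : E →L[ℂ] E)‖ := congrArg NNReal.toReal hkr
  rw [← spectrum.map_inv, Set.mem_inv, hA, ← spectrum.singleton_sub_eq] at hk
  obtain ⟨l', hl', m, hm, hkm⟩ := hk
  rw [Set.mem_singleton_iff] at hl'
  subst hl'
  refine ⟨m, hm, ?_⟩
  have h1 : x = (↑A⁻¹ : E →L[ℂ] E) ((A : E →L[ℂ] E) x) := by
    rw [← mul_apply_eq_comp, Units.inv_mul, one_apply_eq_self]
  have h2 : ‖(A : E →L[ℂ] E) x‖ ≤ δ * ‖x‖ := by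
    rw [hA, norm_algebraMap_sub_apply]
    exact hx
  have hxp := norm_pos_iff.2 hx0
  have h3 : ‖x‖ ≤ ‖k‖ * (δ * ‖x‖) := by
    conv_lhs => rw [h1]
    rw [hkn]
    exact (ContinuousLinearMap.le_opNorm _ _).trans
      (mul_le_mul_of_nonneg_left h2 (norm_nonneg _))
  have h4 : 1 ≤ ‖k‖ * δ := by
    rw [← mul_assoc] at h3
    exact le_of_mul_le_mul_right (by rwa [one_mul]) hxp
  have hk0 : 0 < ‖k‖ := by
    refine (norm_nonneg k).lt_of_ne fun h0 => ?_
    rw [← h0, zero_mul] at h4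
    exact absurd h4 (by norm_num)
  have h5 : dist m l' = ‖k‖⁻¹ := by
    rw [dist_comm, dist_eq_norm, ← norm_inv, ← hkm]
  rw [h5, inv_le_iff_one_le_mul₀' hk0]
  exact h4

lemma isStarNormal_of_inner_symm {T : E →L[ℂ] E} (hT : ∀ x y, ⟪T x, y⟫_ℂ = ⟪x, T y⟫_ℂ) :
    IsStarNormal T :=
  (ContinuousLinearMap.isSelfAdjoint_iff_isSymmetric.2 hT).isStarNormal

end ApproximateSpectrum

section SpectralConvergence

open scoped Topology

variable {d : ℕ} {h : ℝ}

lemma memLp_comp_cellPt (hh : 0 < h) {F : Euc d → ℂ} (hF : Continuous F)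
    (hc : HasCompactSupport F) : MemLp (fun x => F (cellPt d h x)) 2 volume := by
  obtain ⟨R, hR⟩ := exists_radius hc
  obtain ⟨C, hC⟩ := hF.bounded_above_of_compact_support hc
  have hC0 : 0 ≤ C := (norm_nonneg _).trans (hC 0)
  have hm : MemLp ((Metric.closedBall (0 : Euc d) (R + √d * h)).indicator fun _ => (C : ℂ)) 2
      volume :=
    memLp_indicator_const 2 Metric.isClosed_closedBall.measurableSet _
      (Or.inr (isCompact_closedBall _ _).measure_lt_top.ne)
  refine hm.mono (hF.measurable.comp measurable_cellPt).aestronglyMeasurable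
    (Filter.Eventually.of_forall fun x => ?_)
  by_cases hx : x ∈ Metric.closedBall (0 : Euc d) (R + √d * h)
  · rw [Set.indicator_of_mem hx, norm_real, Real.norm_of_nonneg hC0]
    exact hC _
  · rw [hR, norm_zero]
    · exact norm_nonneg _
    · rw [mem_closedBall_zero_iff, not_le] at hx
      have h1 := dist_cellPt_le hh x
      rw [dist_eq_norm] at h1
      have h2 := norm_sub_norm_le x (cellPt d h x)
      linarith

lemma memLp_cellFun_discAct_latRestr (hh : 0 < h) {V : Euc d → ℝ} (hV : Continuous V)
    {u : Euc d → ℂ} (hu : Continuous u) (hc : HasCompactSupport u) (b : ℝ) :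
    MemLp (fun x => cellFun h (discAct d h V (latRestr h u)) x + (b : ℂ) * u (cellPt d h x)) 2
      volume := by
  have hu2 := memLp_comp_cellPt hh hu hc
  have hVu : MemLp (fun x => (V (cellPt d h x) : ℂ) * u (cellPt d h x)) 2 volume :=
    memLp_comp_cellPt (F := fun x => (V x : ℂ) * u x) hh
      ((continuous_ofReal.comp hV).mul hu) hc.mul_left
  have h1 := ((memLp_diffLap hu2 h).add hVu).add (hu2.const_mul (b : ℂ))
  refine h1.congr_norm h1.1 (Filter.Eventually.of_forall fun x => ?_) |>.ae_eq ?_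
  · rfl
  · refine Filter.Eventually.of_forall fun x => ?_
    simp only [Pi.add_apply]
    rw [cellFun_discAct hh]
    rfl

/-- If `u` is an approximate eigenvector in the form `u ≈ l (−Δ + V + M) u`, then so is its
restriction to any sufficiently fine lattice. -/
lemma eventually_l2norm_latRestr_lt {V : Euc d → ℝ} (hV : Continuous V) {u : Euc d → ℂ}
    (hu : ContDiff ℝ (⊤ : ℕ∞) u) (hc : HasCompactSupport u) {b δ : ℝ} {l : ℂ} (hδ : 0 ≤ δ)
    (hl : l2norm (fun x => u x - l * schr V b u x) < δ * l2norm (schr V b u)) :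
    ∀ᶠ h in 𝓝[>] (0 : ℝ),
      l2norm (fun x => u (cellPt d h x) -
        l * (cellFun h (discAct d h V (latRestr h u)) x + (b : ℂ) * u (cellPt d h x))) <
      δ * l2norm (fun x => cellFun h (discAct d h V (latRestr h u)) x +
        (b : ℂ) * u (cellPt d h x)) := by
  have t1 := tendsto_l2norm_comp_cellPt hu.continuous hc
  have t2 := tendsto_l2norm_discAct_latRestr hV hu hc b
  have t3 := t1.add (t2.const_mul (‖l‖ + δ))
  rw [mul_zero, add_zero] at t3
  filter_upwards [t3.eventually_lt_const (sub_pos.2 hl), eventually_pos_lt one_pos] with h h1 h2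
  have hu2 := memLp_of_contDiff hu hc
  have hs2 := memLp_schr (a := b) hu hc hV
  have hA := memLp_cellFun_discAct_latRestr h2.1 hV hu.continuous hc b
  have hB := memLp_comp_cellPt h2.1 hu.continuous hc
  set A : Euc d → ℂ := fun x =>
    cellFun h (discAct d h V (latRestr h u)) x + (b : ℂ) * u (cellPt d h x)
  have e1 : l2norm (schr V b u) ≤ l2norm A + l2norm (fun x => A x - schr V b u x) := by
    have h3 := l2norm_sub_le hA (hA.sub hs2)
    simp only [Pi.sub_apply, sub_sub_cancel] at h3
    exact h3
  have e2 : l2norm (fun x => u (cellPt d h x) - l * A x) ≤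
      l2norm (fun x => u x - l * schr V b u x) + (l2norm (fun x => u (cellPt d h x) - u x) +
        ‖l‖ * l2norm (fun x => A x - schr V b u x)) := by
    rw [← l2norm_const_mul]
    have h3 := (l2norm_sub_le (hB.sub hu2) ((hA.sub hs2).const_mul l))
    have h4 := l2norm_add_le (hu2.sub (hs2.const_mul l))
      ((hB.sub hu2).sub ((hA.sub hs2).const_mul l))
    refine le_trans (le_of_eq (congrArg l2norm (funext fun x => ?_)))
      (h4.trans (add_le_add_right h3 _))
    simp only [Pi.sub_apply]
    ring
  have e3 := mul_le_mul_of_nonneg_left e1 hδ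
  have h1' : l2norm (fun x => u (cellPt d h x) - u x) +
      (‖l‖ + δ) * l2norm (fun x => A x - schr V b u x) <
      δ * l2norm (schr V b u) - l2norm (fun x => u x - l * schr V b u x) := h1
  linarith

lemma IsDiscreteHam.exists_mem_spectrum_of_latRestr (hh : 0 < h) {V : Euc d → ℝ}
    (hV : Continuous V) {u : Euc d → ℂ} (hu : Continuous u) (hc : HasCompactSupport u)
    {Mc δ : ℝ} {l : ℂ} {Hh : l2h d h →ₗ.[ℂ] l2h d h} (hHh : IsDiscreteHam d h V Hh)
    {RhM : l2h d h →L[ℂ] l2h d h} (hR : IsResolventAt Hh (-(Mc : ℂ)) RhM)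
    (hl : l2norm (fun x => u (cellPt d h x) -
        l * (cellFun h (discAct d h V (latRestr h u)) x + (Mc : ℂ) * u (cellPt d h x))) <
      δ * l2norm (fun x => cellFun h (discAct d h V (latRestr h u)) x +
        (Mc : ℂ) * u (cellPt d h x))) :
    ∃ m ∈ spectrum ℂ RhM, dist m l ≤ δ := by
  have hv2 : MemLp (latRestr h u) 2 (latMeas d h) :=
    memLp_of_cellFun hh (memLp_comp_cellPt hh hu hc)
  have hf2 : MemLp (fun z => discAct d h V (latRestr h u) z + (Mc : ℂ) * latRestr h u z) 2
      (latMeas d h) :=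
    memLp_of_cellFun hh (memLp_cellFun_discAct_latRestr hh hV hu hc Mc)
  have hv := funext ((ae_latMeas_iff hh).1 hv2.coeFn_toLp)
  have hf := funext ((ae_latMeas_iff hh).1 hf2.coeFn_toLp)
  have hRf : RhM (hf2.toLp _) = hv2.toLp _ := by
    refine hHh.resolvent_discAct hh hR fun z => ?_
    rw [hv, hf]
  have hsub := (ae_latMeas_iff hh).1 (Lp.coeFn_sub (hv2.toLp _) (l • hf2.toLp _))
  have hsmul := (ae_latMeas_iff hh).1 (Lp.coeFn_smul l (hf2.toLp _))
  have n1 : ‖RhM (hf2.toLp _) - l • hf2.toLp _‖ < δ * ‖hf2.toLp _‖ := by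
    rw [hRf, norm_eq_l2norm_cellFun hh, norm_eq_l2norm_cellFun hh, hf]
    refine lt_of_eq_of_lt (congrArg l2norm (funext fun x => ?_)) hl
    rw [cellFun, hsub, Pi.sub_apply, hsmul, Pi.smul_apply, hv, hf, smul_eq_mul]
    rfl
  refine (isStarNormal_of_inner_symm
    (hHh.inner_symm hh hR)).exists_mem_spectrum_of_approx_eigenvector (fun h0 => ?_) n1.le
  rw [h0, norm_zero, mul_zero] at n1
  exact absurd n1 (norm_nonneg _).not_gt

/-- Points of the continuum resolvent spectrum are limits of points of the discrete ones. -/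
lemma eventually_exists_mem_spectrum_discrete {V : Euc d → ℝ} (hV : Continuous V) {Mc : ℝ}
    (hMc : ∀ x, 1 ≤ V x + Mc) {H : L2 d →ₗ.[ℂ] L2 d} (hH : IsSchrodingerOp d V H)
    {RM : L2 d →L[ℂ] L2 d} (hR : IsResolventAt H (-(Mc : ℂ)) RM) {l : ℂ}
    (hl : l ∈ spectrum ℂ RM) {δ : ℝ} (hδ : 0 < δ) :
    ∀ᶠ h in 𝓝[>] (0 : ℝ), ∀ Hh : l2h d h →ₗ.[ℂ] l2h d h, IsDiscreteHam d h V Hh →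
      ∀ RhM : l2h d h →L[ℂ] l2h d h, IsResolventAt Hh (-(Mc : ℂ)) RhM →
        ∃ m ∈ spectrum ℂ RhM, dist m l ≤ δ := by
  obtain ⟨x, hx0, hx⟩ := (isStarNormal_of_inner_symm
    (hR.inner_symm hH.1)).exists_approx_eigenvector hl (half_pos hδ)
  have hxlt : ‖RM x - l • x‖ < δ * ‖x‖ :=
    hx.trans_lt (mul_lt_mul_of_pos_right (half_lt_self hδ) (norm_pos_iff.2 hx0))
  have ho : IsOpen {f : L2 d | ‖RM f - l • f‖ < δ * ‖f‖} :=
    isOpen_lt (by fun_prop) (by fun_prop)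
  obtain ⟨f, ⟨u, hu, hc, hfu⟩, hf⟩ := (dense_schrRange hV hMc).exists_mem_open ho ⟨x, hxlt⟩
  have hfL : f = (memLp_schr (a := Mc) hu hc hV).toLp _ :=
    Lp.ext (hfu.trans (memLp_schr hu hc hV).coeFn_toLp.symm)
  rw [Set.mem_ofPred_eq, resolvent_schr hV hH hR hu hc hfu, hfL, ← MemLp.toLp_const_smul,
    ← MemLp.toLp_sub, norm_toLp_eq_l2norm, norm_toLp_eq_l2norm] at hf
  filter_upwards [eventually_l2norm_latRestr_lt hV hu hc hδ.le hf, eventually_pos_lt one_pos]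
    with h h1 h2 Hh hHh RhM hRh
  exact hHh.exists_mem_spectrum_of_latRestr h2.1 hV hu.continuous hc hRh h1

/-- Points of the discrete resolvent spectrum are close to the continuum one. -/
lemma exists_mem_spectrum_of_discrete {V : Euc d → ℝ} {M Mc c : ℝ} (hVc : Continuous V)
    (hW : IsSlowlyVarying c fun x => V x + M) (ha : d * c ^ 4 / 4 ≤ Mc - M) (ha1 : 1 ≤ Mc - M)
    (hh : 0 < h) (hh1 : h ≤ 1) {ω : ℝ} (hω0 : 0 ≤ ω)
    (hω : ∀ x, |(V x + M)⁻¹ - (V (cellPt d h x) + M)⁻¹| ≤ ω)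
    {H : L2 d →ₗ.[ℂ] L2 d} (hH : IsSchrodingerOp d V H)
    {RM : L2 d →L[ℂ] L2 d} (hR : IsResolventAt H (-(Mc : ℂ)) RM)
    {Hh : l2h d h →ₗ.[ℂ] l2h d h} (hHh : IsDiscreteHam d h V Hh) {RhM : l2h d h →L[ℂ] l2h d h}
    (hRh : IsResolventAt Hh (-(Mc : ℂ)) RhM) {l : ℂ} (hl : l ∈ spectrum ℂ RhM) {δ : ℝ}
    (hδ : 0 < δ) :
    ∃ m ∈ spectrum ℂ RM, dist m l ≤ 2 * d * (2 + c) * h + ω * c ^ 2 + δ := by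
  obtain ⟨x, hx0, hx⟩ := (isStarNormal_of_inner_symm
    (hHh.inner_symm hh hRh)).exists_approx_eigenvector hl hδ
  refine (isStarNormal_of_inner_symm
    (hR.inner_symm hH.1)).exists_mem_spectrum_of_approx_eigenvector (x := cellEmb d hh x)
    (fun h0 => hx0 (by rw [← norm_eq_zero, ← (cellEmb d hh).norm_map, h0, norm_zero])) ?_
  have h1 := norm_resolvent_comparison_le hVc hW ha ha1 hh hh1 hω0 hω hH hR hHh hRh x
  have h2 : ‖cellEmb d hh (RhM x) - l • cellEmb d hh x‖ ≤ δ * ‖x‖ := by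
    rw [← map_smul, ← map_sub, LinearIsometry.norm_map]
    exact hx
  rw [LinearIsometry.norm_map, add_mul]
  exact (norm_sub_le_norm_sub_add_norm_sub _ (cellEmb d hh (RhM x)) _).trans (add_le_add h1 h2)

lemma eventually_abs_sub_cellPt_le {F : Euc d → ℝ} (hF : UniformContinuous F) {ω : ℝ}
    (hω : 0 < ω) : ∀ᶠ h in 𝓝[>] (0 : ℝ), ∀ x, |F x - F (cellPt d h x)| ≤ ω := by
  obtain ⟨δ, hδ, hδω⟩ := Metric.uniformContinuous_iff.1 hF ω hω
  have hp : 0 < √d + 1 := by positivity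
  filter_upwards [eventually_pos_lt (div_pos hδ hp)] with h hh x
  refine (hδω ((dist_cellPt_le hh.1 x).trans_lt ?_)).le
  have := (lt_div_iff₀ hp).1 hh.2
  linarith [hh.1]

end SpectralConvergence

/-- Corollary 2 of the paper.  Suppose Assumptions (V) and (φ) hold.
Then for all sufficiently large `M > 0`, the Hausdorff distance
`d_H(σ((H_h + M)⁻¹), σ((H + M)⁻¹))` between the spectra of the bounded operators
`(H_h + M)⁻¹` on `ℓ²(hℤ^d)` and `(H + M)⁻¹` on `L²(ℝ^d)` tends to `0` as `h → 0`.
(Here `(H + M)⁻¹ = (H − (−M))⁻¹` and similarly for `H_h`.) -/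
theorem hausdorffDist_spectra_resolvents_tendsto_zero
    (d : ℕ) (φ : SchwartzMap (Euc d) ℂ)
    -- Assumption (φ)
    (hφ1 : ∀ ξ : Euc d, ∑' n : Zd d, ‖𝓕 ⇑φ (ξ + latVec d n)‖ ^ 2 = 1)
    (hφ2 : tsupport (𝓕 ⇑φ) ⊆ {ξ : Euc d | ∀ j, ξ j ∈ Set.Ioo (-1 : ℝ) 1})
    -- Assumption (V)
    (V : Euc d → ℝ) (hVcont : Continuous V) (hVbdd : BddBelow (Set.range V))
    (M : ℝ) (hM : 0 < M) (hVM : ∀ x, 0 < V x + M)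
    (hVu : UniformContinuous fun x => (V x + M)⁻¹)
    (c₁ : ℝ) (hc₁ : 0 < c₁)
    (hVcomp : ∀ x y : Euc d, dist x y ≤ 1 →
      c₁⁻¹ * (V x + M) ≤ V y + M ∧ V y + M ≤ c₁ * (V x + M))
    -- the self-adjoint operator `H = −Δ + V`
    (H : L2 d →ₗ.[ℂ] L2 d) (hH : IsSchrodingerOp d V H) :
    ∃ M₀ : ℝ, ∀ Mc : ℝ, M₀ ≤ Mc →
      ∀ RM : L2 d →L[ℂ] L2 d, IsResolventAt H (-(Mc : ℂ)) RM →
      ∀ ε > (0 : ℝ), ∃ h₀ > (0 : ℝ), ∀ h : ℝ, 0 < h → h < h₀ →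
        ∀ Hh : l2h d h →ₗ.[ℂ] l2h d h, IsDiscreteHam d h V Hh →
        ∀ RhM : l2h d h →L[ℂ] l2h d h, IsResolventAt Hh (-(Mc : ℂ)) RhM →
          Metric.hausdorffDist (spectrum ℂ RhM) (spectrum ℂ RM) ≤ ε := by
  have hc1 : 1 ≤ c₁ := by
    have h1 := (hVcomp 0 0 (by simp)).2
    exact le_of_mul_le_mul_right (by rwa [one_mul]) (hVM 0)
  have hW : IsSlowlyVarying c₁ fun x => V x + M := ⟨hc1, hVM, fun x y hxy => (hVcomp x y hxy).2⟩
  have hd4 : 0 ≤ d * c₁ ^ 4 := by positivity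
  refine ⟨M + 1 + d * c₁ ^ 4, fun Mc hMc RM hR ε hε => ?_⟩
  have ha : d * c₁ ^ 4 / 4 ≤ Mc - M := by linarith
  have ha1 : 1 ≤ Mc - M := by linarith
  have hVMc : ∀ x, 1 ≤ V x + Mc := fun x => by linarith [hVM x]
  obtain ⟨t, htσ, htf, htc⟩ := (spectrum.isCompact (𝕜 := ℂ) RM).finite_cover_balls (half_pos hε)
  have hω : 0 < ε / 4 / c₁ ^ 2 := by positivity
  have hK : 0 < 2 * d * (2 + c₁) + 1 := by positivity
  have hev := ((Filter.eventually_all_finite htf).2 fun l hl =>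
    eventually_exists_mem_spectrum_discrete hVcont hVMc hH hR (htσ hl) (half_pos hε)).and
    ((eventually_abs_sub_cellPt_le hVu hω).and
      ((eventually_pos_lt one_pos).and (eventually_pos_lt (div_pos (half_pos hε) hK))))
  obtain ⟨h₀, hh₀, hsub⟩ := mem_nhdsGT_iff_exists_Ioo_subset.1 hev
  refine ⟨h₀, hh₀, fun h hh hhlt Hh hHh RhM hRh => ?_⟩
  obtain ⟨hB, hωh, ⟨-, hh1⟩, -, hhK⟩ := hsub ⟨hh, hhlt⟩
  rw [lt_div_iff₀ hK] at hhK
  refine Metric.hausdorffDist_le_of_mem_dist hε.le (fun l hl => ?_) fun l hl => ?_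
  · obtain ⟨m, hm, hml⟩ := exists_mem_spectrum_of_discrete hVcont hW ha ha1 hh hh1.le hω.le hωh
      hH hR hHh hRh hl (div_pos hε four_pos)
    refine ⟨m, hm, ?_⟩
    rw [div_mul_cancel₀ _ (by positivity)] at hml
    rw [dist_comm]
    linarith
  · obtain ⟨k, hk, hkl⟩ := Set.mem_iUnion₂.1 (htc hl)
    obtain ⟨m, hm, hmk⟩ := hB k hk Hh hHh RhM hRh
    refine ⟨m, hm, (dist_triangle_right l m k).trans ?_⟩
    rw [Metric.mem_ball] at hkl
    linarith
end
end

section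
/- Let φ ∈ 𝒮(ℝ^d) and h > 0. For every g ∈ L²(h⁻¹𝕋^d), the adjoint Q_h* = 𝓕 P_h* F_h* of Q_h = F_h P_h 𝓕* satisfies Q_h* g(ξ) = φ̂(hξ) g̃(ξ) for a.e. ξ ∈ ℝ^d, where g̃ denotes the h⁻¹ℤ^d-periodic extension of g to ℝ^d. Equivalently, the Fourier transform of the function x ↦ ∑_{z∈hℤ^d} φ(h⁻¹(x−z)) (F_h* g)(z) equals ξ ↦ φ̂(hξ) g̃(ξ). -/
open MeasureTheory Complex Real
open scoped FourierTransform InnerProductSpace ComplexConjugate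

noncomputable section

/-- A fundamental domain `[0, h⁻¹)^d` of the torus `h⁻¹𝕋^d = ℝ^d / h⁻¹ℤ^d`. -/
def torusBox (d : ℕ) (h : ℝ) : Set (Euc d) :=
  {ζ : Euc d | ∀ j, ζ j ∈ Set.Ico (0 : ℝ) h⁻¹}

/-- The inverse discrete Fourier transform `F_h* g (z) = ∫_{h⁻¹𝕋^d} e^{2πi z·ζ} g(ζ) dζ`. -/
def discFourierInv (d : ℕ) (h : ℝ) (g : Euc d → ℂ) (z : Zd d) : ℂ :=
  ∫ ζ in torusBox d h, Complex.exp (2 * π * Complex.I * (⟪latPt d h z, ζ⟫_ℝ : ℂ)) * g ζ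

theorem measurableSet_torusBox (d : ℕ) (h : ℝ) : MeasurableSet (torusBox d h) := by
  have : torusBox d h = ⋂ j, (fun ζ : Euc d => ζ j) ⁻¹' Set.Ico (0 : ℝ) h⁻¹ := by
    ext; simp [torusBox]
  rw [this]
  exact MeasurableSet.iInter fun j => measurableSet_Ico.preimage (by fun_prop)

theorem norm_le_of_mem_torusBox {d : ℕ} {h : ℝ} {t : Euc d} (ht : t ∈ torusBox d h) :
    ‖t‖ ≤ √d * h⁻¹ := by
  rcases Nat.eq_zero_or_pos d with rfl | hd
  · simp [EuclideanSpace.norm_eq]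
  have h0 : 0 ≤ h⁻¹ := (ht ⟨0, hd⟩).1.trans (ht ⟨0, hd⟩).2.le
  rw [EuclideanSpace.norm_eq]
  refine Real.sqrt_le_iff.2 ⟨by positivity, ?_⟩
  rw [mul_pow, Real.sq_sqrt (by positivity)]
  calc ∑ j, ‖t j‖ ^ 2 ≤ ∑ _j : Fin d, h⁻¹ ^ 2 := Finset.sum_le_sum fun j _ => by
        have := ht j
        rw [Real.norm_of_nonneg this.1]
        exact pow_le_pow_left₀ this.1 this.2.le 2
    _ = d * h⁻¹ ^ 2 := by simp

/-- The translate of the fundamental domain by a dual lattice vector. -/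
def torusCell (d : ℕ) (h : ℝ) (n : Zd d) : Set (Euc d) :=
  (fun x => x - h⁻¹ • latVec d n) ⁻¹' torusBox d h

theorem measurableSet_torusCell (d : ℕ) (h : ℝ) (n : Zd d) : MeasurableSet (torusCell d h n) :=
  (measurableSet_torusBox d h).preimage (by fun_prop)

theorem mem_torusCell_iff {d : ℕ} {h : ℝ} (hh : 0 < h) (n : Zd d) (x : Euc d) :
    x ∈ torusCell d h n ↔ n = fun j => ⌊h * x j⌋ := by
  have hc : h * h⁻¹ = 1 := mul_inv_cancel₀ hh.ne'
  simp only [torusCell, torusBox, latVec, Set.mem_preimage, Set.mem_ofPred_eq, Set.mem_Ico,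
    funext_iff]
  refine forall_congr' fun j => ?_
  rw [eq_comm, Int.floor_eq_iff]
  simp only [PiLp.sub_apply, PiLp.smul_apply, smul_eq_mul, sub_nonneg, sub_lt_iff_lt_add,
    PiLp.continuousLinearEquiv_symm_apply, EuclideanSpace.equiv]
  rw [inv_mul_le_iff₀ hh, ← mul_lt_mul_iff_right₀ hh, mul_add, mul_inv_cancel_left₀ hh.ne', hc,
    add_comm (1 : ℝ)]

theorem iUnion_torusCell (d : ℕ) {h : ℝ} (hh : 0 < h) : ⋃ n, torusCell d h n = Set.univ :=
  Set.eq_univ_of_forall fun x =>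
    Set.mem_iUnion.2 ⟨_, (mem_torusCell_iff hh _ x).2 rfl⟩

theorem pairwise_disjoint_torusCell (d : ℕ) {h : ℝ} (hh : 0 < h) :
    Pairwise (Function.onFun Disjoint (torusCell d h)) := fun m n hmn =>
  Set.disjoint_left.2 fun x hm hn =>
    hmn (((mem_torusCell_iff hh m x).1 hm).trans ((mem_torusCell_iff hh n x).1 hn).symm)

theorem preimage_add_torusCell (d : ℕ) (h : ℝ) (n : Zd d) :
    (fun x => x + h⁻¹ • latVec d n) ⁻¹' torusCell d h n = torusBox d h := by
  ext; simp [torusCell]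

/-- The integral over `ℝ^d` unfolds to the integral of the periodization. -/
theorem lintegral_eq_lintegral_torusBox_tsum (d : ℕ) {h : ℝ} (hh : 0 < h) {F : Euc d → ENNReal}
    (hF : Measurable F) :
    ∫⁻ x, F x = ∫⁻ x in torusBox d h, ∑' n, F (x + h⁻¹ • latVec d n) := by
  rw [← setLIntegral_univ, ← iUnion_torusCell d hh,
    lintegral_iUnion (measurableSet_torusCell d h) (pairwise_disjoint_torusCell d hh),
    lintegral_tsum fun n => by fun_prop]
  refine tsum_congr fun n => ?_
  rw [← (measurePreserving_add_right volume (h⁻¹ • latVec d n)).setLIntegral_comp_preimage_emb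
    (measurableEmbedding_addRight _), preimage_add_torusCell]

theorem integral_eq_integral_torusBox_tsum (d : ℕ) {h : ℝ} (hh : 0 < h) {F : Euc d → ℂ}
    (hFm : Measurable F) (hF : Integrable F) :
    ∫ x, F x = ∫ x in torusBox d h, ∑' n, F (x + h⁻¹ • latVec d n) := by
  rw [← setIntegral_univ, ← iUnion_torusCell d hh,
    integral_iUnion (measurableSet_torusCell d h) (pairwise_disjoint_torusCell d hh)
      hF.integrableOn,
    integral_tsum fun n => (show Measurable _ by fun_prop).aestronglyMeasurable]
  · refine tsum_congr fun n => ?_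
    rw [← (measurePreserving_add_right volume (h⁻¹ • latVec d n)).setIntegral_preimage_emb
      (measurableEmbedding_addRight _), preimage_add_torusCell]
  · rw [← lintegral_tsum fun n => by fun_prop,
      ← lintegral_eq_lintegral_torusBox_tsum d hh (F := fun x => ‖F x‖ₑ) (by fun_prop)]
    exact hF.2.ne

theorem volume_torusBox (d : ℕ) {h : ℝ} (hh : 0 < h) :
    volume (torusBox d h) = ENNReal.ofReal ((h ^ d)⁻¹) := by
  have : torusBox d h = WithLp.ofLp ⁻¹' (Set.univ.pi fun _ : Fin d => Set.Ico (0 : ℝ) h⁻¹) := by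
    ext; simp [torusBox]
  rw [this, (PiLp.volume_preserving_ofLp (Fin d)).measure_preimage
    (MeasurableSet.univ_pi fun _ => measurableSet_Ico).nullMeasurableSet, Real.volume_pi_Ico]
  simp [ENNReal.ofReal_pow (inv_nonneg.2 hh.le), ← inv_pow]

theorem exists_tsum_enorm_le (d : ℕ) {h : ℝ} (hh : 0 < h) (f : SchwartzMap (Euc d) ℂ) :
    ∃ C : ENNReal, C ≠ ⊤ ∧ ∀ x, ∑' n, ‖f (x + h⁻¹ • latVec d n)‖ₑ ≤ C := by
  obtain ⟨K, hK⟩ : ∃ K : ℝ, ∀ x, (1 + ‖x‖) ^ (d + 1) * ‖f x‖ ≤ K := ⟨_, fun x => by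
    simpa using SchwartzMap.one_add_le_sup_seminorm_apply (𝕜 := ℝ) (m := (d + 1, 0))
      (k := d + 1) (n := 0) le_rfl le_rfl f x⟩
  have hK0 : 0 ≤ K := le_trans (by positivity) (hK 0)
  set R : ℝ := 1 + √d * h⁻¹
  have hR : 0 < R := by positivity
  let w : Euc d → ENNReal := fun x => ENNReal.ofReal (K * R ^ (d + 1) * (1 + ‖x‖) ^ (-(d + 1 : ℝ)))
  have hw : Measurable w := by fun_prop
  have hwi : ∫⁻ x, w x ≠ ⊤ := by
    have hi := (integrable_one_add_norm (E := Euc d) (μ := volume) (r := d + 1)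
      (by simp)).const_mul (K * R ^ (d + 1))
    exact hi.lintegral_lt_top.ne
  have hfw : ∀ y : Euc d, ∀ t ∈ torusBox d h, ‖f y‖ₑ ≤ w (t + y) := by
    intro y t ht
    rw [← ofReal_norm]
    refine ENNReal.ofReal_le_ofReal ?_
    have h1 : 1 + ‖t + y‖ ≤ R * (1 + ‖y‖) := by
      have := norm_add_le t y
      have h2 := norm_le_of_mem_torusBox ht
      have h3 : 0 ≤ √d * h⁻¹ * ‖y‖ := by positivity
      simp only [R]; nlinarith
    rw [Real.rpow_neg (by positivity), ← div_eq_mul_inv, le_div_iff₀ (by positivity)]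
    norm_cast
    calc ‖f y‖ * (1 + ‖t + y‖) ^ (d + 1) ≤ ‖f y‖ * (R * (1 + ‖y‖)) ^ (d + 1) := by gcongr
      _ = R ^ (d + 1) * ((1 + ‖y‖) ^ (d + 1) * ‖f y‖) := by rw [mul_pow]; ring
      _ ≤ K * R ^ (d + 1) := by rw [mul_comm K]; gcongr; exact hK y
  have hv0 : volume (torusBox d h) ≠ 0 := by
    rw [volume_torusBox d hh]; simp; positivity
  have hvt : volume (torusBox d h) ≠ ⊤ := by rw [volume_torusBox d hh]; simp
  refine ⟨(∫⁻ x, w x) / volume (torusBox d h), ENNReal.div_ne_top hwi hv0, fun x => ?_⟩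
  rw [ENNReal.le_div_iff_mul_le (.inl hv0) (.inl hvt), ← setLIntegral_const,
    ← lintegral_add_right_eq_self w x,
    lintegral_eq_lintegral_torusBox_tsum d hh (F := fun t => w (t + x)) (by fun_prop)]
  refine setLIntegral_mono' (measurableSet_torusBox d h) fun t ht => ENNReal.tsum_le_tsum fun n => ?_
  rw [add_assoc, add_comm _ x]
  exact hfw _ t ht

/-- The measure on `ℝ / ℤ` normalised to have total volume 1, as used for `mFourierBasis`. -/
local instance haarMeasureSpace : MeasureSpace UnitAddCircle := ⟨AddCircle.haarAddCircle⟩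

/-- The covering map from `ℝ^d` to the unit torus, with period lattice `h⁻¹ℤ^d`. -/
def toUnitTorus (d : ℕ) (h : ℝ) (ξ : Euc d) : UnitAddTorus (Fin d) :=
  fun j => ((h * ξ j : ℝ) : UnitAddCircle)

/-- A measurable section of `toUnitTorus` with values in `torusBox`. -/
def torusSection (d : ℕ) (h : ℝ) (t : UnitAddTorus (Fin d)) : Euc d :=
  WithLp.toLp 2 fun j => h⁻¹ * (AddCircle.equivIco 1 0 (t j) : ℝ)

theorem measurable_torusSection (d : ℕ) (h : ℝ) : Measurable (torusSection d h) := by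
  have h1 : Measurable fun t : UnitAddCircle => (AddCircle.equivIco 1 0 t : ℝ) :=
    measurable_subtype_coe.comp (AddCircle.measurableEquivIco 1 0).measurable
  refine (PiLp.volume_preserving_toLp (Fin d)).measurable.comp (measurable_pi_lambda _ fun j => ?_)
  exact (h1.comp (measurable_pi_apply j)).const_mul _

theorem torusSection_toUnitTorus {d : ℕ} {h : ℝ} (hh : 0 < h) {ξ : Euc d}
    (hξ : ξ ∈ torusBox d h) : torusSection d h (toUnitTorus d h ξ) = ξ := by
  ext j
  have hj : h * ξ j ∈ Set.Ico (0 : ℝ) (0 + 1) := by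
    refine ⟨mul_nonneg hh.le (hξ j).1, ?_⟩
    rw [zero_add, mul_comm, ← lt_div_iff₀ hh, one_div]
    exact (hξ j).2
  simp only [torusSection, toUnitTorus]
  rw [AddCircle.equivIco_coe_eq hj, inv_mul_cancel_left₀ hh.ne']

theorem measurePreserving_toUnitTorus (d : ℕ) {h : ℝ} (hh : 0 < h) :
    MeasurePreserving (toUnitTorus d h)
      (ENNReal.ofReal (h ^ d) • volume.restrict (torusBox d h)) volume := by
  have hpi : MeasurePreserving (fun (x : Fin d → ℝ) (j : Fin d) => (x j : UnitAddCircle))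
      (volume.restrict (Set.univ.pi fun _ => Set.Ico 0 1)) volume := by
    have hIco : (volume : Measure (Fin d → ℝ)).restrict (Set.univ.pi fun _ => Set.Ico 0 1)
        = Measure.pi fun _ => (volume : Measure ℝ).restrict (Set.Ioc 0 (0 + 1)) := by
      rw [zero_add, volume_pi, ← Measure.restrict_pi_pi]
      exact Measure.restrict_congr_set
        (Measure.univ_pi_Ico_ae_eq_Icc.trans Measure.univ_pi_Ioc_ae_eq_Icc.symm)
    rw [hIco]
    convert! measurePreserving_pi _ _ fun _ : Fin d => AddCircle.measurePreserving_mk 1 0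
    simp [volume, AddCircle.haarAddCircle]
  have hscale : MeasurePreserving (fun x : Euc d => h • x)
      (ENNReal.ofReal (h ^ d) • volume) volume := by
    refine ⟨by fun_prop, ?_⟩
    rw [Measure.map_smul, Measure.map_addHaar_smul _ hh.ne', smul_smul, finrank_euclideanSpace_fin,
      abs_of_nonneg (by positivity), ← ENNReal.ofReal_mul (by positivity),
      mul_inv_cancel₀ (by positivity), ENNReal.ofReal_one, one_smul]
  have hbox : torusBox d h = (fun x : Euc d => WithLp.ofLp (h • x)) ⁻¹'
      (Set.univ.pi fun _ : Fin d => Set.Ico (0 : ℝ) 1) := by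
    ext x
    simp only [torusBox, Set.mem_preimage, Set.mem_univ_pi, Set.mem_Ico, Set.mem_ofPred_eq,
      PiLp.smul_apply, smul_eq_mul]
    refine forall_congr' fun j => ?_
    rw [mul_nonneg_iff_of_pos_left hh, ← div_one h⁻¹, lt_div_iff₀ one_pos, mul_one,
      ← one_div, lt_div_iff₀ hh, mul_comm]
  have := hpi.comp (((PiLp.volume_preserving_ofLp (Fin d)).comp hscale).restrict_preimage
    (MeasurableSet.univ_pi fun _ : Fin d => measurableSet_Ico (a := (0 : ℝ)) (b := 1)))
  rw [hbox, ← Measure.restrict_smul]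
  exact this

theorem mFourier_toUnitTorus (d : ℕ) (h : ℝ) (z : Zd d) (ξ : Euc d) :
    UnitAddTorus.mFourier z (toUnitTorus d h ξ)
      = Complex.exp (2 * π * Complex.I * (⟪latPt d h z, ξ⟫_ℝ : ℂ)) := by
  simp only [UnitAddTorus.mFourier, ContinuousMap.coe_mk, toUnitTorus, fourier_coe_apply,
    ← Complex.exp_sum, latPt, EuclideanSpace.equiv, PiLp.inner_apply]
  congr 1
  simp only [Complex.ofReal_sum, Finset.mul_sum, PiLp.continuousLinearEquiv_symm_apply,
    RCLike.inner_apply, conj_trivial]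
  refine Finset.sum_congr rfl fun j _ => ?_
  push_cast
  ring

theorem integral_unitAddTorus_eq (d : ℕ) {h : ℝ} (hh : 0 < h) {F : UnitAddTorus (Fin d) → ℂ}
    (hF : AEStronglyMeasurable F volume) :
    ∫ t, F t = h ^ d * ∫ ξ in torusBox d h, F (toUnitTorus d h ξ) := by
  have hT := measurePreserving_toUnitTorus d hh
  rw [← hT.map_eq, integral_map hT.aemeasurable (hT.map_eq ▸ hF), integral_smul_measure,
    ENNReal.toReal_ofReal (by positivity), Complex.real_smul, Complex.ofReal_pow]

theorem memLp_comp_torusSection (d : ℕ) {h : ℝ} (hh : 0 < h) {g : Euc d → ℂ} (hgm : Measurable g)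
    (hg : MemLp g 2 (volume.restrict (torusBox d h))) :
    MemLp (g ∘ torusSection d h) 2 volume := by
  have hT := measurePreserving_toUnitTorus d hh
  have hm := hgm.comp (measurable_torusSection d h)
  rw [← hT.map_eq, memLp_map_measure_iff hm.aestronglyMeasurable hT.aemeasurable]
  refine MemLp.smul_measure ((memLp_congr_ae ?_).2 hg) ENNReal.ofReal_ne_top
  filter_upwards [ae_restrict_mem (measurableSet_torusBox d h)] with ξ hξ
  simp [torusSection_toUnitTorus hh hξ]

theorem mFourierCoeff_comp_torusSection (d : ℕ) {h : ℝ} (hh : 0 < h) {g : Euc d → ℂ}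
    (hgm : Measurable g) (z : Zd d) :
    UnitAddTorus.mFourierCoeff (g ∘ torusSection d h) z
      = h ^ d * ∫ ξ in torusBox d h,
        Complex.exp (-(2 * π * Complex.I * (⟪latPt d h z, ξ⟫_ℝ : ℂ))) * g ξ := by
  have hm := hgm.comp (measurable_torusSection d h)
  rw [UnitAddTorus.mFourierCoeff, integral_unitAddTorus_eq d hh
    (F := fun t => UnitAddTorus.mFourier (-z) t • (g ∘ torusSection d h) t)
    ((UnitAddTorus.mFourier (-z)).continuous.measurable.smul hm).aestronglyMeasurable]
  congr 1
  refine setIntegral_congr_fun (measurableSet_torusBox d h) fun ξ hξ => ?_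
  have hneg : latPt d h (-z) = -latPt d h z := by
    ext j; simp [latPt, EuclideanSpace.equiv]
  simp only [mFourier_toUnitTorus, Function.comp_apply, torusSection_toUnitTorus hh hξ, hneg,
    inner_neg_left, Complex.ofReal_neg, mul_neg, smul_eq_mul]

/-- Parseval's identity on the torus `h⁻¹𝕋^d`. -/
theorem hasSum_mul_discFourierInv (d : ℕ) {h : ℝ} (hh : 0 < h) {p g : Euc d → ℂ}
    (hpm : Measurable p) (hgm : Measurable g) (hp : MemLp p 2 (volume.restrict (torusBox d h)))
    (hg : MemLp g 2 (volume.restrict (torusBox d h))) :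
    HasSum (fun z => h ^ d * (∫ ξ in torusBox d h,
        Complex.exp (-(2 * π * Complex.I * (⟪latPt d h z, ξ⟫_ℝ : ℂ))) * p ξ)
        * discFourierInv d h g z)
      (∫ ξ in torusBox d h, p ξ * g ξ) := by
  have hgm' : Measurable fun ξ => conj (g ξ) := by fun_prop
  have hg' := memLp_comp_torusSection d hh hgm' hg.star
  have hp' := memLp_comp_torusSection d hh hpm hp
  have key := UnitAddTorus.hasSum_prod_mFourierCoeff (hg'.toLp _) (hp'.toLp _)
  have hcoeff {u : UnitAddTorus (Fin d) → ℂ} (hu : MemLp u 2 volume) (z : Zd d) :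
      UnitAddTorus.mFourierCoeff (hu.toLp u) z = UnitAddTorus.mFourierCoeff u z :=
    integral_congr_ae <| by filter_upwards [hu.coeFn_toLp] with t ht; rw [ht]
  have hint : ∫ t, conj (hg'.toLp _ t) * hp'.toLp _ t
      = h ^ d * ∫ ξ in torusBox d h, p ξ * g ξ := by
    have : ∫ t, conj (hg'.toLp _ t) * hp'.toLp _ t
        = ∫ t, (fun ξ => p ξ * g ξ) (torusSection d h t) := integral_congr_ae <| by
      filter_upwards [hg'.coeFn_toLp, hp'.coeFn_toLp] with t h1 h2
      rw [h1, h2]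
      simp [mul_comm]
    rw [this, integral_unitAddTorus_eq d hh
      (F := fun t => (fun ξ => p ξ * g ξ) (torusSection d h t)) ((hpm.mul hgm).comp (measurable_torusSection d h)).aestronglyMeasurable]
    congr 1
    refine setIntegral_congr_fun (measurableSet_torusBox d h) fun ξ hξ => ?_
    simp only [torusSection_toUnitTorus hh hξ]
  have hz : (h ^ d : ℂ) ≠ 0 := by simp [hh.ne']
  rw [hint] at key
  refine ((hasSum_mul_left_iff hz).1 (key.congr_fun fun z => ?_))
  rw [hcoeff, hcoeff, mFourierCoeff_comp_torusSection d hh hgm',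
    mFourierCoeff_comp_torusSection d hh hpm, map_mul, ← integral_conj, discFourierInv]
  have : ∀ ξ, conj (Complex.exp (-(2 * π * Complex.I * (⟪latPt d h z, ξ⟫_ℝ : ℂ))) * conj (g ξ))
      = Complex.exp (2 * π * Complex.I * (⟪latPt d h z, ξ⟫_ℝ : ℂ)) * g ξ := fun ξ => by
    rw [map_mul, ← Complex.exp_conj]
    simp [map_ofNat]
  simp only [this]
  simp
  ring

theorem fourier_comp_inv_smul_sub (d : ℕ) {h : ℝ} (hh : 0 < h) (φ : Euc d → ℂ) (a ξ : Euc d) :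
    𝓕 (fun x => φ (h⁻¹ • (x - a))) ξ
      = h ^ d * (Complex.exp (-(2 * π * Complex.I * (⟪a, ξ⟫_ℝ : ℂ))) * 𝓕 φ (h • ξ)) := by
  rw [Real.fourier_eq', Real.fourier_eq', ← integral_const_mul, ← integral_add_right_eq_self _ a]
  have := Measure.integral_comp_inv_smul (volume : Measure (Euc d)) (fun y =>
    Complex.exp (-(2 * π * Complex.I * (⟪a, ξ⟫_ℝ : ℂ))) *
      (Complex.exp (↑(-2 * π * ⟪y, h • ξ⟫_ℝ) * Complex.I) • φ y)) h
  rw [finrank_euclideanSpace_fin, abs_of_nonneg (by positivity), Complex.real_smul,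
    Complex.ofReal_pow] at this
  rw [← this]
  refine integral_congr_ae (.of_forall fun x => ?_)
  simp only [add_sub_cancel_right, inner_add_left, real_inner_smul_left, real_inner_smul_right,
    mul_inv_cancel_left₀ hh.ne', smul_eq_mul]
  rw [← mul_assoc, ← Complex.exp_add]
  congr 2
  push_cast
  ring

theorem integral_mul_conj_fourierInv (d : ℕ) {u f : Euc d → ℂ} (hu : Integrable u)
    (hf : Integrable f) :
    ∫ x, u x * conj (𝓕⁻ f x) = ∫ ξ, 𝓕 u ξ * conj (f ξ) := by
  have hconj : ∀ x, conj (𝓕⁻ f x) = 𝓕 (fun ξ => conj (f ξ)) x := fun x => by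
    rw [Real.fourierInv_eq', Real.fourier_eq', ← integral_conj]
    refine integral_congr_ae (.of_forall fun ξ => ?_)
    simp only [smul_eq_mul, map_mul, ← Complex.exp_conj, Complex.conj_ofReal, Complex.conj_I]
    congr 2
    push_cast
    ring
  simp only [hconj]
  have := VectorFourier.integral_fourierIntegral_smul_eq_flip (L := innerₗ (Euc d))
    (μ := volume) (ν := volume) Real.continuous_fourierChar continuous_inner hu
    (f := u) (g := fun ξ => conj (f ξ)) ((LinearIsometryEquiv.integrable_comp_iff conjLIE).2 hf)
  simp only [flip_innerₗ, smul_eq_mul] at this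
  exact this.symm

theorem exp_inner_latPt_add (d : ℕ) {h : ℝ} (hh : 0 < h) (z n : Zd d) (ξ : Euc d) :
    Complex.exp (-(2 * π * Complex.I * (⟪latPt d h z, ξ + h⁻¹ • latVec d n⟫_ℝ : ℂ)))
      = Complex.exp (-(2 * π * Complex.I * (⟪latPt d h z, ξ⟫_ℝ : ℂ))) := by
  have hint : ⟪latPt d h z, h⁻¹ • latVec d n⟫_ℝ = ((∑ j, z j * n j : ℤ) : ℝ) := by
    simp only [latPt, latVec, EuclideanSpace.equiv, PiLp.inner_apply, PiLp.smul_apply,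
      PiLp.continuousLinearEquiv_symm_apply, RCLike.inner_apply, conj_trivial, smul_eq_mul]
    push_cast
    refine Finset.sum_congr rfl fun j _ => ?_
    field_simp
  rw [inner_add_right, hint, Complex.exp_eq_exp_iff_exists_int]
  refine ⟨-∑ j, z j * n j, ?_⟩
  push_cast
  ring

theorem enorm_discFourierInv_le (d : ℕ) (h : ℝ) (g : Euc d → ℂ) (z : Zd d) :
    ‖discFourierInv d h g z‖ₑ ≤ ∫⁻ ξ in torusBox d h, ‖g ξ‖ₑ := by
  refine (enorm_integral_le_lintegral_enorm _).trans (lintegral_mono fun ξ => ?_)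
  rw [enorm_mul, ← ofReal_norm (Complex.exp _), Complex.norm_exp]
  simp

theorem exists_tsum_enorm_comp_inv_smul_le (d : ℕ) {h : ℝ} (hh : 0 < h)
    (φ : SchwartzMap (Euc d) ℂ) :
    ∃ C : ENNReal, C ≠ ⊤ ∧ ∀ x, ∑' z, ‖φ (h⁻¹ • (x - latPt d h z))‖ₑ ≤ C := by
  obtain ⟨C, hC, hφ⟩ := exists_tsum_enorm_le d one_pos φ
  refine ⟨C, hC, fun x => (le_of_eq ?_).trans (hφ (h⁻¹ • x))⟩
  rw [← (Equiv.neg (Zd d)).tsum_eq]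
  refine tsum_congr fun z => ?_
  congr 2
  ext j
  simp [latPt, latVec, EuclideanSpace.equiv, mul_add, hh.ne']

theorem integral_tsum_mul_conj_fourierInv (d : ℕ) {h : ℝ} (hh : 0 < h)
    (φ f : SchwartzMap (Euc d) ℂ) {c : Zd d → ℂ} {D : ENNReal} (hD : D ≠ ⊤)
    (hc : ∀ z, ‖c z‖ₑ ≤ D) :
    ∫ x, (∑' z : Zd d, φ (h⁻¹ • (x - latPt d h z)) * c z) * conj (𝓕⁻ (⇑f) x)
      = ∑' z, h ^ d * (∫ ξ, Complex.exp (-(2 * π * Complex.I * (⟪latPt d h z, ξ⟫_ℝ : ℂ)))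
          * (𝓕 ⇑φ (h • ξ) * conj (f ξ))) * c z := by
  obtain ⟨C, hC, hφ⟩ := exists_tsum_enorm_comp_inv_smul_le d hh φ
  have hfi : Integrable (𝓕⁻ ⇑f) := by
    rw [← SchwartzMap.fourierInv_coe]; exact (𝓕⁻ f).integrable
  have hfm : Measurable (𝓕⁻ ⇑f) := by
    rw [← SchwartzMap.fourierInv_coe]; exact (𝓕⁻ f).continuous.measurable
  have hφm : ∀ z, Measurable fun x => φ (h⁻¹ • (x - latPt d h z)) := fun z =>
    φ.continuous.measurable.comp (by fun_prop)
  have hm : ∀ z, Measurable fun x => φ (h⁻¹ • (x - latPt d h z)) * c z * conj (𝓕⁻ (⇑f) x) :=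
    fun z => by have := hφm z; fun_prop
  simp only [← tsum_mul_right]
  rw [integral_tsum fun z => (hm z).aestronglyMeasurable]
  · refine tsum_congr fun z => ?_
    have hφi : Integrable fun x => φ (h⁻¹ • (x - latPt d h z)) :=
      ((integrable_comp_smul_iff volume (⇑φ) (inv_ne_zero hh.ne')).2 φ.integrable).comp_sub_right _
    rw [← integral_const_mul, mul_comm _ (c z)]
    calc ∫ x, φ (h⁻¹ • (x - latPt d h z)) * c z * conj (𝓕⁻ (⇑f) x)
        = c z * ∫ x, φ (h⁻¹ • (x - latPt d h z)) * conj (𝓕⁻ (⇑f) x) := by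
          rw [← integral_const_mul]
          exact integral_congr_ae (.of_forall fun x => by ring)
      _ = _ := by
          rw [integral_mul_conj_fourierInv d hφi f.integrable]
          congr 1
          refine integral_congr_ae (.of_forall fun ξ => ?_)
          simp only [fourier_comp_inv_smul_sub d hh]
          ring
  · rw [← lintegral_tsum fun z => (hm z).enorm.aemeasurable]
    refine ne_top_of_le_ne_top (ENNReal.mul_ne_top (ENNReal.mul_ne_top hC hD) hfi.2.ne) ?_
    rw [← lintegral_const_mul _ hfm.enorm]
    refine lintegral_mono fun x => ?_
    simp only [enorm_mul, RCLike.enorm_conj]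
    rw [ENNReal.tsum_mul_right]
    gcongr
    calc ∑' z, ‖φ (h⁻¹ • (x - latPt d h z))‖ₑ * ‖c z‖ₑ
        ≤ ∑' z, ‖φ (h⁻¹ • (x - latPt d h z))‖ₑ * D :=
          ENNReal.tsum_le_tsum fun z => by gcongr; exact hc z
      _ ≤ C * D := by rw [ENNReal.tsum_mul_right]; gcongr; exact hφ x

/-- For `φ ∈ 𝒮(ℝ^d)`, `h > 0` and `g ∈ L²(h⁻¹𝕋^d)` (realized as an
`h⁻¹ℤ^d`-periodic function on `ℝ^d`, square integrable on a fundamental domain), the adjoint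
`Q_h* = 𝓕 P_h* F_h*` of `Q_h = F_h P_h 𝓕*` satisfies `Q_h* g(ξ) = φ̂(hξ) g̃(ξ)` a.e.;
equivalently, the Fourier transform of `Ψ = P_h* F_h* g`, i.e.
`Ψ(x) = ∑_{z∈hℤ^d} φ(h⁻¹(x−z)) (F_h* g)(z)`, equals `ξ ↦ φ̂(hξ) g̃(ξ)` — stated here,
as an identity of square-integrable functions, in the weak (Parseval) form
`⟨Ψ, 𝓕⁻ f⟩ = ⟨φ̂(h·) g̃, f⟩` against every Schwartz function `f`. -/
theorem adjoint_of_Qh_eq_fourier_multiplier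
    (d : ℕ) (φ : SchwartzMap (Euc d) ℂ) (h : ℝ) (hh : 0 < h)
    (g : Euc d → ℂ) (hgm : Measurable g)
    (hgper : ∀ ξ : Euc d, ∀ n : Zd d, g (ξ + h⁻¹ • latVec d n) = g ξ)
    (hg2 : MemLp g 2 (volume.restrict (torusBox d h))) :
    ∀ f : SchwartzMap (Euc d) ℂ,
      (∫ x, (∑' z : Zd d, φ (h⁻¹ • (x - latPt d h z)) * discFourierInv d h g z) *
          conj (𝓕⁻ (⇑f) x))
      = ∫ ξ, 𝓕 ⇑φ (h • ξ) * g ξ * conj (f ξ) := by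
  intro f
  have hbox := measurableSet_torusBox d h
  have hfin : IsFiniteMeasure (volume.restrict (torusBox d h)) :=
    isFiniteMeasure_restrict.2 (by rw [volume_torusBox d hh]; exact ENNReal.ofReal_ne_top)
  have hD : ∫⁻ ξ in torusBox d h, ‖g ξ‖ₑ ≠ ⊤ := (hg2.integrable one_le_two).2.ne
  rw [integral_tsum_mul_conj_fourierInv d hh φ f hD (enorm_discFourierInv_le d h g)]
  set G : Euc d → ℂ := fun ξ => 𝓕 ⇑φ (h • ξ) * conj (f ξ) with hG
  have hGm : Measurable G := by
    rw [hG, ← SchwartzMap.fourier_coe]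
    exact Continuous.measurable (by fun_prop)
  obtain ⟨B, hB⟩ : ∃ B : ℝ, ∀ ξ, ‖𝓕 ⇑φ ξ‖ ≤ B := by
    rw [← SchwartzMap.fourier_coe]
    exact ⟨_, SchwartzMap.norm_le_seminorm ℝ (𝓕 φ)⟩
  have hGf : ∀ ξ, ‖G ξ‖ₑ ≤ ENNReal.ofReal B * ‖f ξ‖ₑ := fun ξ => by
    simp only [hG, enorm_mul, RCLike.enorm_conj]
    gcongr
    rw [← ofReal_norm]
    exact ENNReal.ofReal_le_ofReal (hB _)
  obtain ⟨C, hC, hfC⟩ := exists_tsum_enorm_le d hh f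
  have hGC : ∀ ξ, ∑' n, ‖G (ξ + h⁻¹ • latVec d n)‖ₑ ≤ ENNReal.ofReal B * C := fun ξ => by
    refine (ENNReal.tsum_le_tsum fun n => hGf _).trans ?_
    rw [ENNReal.tsum_mul_left]
    gcongr
    exact hfC ξ
  have hBC : ENNReal.ofReal B * C ≠ ⊤ := ENNReal.mul_ne_top ENNReal.ofReal_ne_top hC
  have hGi : Integrable G := by
    refine ⟨hGm.aestronglyMeasurable, lt_of_le_of_lt (lintegral_mono hGf) ?_⟩
    rw [lintegral_const_mul' _ _ ENNReal.ofReal_ne_top]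
    exact ENNReal.mul_lt_top ENNReal.ofReal_lt_top f.integrable.2
  have hGgi : Integrable fun ξ => G ξ * g ξ := by
    refine ⟨(hGm.mul hgm).aestronglyMeasurable, ?_⟩
    rw [hasFiniteIntegral_iff_enorm, lintegral_eq_lintegral_torusBox_tsum d hh (by fun_prop)]
    simp only [enorm_mul, hgper, ENNReal.tsum_mul_right]
    refine lt_of_le_of_lt (lintegral_mono fun ξ => mul_le_mul_left (hGC ξ) _) ?_
    rw [lintegral_const_mul' _ _ hBC]
    exact ENNReal.mul_lt_top hBC.lt_top hD.lt_top
  let p : Euc d → ℂ := fun ξ => ∑' n, G (ξ + h⁻¹ • latVec d n)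
  have hpm : Measurable p := Measurable.tsum fun n => by fun_prop
  have hp : MemLp p 2 (volume.restrict (torusBox d h)) := by
    refine MemLp.of_bound hpm.aestronglyMeasurable (ENNReal.ofReal B * C).toReal
      (.of_forall fun ξ => ?_)
    rw [← toReal_enorm]
    exact ENNReal.toReal_mono hBC (enorm_tsum_le_tsum_enorm.trans (hGC ξ))
  have hper : ∀ z, ∫ ξ, Complex.exp (-(2 * π * Complex.I * (⟪latPt d h z, ξ⟫_ℝ : ℂ))) * G ξ
      = ∫ ξ in torusBox d h,
        Complex.exp (-(2 * π * Complex.I * (⟪latPt d h z, ξ⟫_ℝ : ℂ))) * p ξ := fun z => by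
    rw [integral_eq_integral_torusBox_tsum d hh (by fun_prop)]
    · simp only [exp_inner_latPt_add d hh, tsum_mul_left, p]
    · refine hGi.bdd_mul (c := 1) (Measurable.aestronglyMeasurable (by fun_prop))
        (.of_forall fun ξ => ?_)
      rw [Complex.norm_exp]
      simp
  refine (tsum_congr fun z =>
    congrArg (fun w : ℂ => (h : ℂ) ^ d * w * discFourierInv d h g z) (hper z)).trans ?_
  rw [(hasSum_mul_discFourierInv d hh hpm hgm hp hg2).tsum_eq]
  calc ∫ ξ in torusBox d h, p ξ * g ξ = ∫ ξ, G ξ * g ξ := by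
        rw [integral_eq_integral_torusBox_tsum d hh (by fun_prop) hGgi]
        simp only [hgper, tsum_mul_right, p]
    _ = _ := integral_congr_ae (.of_forall fun ξ => by simp only [hG]; ring)
end
end
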